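/- For every positive integer m there exists an integer D(m) with the following property: for all integers d ≥ D(m), all r ≥ 1 and all multiplicities m_1, …, m_r with 1 ≤ m_i ≤ m such that χ := (d+1)(d+2)/2 − Σ_{i=1}^r m_i(m_i+1)/2 ≥ 1, there is a dense Zariski-open subset U of (ℙ²(ℂ))^r consisting of tuples of pairwise distinct points such that for every (P_1,…,P_r) ∈ U: the vector space L_d(P,m) has dimension exactly χ, and there is a dense Zariski-open subset W of the projective space ℙ(L_d(P,m)) such that every [F] ∈ W is represented by an irreducible polynomial F which has an ordinary singularity of multiplicity exactly m_i at each P_i and whose zero curve is smooth away from P_1, …, P_r. -/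

import Mathlib

open MvPolynomial

noncomputable section

abbrev Proj2 := Projectivization ℂ (Fin 3 → ℂ)

/-- The iterated partial derivative operator `∂₀^{k 0} ∂₁^{k 1} ∂₂^{k 2}`. -/
def diffOp (k : Fin 3 → ℕ) : MvPolynomial (Fin 3) ℂ →ₗ[ℂ] MvPolynomial (Fin 3) ℂ :=
  (((pderiv (0 : Fin 3)).toLinearMap ^ k 0) * ((pderiv (1 : Fin 3)).toLinearMap ^ k 1) *
    ((pderiv (2 : Fin 3)).toLinearMap ^ k 2) :
    Module.End ℂ (MvPolynomial (Fin 3) ℂ))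

/-- Polynomials all of whose partial derivatives of total order `< m` vanish at `p`. -/
def vanishingSubmodule (m : ℕ) (p : Fin 3 → ℂ) : Submodule ℂ (MvPolynomial (Fin 3) ℂ) :=
  ⨅ k ∈ {k : Fin 3 → ℕ | k 0 + k 1 + k 2 < m},
    LinearMap.ker ((aeval p).toLinearMap ∘ₗ diffOp k)

/-- The space of homogeneous polynomials of degree `d` vanishing to order at least `mi i`
at the point `P i`, for each `i`. -/
def Lspace (d : ℕ) {r : ℕ} (P : Fin r → Proj2) (mi : Fin r → ℕ) :
    Submodule ℂ (MvPolynomial (Fin 3) ℂ) :=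
  homogeneousSubmodule (Fin 3) ℂ d ⊓ ⨅ i, vanishingSubmodule (mi i) (P i).rep

/-- The Zariski topology on a complex vector space: generated by the nonvanishing loci of
polynomial functions (polynomials in finitely many linear forms). -/
def vectorZariski (V : Type*) [AddCommGroup V] [Module ℂ V] : TopologicalSpace V :=
  TopologicalSpace.generateFrom
    { U | ∃ (n : ℕ) (f : MvPolynomial (Fin n) ℂ) (φ : Fin n → (V →ₗ[ℂ] ℂ)),
        U = {v | MvPolynomial.eval (fun i => φ i v) f ≠ 0} }

/-- The Zariski topology on the space of `r`-tuples of points of `ℙ²(ℂ)`, obtained as the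
quotient topology from the Zariski topology on tuples of nonzero vectors in `ℂ³`. -/
def projTupleZariski (r : ℕ) : TopologicalSpace (Fin r → Proj2) :=
  TopologicalSpace.coinduced
    (fun v : {v : Fin r → Fin 3 → ℂ // ∀ i, v i ≠ 0} =>
      fun i => Projectivization.mk ℂ (v.1 i) (v.2 i))
    (TopologicalSpace.induced Subtype.val (vectorZariski (Fin r → Fin 3 → ℂ)))

/-- The Zariski topology on the projectivization of a complex vector space. -/
def projZariski (V : Type*) [AddCommGroup V] [Module ℂ V] :
    TopologicalSpace (Projectivization ℂ V) :=
  TopologicalSpace.coinduced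
    (fun v : {v : V // v ≠ 0} => Projectivization.mk ℂ v.1 v.2)
    (TopologicalSpace.induced Subtype.val (vectorZariski V))

/-- The dehomogenization of `F` in the affine chart `(x, y) ↦ A ⬝ (x, y, 1)`. -/
def chartPoly (A : Matrix (Fin 3) (Fin 3) ℂ) (F : MvPolynomial (Fin 3) ℂ) :
    MvPolynomial (Fin 2) ℂ :=
  aeval (fun j : Fin 3 => ∑ i : Fin 3, C (A j i) * ![X 0, X 1, (1 : MvPolynomial (Fin 2) ℂ)] i) F

/-- `F` has an ordinary singularity of multiplicity `m` at `P`: in some affine chart centered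
at `P`, the lowest-degree homogeneous part of the dehomogenization of `F` has degree exactly
`m` and is a squarefree binary form. -/
def HasOrdinarySingularity (m : ℕ) (P : Proj2) (F : MvPolynomial (Fin 3) ℂ) : Prop :=
  ∃ A : Matrix (Fin 3) (Fin 3) ℂ, IsUnit A.det ∧
    ∃ h : A.mulVec ![0, 0, 1] ≠ 0,
      Projectivization.mk ℂ (A.mulVec ![0, 0, 1]) h = P ∧
      (∀ k < m, homogeneousComponent k (chartPoly A F) = 0) ∧
      homogeneousComponent m (chartPoly A F) ≠ 0 ∧
      Squarefree (homogeneousComponent m (chartPoly A F))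

/-- The curve `{F = 0}` is smooth away from the points `P i`: at every point of the curve
other than the `P i`, some first partial derivative of `F` is nonzero. -/
def SmoothAwayFrom {r : ℕ} (F : MvPolynomial (Fin 3) ℂ) (P : Fin r → Proj2) : Prop :=
  ∀ Q : Proj2, eval Q.rep F = 0 → (∀ i, Q ≠ P i) →
    ∃ j : Fin 3, eval Q.rep (pderiv j F) ≠ 0

section

open Filter Topology

/-- Every matrix over a domain has a generalized inverse after clearing denominators. -/
theorem exists_ginv {A m n : Type*} [CommRing A] [IsDomain A] [Fintype m] [Fintype n]
    [DecidableEq m] [DecidableEq n] (M : Matrix m n A) :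
    ∃ (q : A) (P : Matrix n m A), q ≠ 0 ∧ M * P * M = q • M := by
  classical
  let K := FractionRing A
  let f := Matrix.toLin' (M.map (algebraMap A K))
  obtain ⟨h, hh⟩ := LinearMap.exists_rightInverse_of_surjective f.rangeRestrict
    (LinearMap.range_rangeRestrict f)
  obtain ⟨g, hg⟩ := LinearMap.exists_extend h
  have hfg : f ∘ₗ g ∘ₗ f = f := by
    refine LinearMap.ext fun v => ?_
    have h1 : g (f v) = h (f.rangeRestrict v) := LinearMap.congr_fun hg (f.rangeRestrict v)
    have h2 := congrArg Subtype.val (LinearMap.congr_fun hh (f.rangeRestrict v))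
    simp only [LinearMap.comp_apply, LinearMap.id_apply] at h2
    exact (congrArg f h1).trans h2
  obtain ⟨b, hb⟩ := IsLocalization.exist_integer_multiples_of_finset (nonZeroDivisors A)
    (Finset.univ.image fun ij : n × m => LinearMap.toMatrix' g ij.1 ij.2)
  have hb' : ∀ i j, ∃ a : A, algebraMap A K a = (b : A) • LinearMap.toMatrix' g i j := fun i j =>
    hb _ (Finset.mem_image_of_mem (fun ij : n × m => LinearMap.toMatrix' g ij.1 ij.2)
      (Finset.mem_univ (i, j)))
  choose P hP using hb'
  refine ⟨b, P, nonZeroDivisors.coe_ne_zero b, ?_⟩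
  have hinj : Function.Injective (algebraMap A K) := IsFractionRing.injective A K
  apply Matrix.map_injective hinj
  have hP' : (Matrix.of P).map (algebraMap A K) = (b : A) • LinearMap.toMatrix' g := by
    ext i j; exact hP i j
  have hfg' : M.map (algebraMap A K) * LinearMap.toMatrix' g * M.map (algebraMap A K) =
      M.map (algebraMap A K) := by
    have := congrArg LinearMap.toMatrix' hfg
    simpa [LinearMap.toMatrix'_comp, f, Matrix.mul_assoc] using this
  change (M * Matrix.of P * M).map (algebraMap A K) = ((b : A) • M).map (algebraMap A K)
  rw [Matrix.map_mul, Matrix.map_mul, hP', Matrix.mul_smul, Matrix.smul_mul, hfg']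
  ext i j
  simp [Algebra.smul_def]

/-- A matrix over a domain has a kernel matrix `N`, whose columns lie in the kernel, and whose
specializations span the specialized kernel off the zeros of some nonzero `q`. -/
theorem exists_kerMatrix {A m n : Type*} [CommRing A] [IsDomain A] [Fintype m] [Fintype n]
    [DecidableEq m] [DecidableEq n] (M : Matrix m n A) :
    ∃ (q : A) (N : Matrix n n A), q ≠ 0 ∧ M * N = 0 ∧
      ∀ {k : Type} [Field k] (ε : A →+* k) (c : n → k), (M.map ε).mulVec c = 0 →
        (N.map ε).mulVec c = ε q • c := by
  obtain ⟨q, P, hq, hP⟩ := exists_ginv M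
  refine ⟨q, q • (1 : Matrix n n A) - P * M, hq, ?_, ?_⟩
  · rw [Matrix.mul_sub, Matrix.mul_smul, Matrix.mul_one, ← Matrix.mul_assoc, hP, sub_self]
  · intro k _ ε c hc
    have h1 : (q • (1 : Matrix n n A) - P * M).map ε =
        ε q • (1 : Matrix n n k) - P.map ε * M.map ε := by
      have h2 := Matrix.map_mul (L := P) (M := M) (f := ε)
      ext i j
      have h3 := congrFun (congrFun h2 i) j
      rw [Matrix.sub_apply, ← h3]
      by_cases hij : i = j <;> simp [hij]
    rw [h1, Matrix.sub_mulVec, ← Matrix.mulVec_mulVec, hc, Matrix.mulVec_zero, sub_zero,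
      Matrix.smul_mulVec, Matrix.one_mulVec]

theorem eventually_eval_ne_zero {q : Polynomial ℂ} (hq : q ≠ 0) (z : ℂ) :
    ∀ᶠ t in 𝓝[≠] z, q.eval t ≠ 0 := by
  have hf : (q.roots.toFinset : Set ℂ).Finite := Finset.finite_toSet _
  have : ∀ᶠ t in 𝓝[≠] z, t ∉ (q.roots.toFinset : Set ℂ) := by
    have h := (hf.subset (Set.sdiff_subset (t := {z}))).isClosed.isOpen_compl.mem_nhds
      (x := z) (by simp)
    filter_upwards [nhdsWithin_le_nhds h, self_mem_nhdsWithin] with t ht htz hmem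
    exact ht ⟨hmem, htz⟩
  filter_upwards [this] with t ht h0
  exact ht (by simp [hq, h0, Polynomial.IsRoot])

/-- Semicontinuity of the kernel of a matrix depending polynomially on one parameter. -/
theorem kernel_limit_of_ne_zero {m n : Type*} [Fintype m] [Fintype n]
    [DecidableEq m] [DecidableEq n] (M : Matrix m n (Polynomial ℂ)) (S : Submodule ℂ (n → ℂ))
    (hS : ∀ c : n → Polynomial ℂ, M.mulVec c = 0 → (fun i => (c i).eval 0) ∈ S) :
    (∃ q : Polynomial ℂ, q ≠ 0 ∧ ∀ t, q.eval t ≠ 0 →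
      Module.finrank ℂ (LinearMap.ker (M.map (Polynomial.evalRingHom t)).mulVecLin) ≤
        Module.finrank ℂ S) ∧
    ((∃ᶠ t in 𝓝[≠] (0 : ℂ), Module.finrank ℂ S ≤
      Module.finrank ℂ (LinearMap.ker (M.map (Polynomial.evalRingHom t)).mulVecLin)) →
      ∀ s ∈ S, ∃ c : n → Polynomial ℂ, M.mulVec c = 0 ∧ (fun i => (c i).eval 0) = s) := by
  obtain ⟨q, N, hq, hMN, hN⟩ := exists_kerMatrix M
  let Λ := LinearMap.ker M.mulVecLin
  let b := Module.finBasis (Polynomial ℂ) Λ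
  set ρ := Module.finrank (Polynomial ℂ) Λ with hρ
  let ev (t : ℂ) : (n → Polynomial ℂ) →+ (n → ℂ) :=
    { toFun := fun c i => (c i).eval t
      map_zero' := by ext; simp
      map_add' := by intros; ext; simp }
  have hev : ∀ t (p : Polynomial ℂ) c, ev t (p • c) = p.eval t • ev t c := by
    intro t p c; ext i; simp [ev]
  have hspan : ∀ t, ∀ c ∈ Λ, ev t c ∈ Submodule.span ℂ (Set.range fun i => ev t (b i).1) := by
    intro t c hc
    have h := b.sum_repr ⟨c, hc⟩
    have h' : c = ∑ i, b.repr ⟨c, hc⟩ i • (b i).1 := by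
      have := congrArg Subtype.val h
      rw [Submodule.coe_sum] at this
      exact this.symm
    rw [h', map_sum]
    refine Submodule.sum_mem _ fun i _ => ?_
    rw [hev]
    exact Submodule.smul_mem _ _ (Submodule.subset_span ⟨i, rfl⟩)
  have hle : ∀ t, q.eval t ≠ 0 →
      Module.finrank ℂ (LinearMap.ker (M.map (Polynomial.evalRingHom t)).mulVecLin) ≤ ρ := by
    intro t ht
    have : LinearMap.ker (M.map (Polynomial.evalRingHom t)).mulVecLin ≤
        Submodule.span ℂ (Set.range fun i => ev t (b i).1) := by
      intro c hc
      have h1 := hN (Polynomial.evalRingHom t) c hc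
      have h2 : c = (q.eval t)⁻¹ • ev t (N.mulVec fun i => Polynomial.C (c i)) := by
        have : ev t (N.mulVec fun i => Polynomial.C (c i)) =
            (N.map (Polynomial.evalRingHom t)).mulVec c := by
          ext i
          simp [ev, Matrix.mulVec, dotProduct, Polynomial.eval_finsetSum]
        rw [this, h1]
        simp [smul_smul, ht]
      rw [h2]
      refine Submodule.smul_mem _ _ (hspan t _ ?_)
      simp only [Λ, LinearMap.mem_ker, Matrix.mulVecLin_apply, Matrix.mulVec_mulVec, hMN,
        Matrix.zero_mulVec]
    refine (Submodule.finrank_mono this).trans ?_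
    refine (finrank_range_le_card (R := ℂ) _).trans ?_
    simp
  have hli : LinearIndependent ℂ fun i => ev 0 (b i).1 := by
    rw [Fintype.linearIndependent_iff]
    intro α hα
    have h0 : ev 0 (∑ i, Polynomial.C (α i) • (b i).1) = 0 := by
      rw [map_sum, ← hα]
      refine Finset.sum_congr rfl fun i _ => ?_
      rw [hev]; simp
    have hX : ∀ i, ∃ w, (∑ i, Polynomial.C (α i) • (b i).1) i = Polynomial.X * w := by
      intro j
      have := congrFun h0 j
      exact Polynomial.X_dvd_iff.2 (by rw [Polynomial.coeff_zero_eq_eval_zero]; exact this)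
    choose w hw using hX
    have hw' : (∑ i, Polynomial.C (α i) • (b i).1) = (Polynomial.X : Polynomial ℂ) • w := by
      ext1 j; rw [hw]; rfl
    have hwΛ : w ∈ Λ := by
      have h1 : M.mulVec ((Polynomial.X : Polynomial ℂ) • w) = 0 := by
        rw [← hw']
        exact (Λ.sum_mem fun i _ => Λ.smul_mem _ (b i).2 : _ ∈ Λ)
      rw [Matrix.mulVec_smul] at h1
      exact (smul_eq_zero.1 h1).resolve_left Polynomial.X_ne_zero
    have h2 : ∑ i, Polynomial.C (α i) • b i = (Polynomial.X : Polynomial ℂ) • (⟨w, hwΛ⟩ : Λ) := by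
      apply Subtype.ext
      rw [Submodule.coe_smul, ← hw']
      simp
    intro i
    have h3 := congrArg (fun z => b.repr z i) h2
    have h4 : b.repr (∑ i, Polynomial.C (α i) • b i) i = Polynomial.C (α i) := by
      rw [Module.Basis.repr_sum_self]
    simp only [h4, map_smul, Finsupp.smul_apply, smul_eq_mul] at h3
    have := congrArg (Polynomial.eval 0) h3
    simpa using this
  have hsub : Submodule.span ℂ (Set.range fun i => ev 0 (b i).1) ≤ S := by
    rw [Submodule.span_le]
    rintro _ ⟨i, rfl⟩
    exact hS _ (b i).2
  have hspanrank : Module.finrank ℂ (Submodule.span ℂ (Set.range fun i => ev 0 (b i).1)) = ρ := by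
    rw [finrank_span_eq_card hli]; simp
  have hρS : ρ ≤ Module.finrank ℂ S := by
    rw [← hspanrank]
    exact Submodule.finrank_mono hsub
  refine ⟨?_, ?_⟩
  · exact ⟨q, hq, fun t ht => (hle t ht).trans hρS⟩
  · intro hfr s hs
    obtain ⟨t, ht1, ht2⟩ := (hfr.and_eventually (eventually_eval_ne_zero hq 0)).exists
    have heq : Submodule.span ℂ (Set.range fun i => ev 0 (b i).1) = S := by
      apply Submodule.eq_of_le_of_finrank_le hsub
      rw [hspanrank]
      exact ht1.trans (hle t ht2)
    rw [← heq, Submodule.mem_span_range_iff_exists_fun] at hs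
    obtain ⟨α, hα⟩ := hs
    refine ⟨∑ i, Polynomial.C (α i) • (b i).1,
      (Λ.sum_mem fun i _ => Λ.smul_mem _ (b i).2 : _ ∈ Λ), ?_⟩
    change ev 0 _ = s
    rw [map_sum, ← hα]
    refine Finset.sum_congr rfl fun i _ => ?_
    rw [hev]; simp

theorem kernel_limit {m n : Type*} [Fintype m] [Fintype n]
    [DecidableEq m] [DecidableEq n] (M : Matrix m n (Polynomial ℂ)) (S : Submodule ℂ (n → ℂ))
    (hS : ∀ c : n → Polynomial ℂ, M.mulVec c = 0 → (fun i => (c i).eval 0) ∈ S) :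
    (∀ᶠ t in 𝓝[≠] (0 : ℂ),
      Module.finrank ℂ (LinearMap.ker (M.map (Polynomial.evalRingHom t)).mulVecLin) ≤
        Module.finrank ℂ S) ∧
    ((∃ᶠ t in 𝓝[≠] (0 : ℂ), Module.finrank ℂ S ≤
      Module.finrank ℂ (LinearMap.ker (M.map (Polynomial.evalRingHom t)).mulVecLin)) →
      ∀ s ∈ S, ∃ c : n → Polynomial ℂ, M.mulVec c = 0 ∧ (fun i => (c i).eval 0) = s) := by
  obtain ⟨⟨q, hq, h⟩, h2⟩ := kernel_limit_of_ne_zero M S hS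
  exact ⟨(eventually_eval_ne_zero hq 0).mono h, h2⟩

/-- Elimination: a system of polynomial equations over a domain `A` without solutions in an
algebraic closure of the fraction field implies a nonzero element of `A`. -/
theorem exists_elim {A σ : Type*} (K Ω : Type*) [CommRing A] [IsDomain A] [Finite σ]
    [Field K] [Algebra A K] [IsFractionRing A K] [Field Ω] [IsAlgClosed Ω] [Algebra K Ω]
    [Algebra A Ω] [IsScalarTower A K Ω] (S : Set (MvPolynomial σ A)) :
    (∃ y : σ → Ω, ∀ f ∈ S, aeval y f = 0) ∨ ∃ a : A, a ≠ 0 ∧ C a ∈ Ideal.span S := by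
  classical
  let _ := MvPolynomial.algebraMvPolynomial (σ := σ) (R := A) (S := K)
  let J := (Ideal.span S).map (algebraMap (MvPolynomial σ A) (MvPolynomial σ K))
  by_cases hJ : J = ⊤
  · right
    have := MvPolynomial.isLocalization (σ := σ) (nonZeroDivisors A) K
    have h := (IsLocalization.map_algebraMap_ne_top_iff_disjoint
      (Submonoid.map C (nonZeroDivisors A)) (MvPolynomial σ K) (Ideal.span S)).not_right.1 hJ
    rw [Set.not_disjoint_iff] at h
    obtain ⟨_, ⟨a, ha, rfl⟩, h2⟩ := h
    exact ⟨a, nonZeroDivisors.ne_zero ha, h2⟩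
  · left
    obtain ⟨m, hm, hJm⟩ := Ideal.exists_le_maximal J hJ
    obtain ⟨x, hx⟩ := eq_vanishingIdeal_singleton_of_isMaximal Ω hm
    refine ⟨x, fun f hf => ?_⟩
    have h1 : algebraMap (MvPolynomial σ A) (MvPolynomial σ K) f ∈ m :=
      hJm (Ideal.mem_map_of_mem _ (Ideal.subset_span hf))
    rw [hx, mem_vanishingIdeal_singleton_iff] at h1
    rw [← h1]
    exact (aeval_map_algebraMap K x f).symm

/-- A point with algebraic coordinates over the fraction field of `A` specializes along all
surjections `A → ℂ` which do not kill a suitable nonzero element. -/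
theorem exists_specialization {A σ : Type*} (K Ω : Type*) [CommRing A] [IsDomain A] [Finite σ]
    [Field K] [Algebra A K] [IsFractionRing A K] [Field Ω] [Algebra K Ω] [Algebra.IsAlgebraic K Ω]
    [Algebra A Ω] [IsScalarTower A K Ω] (y : σ → Ω) :
    ∃ b : A, b ≠ 0 ∧ ∀ ε : A →+* ℂ, Function.Surjective ε → ε b ≠ 0 →
      ∃ z : σ → ℂ, ∀ f : MvPolynomial σ A, aeval y f = 0 → eval₂ ε z f = 0 := by
  classical
  have := Fintype.ofFinite σ
  have halg : ∀ j, ∃ b : A, b ≠ 0 ∧ IsIntegral A (b • y j) := fun j => by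
    have h1 : IsAlgebraic K (y j) := Algebra.IsAlgebraic.isAlgebraic _
    exact ((IsFractionRing.isAlgebraic_iff A K Ω).2 h1).exists_integral_multiple
  choose b hb hbint using halg
  refine ⟨∏ j, b j, Finset.prod_ne_zero_iff.2 fun j _ => hb j, fun ε hε hεb => ?_⟩
  set β := ∏ j, b j with hβ
  have hβ0 : β ≠ 0 := Finset.prod_ne_zero_iff.2 fun j _ => hb j
  let A' := Localization.Away β
  have hinjA : Function.Injective (algebraMap A Ω) := by
    rw [IsScalarTower.algebraMap_eq A K Ω]
    exact (algebraMap K Ω).injective.comp (IsFractionRing.injective A _)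
  have hunit : IsUnit (algebraMap A Ω β) :=
    isUnit_iff_ne_zero.2 ((map_ne_zero_iff _ hinjA).2 hβ0)
  let l : A' →+* Ω := IsLocalization.Away.lift β hunit
  let : Algebra A' Ω := l.toAlgebra
  have hl : ∀ a, algebraMap A' Ω (algebraMap A A' a) = algebraMap A Ω a := fun a =>
    IsLocalization.Away.lift_eq β hunit a
  have : IsScalarTower A A' Ω := IsScalarTower.of_algebraMap_eq fun a => (hl a).symm
  have hlinj : Function.Injective (algebraMap A' Ω) :=
    IsLocalization.lift_injective_iff (M := Submonoid.powers β) (S := A') _ |>.2 fun a c => by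
      constructor
      · intro h
        rw [IsLocalization.eq_iff_exists (Submonoid.powers β) A'] at h
        obtain ⟨⟨_, n, rfl⟩, h⟩ := h
        have := congrArg (algebraMap A Ω) h
        simp only [map_mul, map_pow] at this
        exact mul_left_cancel₀ (pow_ne_zero _ hunit.ne_zero) this
      · intro h; rw [hinjA h]
  let Cl := integralClosure A' Ω
  have hyint : ∀ j, y j ∈ Cl := fun j => by
    have h1 : IsIntegral A' (b j • y j) := (hbint j).tower_top
    have hdvd : b j ∣ β := Finset.dvd_prod_of_mem b (Finset.mem_univ j)
    have hub : IsUnit (algebraMap A A' (b j)) :=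
      isUnit_of_dvd_unit (map_dvd _ hdvd) (IsLocalization.Away.algebraMap_isUnit β)
    obtain ⟨u, hu⟩ := hub
    have h2 : y j = ((u⁻¹ : A'ˣ) : A') • (b j • y j) := by
      rw [← algebraMap_smul A' (b j) (y j), ← hu, smul_smul]; simp
    rw [h2]
    exact Cl.smul_mem h1 _
  let ε' : A' →+* ℂ := IsLocalization.Away.lift β (isUnit_iff_ne_zero.2 hεb)
  have hε' : ∀ a, ε' (algebraMap A A' a) = ε a := fun a => IsLocalization.Away.lift_eq β _ a
  have hε's : Function.Surjective ε' := fun z => by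
    obtain ⟨a, rfl⟩ := hε z
    exact ⟨_, hε' a⟩
  have hmax : (RingHom.ker ε').IsMaximal := RingHom.ker_isMaximal_of_surjective ε' hε's
  have hinj' : Function.Injective (algebraMap A' Cl) := fun a c h => by
    apply hlinj
    exact congrArg (algebraMap Cl Ω) h
  obtain ⟨Q, hQ, hQc⟩ := Ideal.exists_ideal_over_maximal_of_isIntegral (S := Cl)
    (RingHom.ker ε') (by rw [(RingHom.injective_iff_ker_eq_bot _).1 hinj']; exact bot_le)
  let e : (A' ⧸ RingHom.ker ε') ≃+* ℂ := RingHom.quotientKerEquivOfSurjective hε's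
  let g : (A' ⧸ RingHom.ker ε') →+* (Cl ⧸ Q) := Ideal.quotientMap Q (algebraMap A' Cl) hQc.ge
  have hgint : g.IsIntegral := by
    have h1 : (algebraMap A' Cl).IsIntegral := algebraMap_isIntegral_iff.2 inferInstance
    have h2 : ((Ideal.Quotient.mk Q).comp (algebraMap A' Cl)).IsIntegral :=
      RingHom.IsIntegral.trans _ _ h1
        (RingHom.isIntegral_of_surjective _ Ideal.Quotient.mk_surjective)
    have h3 : g.comp (Ideal.Quotient.mk _) = (Ideal.Quotient.mk Q).comp (algebraMap A' Cl) :=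
      Ideal.quotientMap_comp_mk _
    rw [← h3] at h2
    exact RingHom.IsIntegral.tower_top _ _ h2
  have hfint : (g.comp (e.symm : ℂ →+* _)).IsIntegral :=
    RingHom.IsIntegral.trans _ _ (RingHom.isIntegral_of_surjective _ e.symm.surjective) hgint
  have hbij := IsAlgClosed.ringHom_bijective_of_isIntegral _ hfint
  let e2 := RingEquiv.ofBijective _ hbij
  let θ : Cl →+* ℂ := (e2.symm : (Cl ⧸ Q) →+* ℂ).comp (Ideal.Quotient.mk Q)
  have hθ : ∀ a : A', θ (algebraMap A' Cl a) = ε' a := fun a => by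
    change e2.symm _ = _
    rw [RingEquiv.symm_apply_eq]
    change _ = g (e.symm (ε' a))
    have h4 : e.symm (ε' a) = Ideal.Quotient.mk _ a := by
      rw [RingEquiv.symm_apply_eq]; rfl
    rw [h4]
    rfl
  refine ⟨fun j => θ ⟨y j, hyint j⟩, fun f hf => ?_⟩
  let yc : σ → Cl := fun j => ⟨y j, hyint j⟩
  have h5 : eval₂ ((algebraMap A' Cl).comp (algebraMap A A')) yc f = 0 := by
    apply Subtype.val_injective
    have : (algebraMap Cl Ω) (eval₂ ((algebraMap A' Cl).comp (algebraMap A A')) yc f) =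
        aeval y f := by
      rw [MvPolynomial.hom_eval₂, aeval_def]
      congr 1
      ext a
      exact hl a
    exact this.trans hf
  have h6 := congrArg θ h5
  rw [MvPolynomial.hom_eval₂, map_zero] at h6
  rw [← h6]
  congr 1
  ext a
  simp [hε', hθ]

/-- Coefficientwise derivative in the parameter. -/
def paramDeriv {σ : Type*} (F : MvPolynomial σ (Polynomial ℂ)) : MvPolynomial σ (Polynomial ℂ) :=
  ∑ e ∈ F.support, monomial e (coeff e F).derivative

theorem coeff_paramDeriv {σ : Type*} (F : MvPolynomial σ (Polynomial ℂ)) (e : σ →₀ ℕ) :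
    coeff e (paramDeriv F) = (coeff e F).derivative := by
  classical
  simp only [paramDeriv, coeff_sum, coeff_monomial, Finset.sum_ite_eq', mem_support_iff]
  split_ifs with h
  · rfl
  · rw [not_not.1 h, map_zero]

theorem paramDeriv_add {σ : Type*} (F G : MvPolynomial σ (Polynomial ℂ)) :
    paramDeriv (F + G) = paramDeriv F + paramDeriv G := by
  ext1 e; simp [coeff_paramDeriv]

theorem paramDeriv_monomial {σ : Type*} (e : σ →₀ ℕ) (a : Polynomial ℂ) :
    paramDeriv (monomial e a) = monomial e a.derivative := by
  classical
  ext1 i; rw [coeff_paramDeriv, coeff_monomial, coeff_monomial]; split_ifs <;> simp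

theorem paramDeriv_C {σ : Type*} (a : Polynomial ℂ) :
    paramDeriv (C a : MvPolynomial σ (Polynomial ℂ)) = C a.derivative :=
  paramDeriv_monomial 0 a

theorem paramDeriv_mul_X {σ : Type*} (F : MvPolynomial σ (Polynomial ℂ)) (i : σ) :
    paramDeriv (F * X i) = paramDeriv F * X i := by
  classical
  ext1 e
  rw [coeff_paramDeriv, coeff_mul_X', coeff_mul_X', coeff_paramDeriv]
  split_ifs <;> simp

/-- Derivations extend along formally étale extensions. -/
theorem exists_derivation_extension {A Ω : Type*} [CommRing A] [CommRing Ω] [Algebra A Ω]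
    [Algebra.FormallyEtale A Ω] (d : A →+ A) (hd : ∀ x y, d (x * y) = x * d y + y * d x) : ∃ D : Ω
        →+ Ω,
    (∀ x y, D (x * y) = x * D y + y * D x) ∧
      ∀ a : A, D (algebraMap A Ω a) = algebraMap A Ω (d a) := by
  have hd1 : d 1 = 0 := by simpa using hd 1 1
  let φ : A →+* TrivSqZeroExt Ω Ω :=
    { toFun := fun a => TrivSqZeroExt.inl (algebraMap A Ω a) + TrivSqZeroExt.inr
        (algebraMap A Ω (d a))
      map_one' := by ext <;> simp [hd1]
      map_zero' := by ext <;> simp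
      map_add' := fun a b => by ext <;> simp [Algebra.smul_def]
      map_mul' := fun a b => by
        ext
        · simp
        · simp [hd, Algebra.smul_def, TrivSqZeroExt.algebraMap_eq_inl]; ring }
  let alg : Algebra A (TrivSqZeroExt Ω Ω) := φ.toAlgebra
  let pr : TrivSqZeroExt Ω Ω →ₐ[A] Ω :=
    { toFun := TrivSqZeroExt.fst
      map_one' := rfl
      map_mul' := fun _ _ => rfl
      map_zero' := rfl
      map_add' := fun _ _ => rfl
      commutes' := fun a => by
        change TrivSqZeroExt.fst (φ a) = _
        simp [φ] }
  have hpr : Function.Surjective pr := fun x => ⟨TrivSqZeroExt.inl x, rfl⟩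
  have hnil : IsNilpotent (RingHom.ker (pr : TrivSqZeroExt Ω Ω →+* Ω)) := by
    refine ⟨2, (pow_two (RingHom.ker (pr : TrivSqZeroExt Ω Ω →+* Ω))).trans ?_⟩
    rw [Submodule.zero_eq_bot, eq_bot_iff, Ideal.mul_le]
    intro r hr s hs
    have hr' : r.fst = 0 := hr
    have hs' : s.fst = 0 := hs
    rw [Ideal.mem_bot]
    ext <;> simp [hr', hs']
  let s : Ω →ₐ[A] TrivSqZeroExt Ω Ω := Algebra.FormallySmooth.liftOfSurjective
    (AlgHom.id A Ω) pr hpr hnil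
  have hs : ∀ x, (s x).fst = x := fun x =>
    Algebra.FormallySmooth.liftOfSurjective_apply (AlgHom.id A Ω) pr hpr hnil x
  refine ⟨⟨⟨fun x => (s x).snd, by simp⟩, fun x y => by simp⟩, fun x y => ?_, fun a => ?_⟩
  · simp [hs, mul_comm]
  · change (s (algebraMap A Ω a)).snd = _
    rw [s.commutes]
    change (φ a).snd = _
    simp [φ, Algebra.smul_def, TrivSqZeroExt.algebraMap_eq_inl]

/-- The derivation `d/dt` extends to the algebraic closure of `ℂ(t)`. -/
theorem exists_derivation : ∃ D : AlgebraicClosure (FractionRing (Polynomial ℂ)) →+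
    AlgebraicClosure (FractionRing (Polynomial ℂ)),
    (∀ x y, D (x * y) = x * D y + y * D x) ∧ ∀ a : Polynomial ℂ,
      D (algebraMap _ _ a) = algebraMap _ _ (Polynomial.derivative a) := by
  have h1 : Algebra.FormallyEtale (Polynomial ℂ) (FractionRing (Polynomial ℂ)) :=
    Algebra.FormallyEtale.of_isLocalization (nonZeroDivisors (Polynomial ℂ))
  have h2 := Algebra.FormallyEtale.of_isSeparable (FractionRing (Polynomial ℂ))
    (AlgebraicClosure (FractionRing (Polynomial ℂ)))
  have h3 := Algebra.FormallyEtale.comp (Polynomial ℂ) (FractionRing (Polynomial ℂ))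
    (AlgebraicClosure (FractionRing (Polynomial ℂ)))
  exact exists_derivation_extension (Polynomial.derivative (R := ℂ)).toAddMonoidHom fun x y => by
    simp [Polynomial.derivative_mul]; ring

/-- At singular points of the general member of a one-parameter family the derivative with
respect to the parameter vanishes. -/
theorem paramDeriv_eq_zero_of_singular {σ : Type} [Finite σ] (F : MvPolynomial σ (Polynomial ℂ)) :
    ∀ᶠ t in 𝓝[≠] (0 : ℂ), ∀ Q : σ → ℂ,
      eval₂ (Polynomial.evalRingHom t) Q F = 0 →
      (∀ j, eval₂ (Polynomial.evalRingHom t) Q (pderiv j F) = 0) →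
      eval₂ (Polynomial.evalRingHom t) Q (paramDeriv F) = 0 := by
  classical
  have := Fintype.ofFinite σ
  let ι : MvPolynomial σ (Polynomial ℂ) →ₐ[Polynomial ℂ] MvPolynomial (Option σ) (Polynomial ℂ) :=
    rename some
  let S : Set (MvPolynomial (Option σ) (Polynomial ℂ)) :=
    {ι F, X none * ι (paramDeriv F) - 1} ∪ Set.range fun j => ι (pderiv j F)
  rcases exists_elim (FractionRing (Polynomial ℂ))
    (AlgebraicClosure (FractionRing (Polynomial ℂ))) S with ⟨y, hy⟩ | ⟨a, ha, haS⟩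
  · exfalso
    obtain ⟨D, hD, hDa⟩ := exists_derivation
    have key : ∀ G : MvPolynomial σ (Polynomial ℂ), ∀ Q : σ → _,
        D (aeval Q G) = aeval Q (paramDeriv G) + ∑ j, aeval Q (pderiv j G) * D (Q j) := by
      intro G Q
      induction G using MvPolynomial.induction_on with
      | C a => simp [hDa, paramDeriv_C]
      | add p q hp hq =>
        simp only [map_add, hp, hq, paramDeriv_add, add_mul, Finset.sum_add_distrib]
        ring
      | mul_X p i hp =>
        have h : ∀ j, aeval Q (pderiv j (p * X i)) * D (Q j) =
            (if i = j then aeval Q p * D (Q j) else 0) +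
              Q i * (aeval Q (pderiv j p) * D (Q j)) := by
          intro j
          by_cases hij : i = j
          · subst hij
            simp [Derivation.leibniz]; ring
          · simp [Derivation.leibniz, pderiv_X_of_ne hij, hij]; ring
        rw [paramDeriv_mul_X]
        simp only [map_mul, hD, hp, aeval_X, h, Finset.sum_add_distrib, Finset.sum_ite_eq,
          Finset.mem_univ, if_true, ← Finset.mul_sum]
        ring
    have hι : ∀ G, aeval y (ι G) = aeval (y ∘ some) G := fun G => aeval_rename _ _ _
    have h1 := hy (ι F) (Or.inl (Or.inl rfl))
    have h2 := hy (X none * ι (paramDeriv F) - 1) (Or.inl (Or.inr rfl))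
    have h3 : ∀ j, aeval y (ι (pderiv j F)) = 0 := fun j => hy _ (Or.inr ⟨j, rfl⟩)
    simp only [map_sub, map_mul, map_one, hι] at h1 h2 h3
    have h4 := key F (y ∘ some)
    simp only [h1, h3, map_zero, zero_mul, Finset.sum_const_zero, add_zero] at h4
    rw [← h4] at h2
    simp at h2
  · filter_upwards [eventually_eval_ne_zero ha 0] with t ht Q h1 h2
    by_contra h3
    set w := eval₂ (Polynomial.evalRingHom t) Q (paramDeriv F) with hw
    let y : Option σ → ℂ := fun o => o.elim w⁻¹ Q
    have hι : ∀ G, eval₂ (Polynomial.evalRingHom t) y (ι G) =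
        eval₂ (Polynomial.evalRingHom t) Q G := fun G => by
      change eval₂ _ _ (rename some G) = _
      rw [eval₂_rename]; rfl
    have h5 : Ideal.span S ≤ RingHom.ker (eval₂Hom (Polynomial.evalRingHom t) y) := by
      rw [Ideal.span_le]
      rintro f ((rfl | rfl) | ⟨j, rfl⟩)
      · exact (hι F).trans h1
      · change eval₂ _ _ _ = 0
        rw [eval₂_sub, eval₂_mul, hι, ← hw, eval₂_X, eval₂_one]
        simp [y, h3]
      · exact (hι _).trans (h2 j)
    have h6 := h5 haS
    rw [RingHom.mem_ker, eval₂Hom_C] at h6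
    exact ht h6

/-- Coefficientwise convergence of polynomials with uniformly bounded support. -/
def CoeffTendsto {α σ : Type*} (F : α → MvPolynomial σ ℂ) (l : Filter α) (G : MvPolynomial σ ℂ) :
    Prop :=
  ∃ s : Finset (σ →₀ ℕ), (∀ n, (F n).support ⊆ s) ∧ G.support ⊆ s ∧
    ∀ e, Tendsto (fun n => coeff e (F n)) l (𝓝 (coeff e G))

namespace CoeffTendsto

variable {α σ τ : Type*} {l : Filter α} {F F' : α → MvPolynomial σ ℂ} {G G' : MvPolynomial σ ℂ}

theorem const (G : MvPolynomial σ ℂ) : CoeffTendsto (fun _ => G) l G :=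
  ⟨G.support, fun _ => subset_rfl, subset_rfl, fun _ => tendsto_const_nhds⟩

theorem comp {β : Type*} {k : Filter β} {u : β → α} (h : CoeffTendsto F l G)
    (hu : Tendsto u k l) : CoeffTendsto (fun n => F (u n)) k G := by
  obtain ⟨s, h1, h2, h3⟩ := h
  exact ⟨s, fun n => h1 _, h2, fun e => (h3 e).comp hu⟩

theorem add (h : CoeffTendsto F l G) (h' : CoeffTendsto F' l G') :
    CoeffTendsto (fun n => F n + F' n) l (G + G') := by
  classical
  obtain ⟨s, h1, h2, h3⟩ := h
  obtain ⟨s', h1', h2', h3'⟩ := h'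
  refine ⟨s ∪ s', fun n => support_add.trans (Finset.union_subset_union (h1 n) (h1' n)),
    support_add.trans (Finset.union_subset_union h2 h2'), fun e => ?_⟩
  simp only [coeff_add]
  exact (h3 e).add (h3' e)

theorem sum {ι : Type*} (s : Finset ι) {F : ι → α → MvPolynomial σ ℂ} {G : ι → MvPolynomial σ ℂ}
    (h : ∀ i ∈ s, CoeffTendsto (F i) l (G i)) :
    CoeffTendsto (fun n => ∑ i ∈ s, F i n) l (∑ i ∈ s, G i) := by
  classical
  induction s using Finset.induction_on with
  | empty => simpa using const 0
  | insert a s ha ih =>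
    simp only [Finset.sum_insert ha]
    exact (h a (Finset.mem_insert_self _ _)).add
      (ih fun i hi => h i (Finset.mem_insert_of_mem hi))

theorem C_mul {a : α → ℂ} {b : ℂ} (ha : Tendsto a l (𝓝 b)) (h : CoeffTendsto F l G) :
    CoeffTendsto (fun n => C (a n) * F n) l (C b * G) := by
  obtain ⟨s, h1, h2, h3⟩ := h
  have hs : ∀ (c : ℂ) (H : MvPolynomial σ ℂ), (C c * H).support ⊆ H.support := by
    intro c H e he
    rw [mem_support_iff, coeff_C_mul] at he
    exact mem_support_iff.2 (right_ne_zero_of_mul he)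
  refine ⟨s, fun n => (hs _ _).trans (h1 n), (hs _ _).trans h2, fun e => ?_⟩
  simp only [coeff_C_mul]
  exact ha.mul (h3 e)

theorem coeff (h : CoeffTendsto F l G) (e : σ →₀ ℕ) :
    Tendsto (fun n => coeff e (F n)) l (𝓝 (coeff e G)) := h.choose_spec.2.2 e

theorem expand (h : CoeffTendsto F l G) : ∃ s : Finset (σ →₀ ℕ),
    (∀ n, F n = ∑ e ∈ s, C (MvPolynomial.coeff e (F n)) * monomial e 1) ∧
    G = ∑ e ∈ s, C (MvPolynomial.coeff e G) * monomial e 1 := by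
  classical
  obtain ⟨s, h1, h2, -⟩ := h
  have : ∀ H : MvPolynomial σ ℂ, H.support ⊆ s →
      H = ∑ e ∈ s, C (MvPolynomial.coeff e H) * monomial e 1 := by
    intro H hH
    conv_lhs => rw [H.as_sum]
    rw [Finset.sum_subset hH fun e _ he => by rw [notMem_support_iff.1 he, monomial_zero]]
    simp [C_mul_monomial]
  exact ⟨s, fun n => this _ (h1 n), this _ h2⟩

theorem linearMap (h : CoeffTendsto F l G) (T : MvPolynomial σ ℂ →ₗ[ℂ] MvPolynomial τ ℂ) :
    CoeffTendsto (fun n => T (F n)) l (T G) := by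
  obtain ⟨s, h1, h2⟩ := h.expand
  have hT : ∀ H : MvPolynomial σ ℂ, T (∑ e ∈ s, C (MvPolynomial.coeff e H) * monomial e 1) =
      ∑ e ∈ s, C (MvPolynomial.coeff e H) * T (monomial e 1) := by
    intro H
    rw [map_sum]
    refine Finset.sum_congr rfl fun e _ => ?_
    rw [← smul_eq_C_mul, map_smul, smul_eq_C_mul]
  have e1 : (fun n => T (F n)) =
      fun n => ∑ e ∈ s, C (MvPolynomial.coeff e (F n)) * T (monomial e 1) := by
    funext n; rw [← hT, ← h1]
  have e2 : T G = ∑ e ∈ s, C (MvPolynomial.coeff e G) * T (monomial e 1) :=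
    (congrArg T h2).trans (hT G)
  rw [e1, e2]
  exact sum s fun e _ => C_mul (h.coeff e) (const _)

theorem mul (h : CoeffTendsto F l G) (h' : CoeffTendsto F' l G') :
    CoeffTendsto (fun n => F n * F' n) l (G * G') := by
  obtain ⟨s, h1, h2⟩ := h.expand
  have e1 : (fun n => F n * F' n) =
      fun n => ∑ e ∈ s, C (MvPolynomial.coeff e (F n)) * (monomial e 1 * F' n) := by
    funext n
    conv_lhs => rw [h1 n, Finset.sum_mul]
    simp only [mul_assoc]
  have e2 : G * G' = ∑ e ∈ s, C (MvPolynomial.coeff e G) * (monomial e 1 * G') := by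
    conv_lhs => rw [h2, Finset.sum_mul]
    simp only [mul_assoc]
  rw [e1, e2]
  refine sum s fun e _ => C_mul (h.coeff e) ?_
  exact h'.linearMap (LinearMap.mulLeft ℂ (monomial e 1))

theorem pow (h : CoeffTendsto F l G) (m : ℕ) : CoeffTendsto (fun n => F n ^ m) l (G ^ m) := by
  induction m with
  | zero => simpa using const 1
  | succ m ih => simp only [pow_succ]; exact ih.mul h

theorem prod {ι : Type*} (s : Finset ι) {F : ι → α → MvPolynomial σ ℂ} {G : ι → MvPolynomial σ ℂ}
    (h : ∀ i ∈ s, CoeffTendsto (F i) l (G i)) :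
    CoeffTendsto (fun n => ∏ i ∈ s, F i n) l (∏ i ∈ s, G i) := by
  classical
  induction s using Finset.induction_on with
  | empty => simpa using const 1
  | insert a s ha ih =>
    simp only [Finset.prod_insert ha]
    exact (h a (Finset.mem_insert_self _ _)).mul
      (ih fun i hi => h i (Finset.mem_insert_of_mem hi))

theorem aeval (h : CoeffTendsto F l G) {g : α → σ → MvPolynomial τ ℂ} {g' : σ → MvPolynomial τ ℂ}
    (hg : ∀ j, CoeffTendsto (fun n => g n j) l (g' j)) :
    CoeffTendsto (fun n => aeval (g n) (F n)) l (aeval g' G) := by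
  obtain ⟨s, h1, h2⟩ := h.expand
  have hT : ∀ (g : σ → MvPolynomial τ ℂ) (H : MvPolynomial σ ℂ), MvPolynomial.aeval g
      (∑ e ∈ s, C (MvPolynomial.coeff e H) * monomial e 1) =
      ∑ e ∈ s, C (MvPolynomial.coeff e H) * ∏ j ∈ e.support, g j ^ e j := by
    intro g H
    simp only [map_sum, map_mul, aeval_monomial, map_one, one_mul, Finsupp.prod]
    simp [MvPolynomial.algebraMap_eq]
  have e1 : (fun n => MvPolynomial.aeval (g n) (F n)) = fun n => ∑ e ∈ s,
      C (MvPolynomial.coeff e (F n)) * ∏ j ∈ e.support, g n j ^ e j := by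
    funext n; rw [← hT, ← h1]
  have e2 : MvPolynomial.aeval g' G = ∑ e ∈ s,
      C (MvPolynomial.coeff e G) * ∏ j ∈ e.support, g' j ^ e j :=
    (congrArg (MvPolynomial.aeval g') h2).trans (hT g' G)
  rw [e1, e2]
  exact sum s fun e _ => C_mul (h.coeff e) (prod _ fun j _ => (hg j).pow _)

theorem C {a : α → ℂ} {b : ℂ} (ha : Tendsto a l (𝓝 b)) :
    CoeffTendsto (fun n => (C (a n) : MvPolynomial σ ℂ)) l (C b) := by
  simpa using C_mul ha (const (1 : MvPolynomial σ ℂ))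

theorem eval (h : CoeffTendsto F l G) {Q : α → σ → ℂ} {q : σ → ℂ} (hQ : Tendsto Q l (𝓝 q)) :
    Tendsto (fun n => eval (Q n) (F n)) l (𝓝 (eval q G)) := by
  have h1 := (h.aeval (g := fun n j => (MvPolynomial.C (Q n j) : MvPolynomial σ ℂ))
    (g' := fun j => MvPolynomial.C (q j)) fun j => C ((tendsto_pi_nhds.1 hQ) j)).coeff 0
  have h2 : ∀ (Q : σ → ℂ) (H : MvPolynomial σ ℂ), MvPolynomial.coeff 0 (MvPolynomial.aeval
      (fun j => (MvPolynomial.C (Q j) : MvPolynomial σ ℂ)) H) = MvPolynomial.eval Q H := by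
    intro Q H
    induction H using MvPolynomial.induction_on with
    | C a => simp
    | add p q hp hq => simp only [map_add, coeff_add, hp, hq]
    | mul_X p i hp => rw [map_mul, aeval_X, mul_comm, coeff_C_mul, hp, map_mul, eval_X, mul_comm]
  simpa only [h2] using h1

theorem unique [l.NeBot] (h : CoeffTendsto F l G) (h' : CoeffTendsto F l G') : G = G' := by
  ext e
  exact tendsto_nhds_unique (h.coeff e) (h'.coeff e)

theorem isHomogeneous [l.NeBot] {d : ℕ} (h : CoeffTendsto F l G)
    (hF : ∀ n, (F n).IsHomogeneous d) : G.IsHomogeneous d := by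
  intro e he
  by_contra hd
  refine he (tendsto_nhds_unique (h.coeff e) ?_)
  have : (fun n => MvPolynomial.coeff e (F n)) = fun _ => 0 := by
    funext n
    by_contra hn
    exact hd (hF n hn)
  rw [this]
  exact tendsto_const_nhds

end CoeffTendsto

theorem coeffTendsto_map_eval {σ : Type*} (F : MvPolynomial σ (Polynomial ℂ)) (z : ℂ) :
    CoeffTendsto (fun t => map (Polynomial.evalRingHom t) F) (𝓝[≠] z)
      (map (Polynomial.evalRingHom z) F) := by
  refine ⟨F.support, fun t => support_map_subset _ _, support_map_subset _ _, fun e => ?_⟩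
  simp only [coeff_map, Polynomial.coe_evalRingHom]
  exact ((coeff e F).continuous.tendsto z).mono_left nhdsWithin_le_nhds

theorem MvPolynomial.IsHomogeneous.coeffTendsto {α σ : Type*} [Finite σ] {l : Filter α} {d : ℕ}
    {F : α → MvPolynomial σ ℂ} {G : MvPolynomial σ ℂ} (hF : ∀ n, (F n).IsHomogeneous d)
    (hG : G.IsHomogeneous d) (h : ∀ e, Tendsto (fun n => coeff e (F n)) l (𝓝 (coeff e G))) :
    CoeffTendsto F l G := by
  classical
  have := Fintype.ofFinite σ
  have : ∀ H : MvPolynomial σ ℂ, H.IsHomogeneous d →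
      H.support ⊆ Finset.finsuppAntidiag Finset.univ d := by
    intro H hH e he
    rw [Finset.mem_finsuppAntidiag]
    refine ⟨?_, Finset.subset_univ _⟩
    have := hH (mem_support_iff.1 he)
    rw [Finsupp.weight_apply, Finsupp.sum_fintype _ _ (by simp)] at this
    simpa using this
  exact ⟨_, fun n => this _ (hF n), this _ hG, h⟩

/-- Nonzero forms converge after rescaling, along any ultrafilter. -/
theorem exists_coeffTendsto_smul {α σ : Type*} [Finite σ] (U : Ultrafilter α) {d : ℕ}
    {F : α → MvPolynomial σ ℂ} (hF : ∀ n, (F n).IsHomogeneous d) (h0 : ∀ n, F n ≠ 0) :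
    ∃ (a : α → ℂ) (G : MvPolynomial σ ℂ), (∀ n, a n ≠ 0) ∧ G ≠ 0 ∧ G.IsHomogeneous d ∧
      CoeffTendsto (fun n => C (a n) * F n) U G := by
  classical
  have := Fintype.ofFinite σ
  let s : Finset (σ →₀ ℕ) := Finset.finsuppAntidiag Finset.univ d
  have hs : ∀ n, ∀ e, coeff e (F n) ≠ 0 → e ∈ s := by
    intro n e he
    rw [Finset.mem_finsuppAntidiag]
    refine ⟨?_, Finset.subset_univ _⟩
    have := hF n he
    rw [Finsupp.weight_apply, Finsupp.sum_fintype _ _ (by simp)] at this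
    simpa using this
  let c : α → s → ℂ := fun n e => coeff e.1 (F n)
  have hc : ∀ n, ‖c n‖ ≠ 0 := by
    intro n hn
    rw [norm_eq_zero] at hn
    apply h0 n
    ext e
    by_contra he
    exact he (by simpa using congrFun hn ⟨e, hs n e he⟩)
  have hmem : ∀ n, ((‖c n‖⁻¹ : ℝ) : ℂ) • c n ∈ Metric.sphere (0 : s → ℂ) 1 := by
    intro n
    rw [mem_sphere_zero_iff_norm, norm_smul, Complex.norm_real, norm_inv, norm_norm,
      inv_mul_cancel₀ (hc n)]
  obtain ⟨w, hw, hle⟩ := (isCompact_sphere (0 : s → ℂ) 1).ultrafilter_le_nhds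
    (U.map fun n => ((‖c n‖⁻¹ : ℝ) : ℂ) • c n)
    (by rw [le_principal_iff]; exact mem_map.2 (Filter.univ_mem' hmem))
  have hlim : ∀ e : s, Tendsto (fun n => ((‖c n‖⁻¹ : ℝ) : ℂ) * c n e) U (𝓝 (w e)) := by
    have : Tendsto (fun n => ((‖c n‖⁻¹ : ℝ) : ℂ) • c n) U (𝓝 w) := hle
    exact fun e => (tendsto_pi_nhds.1 this) e
  have hhom : ∀ n, (C ((‖c n‖⁻¹ : ℝ) : ℂ) * F n).IsHomogeneous d := fun n => by
    simpa using (isHomogeneous_C σ ((‖c n‖⁻¹ : ℝ) : ℂ)).mul (hF n)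
  have hcoeff : ∀ e, coeff e (∑ e : s, monomial e.1 (w e)) = if h : e ∈ s then w ⟨e, h⟩ else 0 := by
    intro e
    simp only [coeff_sum, coeff_monomial]
    split_ifs with h
    · rw [Finset.sum_eq_single ⟨e, h⟩]
      · simp
      · intro b _ hb
        rw [if_neg fun h => hb (Subtype.ext h)]
      · simp
    · refine Finset.sum_eq_zero fun b _ => ?_
      rw [if_neg]
      rintro rfl
      exact h b.2
  have hct : CoeffTendsto (fun n => C ((‖c n‖⁻¹ : ℝ) : ℂ) * F n) U
      (∑ e : s, monomial e.1 (w e)) := by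
    refine ⟨s, fun n e he => hs n e ?_, fun e he => ?_, fun e => ?_⟩
    · rw [mem_support_iff, coeff_C_mul] at he
      exact right_ne_zero_of_mul he
    · rw [mem_support_iff, hcoeff] at he
      by_contra h
      exact he (dif_neg h)
    · rw [hcoeff]
      simp only [coeff_C_mul]
      split_ifs with h
      · exact hlim ⟨e, h⟩
      · have : ∀ n, coeff e (F n) = 0 := fun n => by
          by_contra hn
          exact h (hs n e hn)
        simp only [this, mul_zero]
        exact tendsto_const_nhds
  refine ⟨fun n => ((‖c n‖⁻¹ : ℝ) : ℂ), ∑ e : s, monomial e.1 (w e), fun n => ?_, ?_, ?_, hct⟩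
  · simpa using norm_ne_zero_iff.1 (hc n)
  · intro h
    have hw0 : w = 0 := by
      funext e
      have := hcoeff e.1
      rw [h, coeff_zero, dif_pos e.2] at this
      exact this.symm
    rw [hw0] at hw
    simp at hw
  · exact hct.isHomogeneous hhom

/-- Limits of products of forms are products of limits, after rescaling. -/
theorem exists_limit_factorization {α σ : Type*} [Finite σ] (U : Ultrafilter α) {a b : ℕ}
    {F A B : α → MvPolynomial σ ℂ} {G : MvPolynomial σ ℂ} (hF : CoeffTendsto F U G)
    (hAB : ∀ n, F n = A n * B n) (hA : ∀ n, (A n).IsHomogeneous a)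
    (hB : ∀ n, (B n).IsHomogeneous b) (hA0 : ∀ n, A n ≠ 0) (hB0 : ∀ n, B n ≠ 0) :
    ∃ (α' β' : α → ℂ) (A' B' : MvPolynomial σ ℂ) (c : ℂ), (∀ n, α' n ≠ 0) ∧ (∀ n, β' n ≠ 0) ∧
      A' ≠ 0 ∧ B' ≠ 0 ∧ A'.IsHomogeneous a ∧ B'.IsHomogeneous b ∧
      CoeffTendsto (fun n => C (α' n) * A n) U A' ∧ CoeffTendsto (fun n => C (β' n) * B n) U B' ∧
      G = C c * (A' * B') := by
  obtain ⟨α', A', hα, hA', hAh, hAt⟩ := exists_coeffTendsto_smul U hA hA0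
  obtain ⟨β', B', hβ, hB', hBh, hBt⟩ := exists_coeffTendsto_smul U hB hB0
  have hprod := hAt.mul hBt
  obtain ⟨e, he⟩ : ∃ e, coeff e (A' * B') ≠ 0 := by
    by_contra! h
    exact mul_ne_zero hA' hB' (by ext e; simpa using h e)
  have key : ∀ n, C (α' n) * A n * (C (β' n) * B n) = C (α' n * β' n) * F n := fun n => by
    rw [hAB n, C_mul]; ring
  simp only [key] at hprod
  have h1 := hprod.coeff e
  simp only [coeff_C_mul] at h1
  have h2 := (hF.coeff e).mul (h1.inv₀ he)
  have h3 : ∀ᶠ n in (U : Filter α), coeff e (F n) * (α' n * β' n * coeff e (F n))⁻¹ =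
      (α' n * β' n)⁻¹ := by
    filter_upwards [h1.eventually_ne he] with n hn
    have := right_ne_zero_of_mul hn
    field_simp
  have h4 := h2.congr' h3
  have h5 := CoeffTendsto.C_mul h4 hprod
  have h6 : ∀ n, C (α' n * β' n)⁻¹ * (C (α' n * β' n) * F n) = F n := fun n => by
    rw [← mul_assoc, ← C_mul, inv_mul_cancel₀ (mul_ne_zero (hα n) (hβ n)), C_1, one_mul]
  simp only [h6] at h5
  exact ⟨α', β', A', B', _, hα, hβ, hA', hB', hAh, hBh, hAt, hBt, hF.unique h5⟩

/-- The Taylor expansion of a form at the affine point `(x, y, 1)`. -/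
def loc {R : Type*} [CommRing R] (x y : R) : MvPolynomial (Fin 3) R →ₐ[R] MvPolynomial (Fin 2) R :=
  aeval ![X 0 + C x, X 1 + C y, 1]

theorem map_loc {R S : Type*} [CommRing R] [CommRing S] (φ : R →+* S) (x y : R)
    (F : MvPolynomial (Fin 3) R) : map φ (loc x y F) = loc (φ x) (φ y) (map φ F) := by
  induction F using MvPolynomial.induction_on with
  | C a => simp [loc]
  | add p q hp hq => simp only [map_add, hp, hq]
  | mul_X p i hp =>
    simp only [map_mul, hp]
    congr 1
    fin_cases i <;> simp [loc]

theorem eval_loc {R : Type*} [CommRing R] (x y : R) (F : MvPolynomial (Fin 3) R) (u : Fin 2 → R) :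
    eval u (loc x y F) = eval ![u 0 + x, u 1 + y, 1] F := by
  induction F using MvPolynomial.induction_on with
  | C a => simp [loc]
  | add p q hp hq => simp only [map_add, hp, hq]
  | mul_X p i hp =>
    simp only [map_mul, hp]
    congr 1
    fin_cases i <;> simp [loc]

theorem pderiv_loc {R : Type*} [CommRing R] (x y : R) (F : MvPolynomial (Fin 3) R) (j : Fin 2) :
    pderiv j (loc x y F) = loc x y (pderiv j.castSucc F) := by
  induction F using MvPolynomial.induction_on with
  | C a => simp [loc]
  | add p q hp hq => simp only [map_add, hp, hq]
  | mul_X p i hp =>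
    simp only [map_mul, Derivation.leibniz, hp, map_add, smul_eq_mul]
    congr 2
    fin_cases i <;> fin_cases j <;> simp [loc, pderiv_X]

theorem CoeffTendsto.loc {α : Type*} {l : Filter α} {F : α → MvPolynomial (Fin 3) ℂ}
    {G : MvPolynomial (Fin 3) ℂ} (h : CoeffTendsto F l G) {x y : α → ℂ} {a b : ℂ}
    (hx : Tendsto x l (𝓝 a)) (hy : Tendsto y l (𝓝 b)) :
    CoeffTendsto (fun n => loc (x n) (y n) (F n)) l (loc a b G) := by
  refine h.aeval fun j => ?_
  fin_cases j
  · exact (const _).add (CoeffTendsto.C hx)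
  · exact (const _).add (CoeffTendsto.C hy)
  · exact const _

theorem coeff_aeval_C_mul_X {σ R : Type*} [CommRing R] (s : R) (f : MvPolynomial σ R)
    (e : σ →₀ ℕ) : coeff e (aeval (fun j => C s * X j) f : MvPolynomial σ R) =
      s ^ e.degree * coeff e f := by
  classical
  induction f using MvPolynomial.induction_on' with
  | monomial d a =>
    rw [aeval_monomial, Finsupp.prod]
    simp only [mul_pow, Finset.prod_mul_distrib]
    have h1 : ∏ i ∈ d.support, (X i : MvPolynomial σ R) ^ d i = monomial d 1 := by
      rw [monomial_eq, C_1, one_mul]; rfl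
    rw [h1, Finset.prod_pow_eq_pow_sum, algebraMap_eq, ← C_pow, coeff_C_mul, coeff_C_mul,
      coeff_monomial, coeff_monomial]
    split_ifs with h
    · subst h
      simp [Finsupp.degree_apply, mul_comm]
    · simp
  | add p q hp hq => rw [map_add, coeff_add, coeff_add, hp, hq, mul_add]

theorem pderiv_aeval_C_mul_X {σ R : Type*} [CommRing R] (s : R) (f : MvPolynomial σ R)
    (j : σ) : pderiv j (aeval (fun j => C s * X j) f : MvPolynomial σ R) =
      C s * aeval (fun j => C s * X j) (pderiv j f) := by
  classical
  induction f using MvPolynomial.induction_on with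
  | C a => simp
  | add p q hp hq => simp only [map_add, hp, hq, mul_add]
  | mul_X p i hp =>
    simp only [map_mul, Derivation.leibniz, hp, map_add, smul_eq_mul, aeval_X, pderiv_C, mul_zero,
      add_zero, pderiv_X]
    by_cases h : i = j
    · subst h
      rw [Pi.single_eq_same, map_one]
      ring
    · rw [Pi.single_eq_of_ne h, map_zero]
      ring

theorem eval_aeval_C_mul_X {σ R : Type*} [CommRing R] (s : R) (f : MvPolynomial σ R)
    (v : σ → R) : eval v (aeval (fun j => C s * X j) f : MvPolynomial σ R) =
      eval (fun j => s * v j) f := by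
  induction f using MvPolynomial.induction_on with
  | C a => simp
  | add p q hp hq => simp only [map_add, hp, hq]
  | mul_X p i hp => simp only [map_mul, hp, aeval_X, eval_X, eval_C]

/-- Singular points cannot accumulate at a point whose limit tangent cone is reduced. -/
theorem not_tendsto_singular {α : Type*} (U : Ultrafilter α) {f : α → MvPolynomial (Fin 2) ℂ}
    {g : MvPolynomial (Fin 2) ℂ} (hf : CoeffTendsto f U g) {k : ℕ}
    (hk : ∀ n, ∀ e : Fin 2 →₀ ℕ, e.degree < k → coeff e (f n) = 0)
    (hg : ∀ v : Fin 2 → ℂ, v ≠ 0 → ∃ j, eval v (pderiv j (homogeneousComponent k g)) ≠ 0)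
    {u : α → Fin 2 → ℂ} (hu : Tendsto u U (𝓝 0))
    (h : ∀ᶠ n in (U : Filter α), u n ≠ 0 ∧ ∀ j, eval (u n) (pderiv j (f n)) = 0) : False := by
  classical
  let s : α → ℂ := fun n => (‖u n‖ : ℂ)
  have hs : Tendsto s U (𝓝 0) := by
    have := (Complex.continuous_ofReal.tendsto _).comp (tendsto_norm_zero.comp hu)
    rwa [Complex.ofReal_zero] at this
  have hs0 : ∀ n, u n ≠ 0 → s n ≠ 0 := fun n hn => by simpa [s] using hn
  obtain ⟨S, hS1, hS2, hS3⟩ := id hf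
  let b : α → MvPolynomial (Fin 2) ℂ := fun n =>
    ∑ e ∈ S, monomial e (coeff e (f n) * s n ^ (e.degree - k))
  have hb : ∀ n e, coeff e (b n) = coeff e (f n) * s n ^ (e.degree - k) := by
    intro n e
    simp only [b, coeff_sum, coeff_monomial, Finset.sum_ite_eq']
    split_ifs with he
    · rfl
    · rw [notMem_support_iff.1 fun h => he (hS1 n h), zero_mul]
  have hscale : ∀ n, C (s n ^ k) * b n = aeval (fun j => C (s n) * X j) (f n) := by
    intro n
    ext e
    rw [coeff_C_mul, hb, coeff_aeval_C_mul_X]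
    by_cases he : e.degree < k
    · rw [hk n e he]; simp
    · have : e.degree = k + (e.degree - k) := by omega
      conv_rhs => rw [this, pow_add]
      ring
  have hbt : CoeffTendsto b U (homogeneousComponent k g) := by
    refine ⟨S, fun n e he => ?_, fun e he => hS2 ?_, fun e => ?_⟩
    · rw [mem_support_iff, hb] at he
      exact hS1 n (mem_support_iff.2 (left_ne_zero_of_mul he))
    · rw [mem_support_iff, coeff_homogeneousComponent] at he
      exact mem_support_iff.2 fun h => he (by rw [h, ite_self])
    · simp only [hb, coeff_homogeneousComponent]
      rcases lt_trichotomy e.degree k with he | he | he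
      · rw [if_neg he.ne]
        have : ∀ n, coeff e (f n) = 0 := fun n => hk n e he
        simp only [this, zero_mul]
        exact tendsto_const_nhds
      · rw [if_pos he, he]
        simpa using hS3 e
      · rw [if_neg he.ne']
        have h1 := (hS3 e).mul (hs.pow (e.degree - k))
        rwa [zero_pow (by omega), mul_zero] at h1
  have hmem : ∀ᶠ n in (U : Filter α), (s n)⁻¹ • u n ∈ Metric.sphere (0 : Fin 2 → ℂ) 1 := by
    filter_upwards [h] with n hn
    rw [mem_sphere_zero_iff_norm, norm_smul, norm_inv, Complex.norm_real, norm_norm,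
      inv_mul_cancel₀ (norm_ne_zero_iff.2 hn.1)]
  obtain ⟨w, hw, hle⟩ := (isCompact_sphere (0 : Fin 2 → ℂ) 1).ultrafilter_le_nhds
    (U.map fun n => (s n)⁻¹ • u n) (by rw [le_principal_iff]; exact mem_map.2 hmem)
  have hw0 : w ≠ 0 := fun h0 => by
    rw [h0, mem_sphere_zero_iff_norm, norm_zero] at hw
    exact zero_ne_one hw
  obtain ⟨j, hj⟩ := hg w hw0
  refine hj (tendsto_nhds_unique
    ((hbt.linearMap (pderiv j).toLinearMap).eval (show Tendsto _ (U : Filter α) (𝓝 w) from hle)) ?_)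
  refine tendsto_const_nhds.congr' ?_
  filter_upwards [h] with n hn
  have h1 := congrArg (fun p => eval ((s n)⁻¹ • u n) (pderiv j p)) (hscale n)
  simp only [pderiv_aeval_C_mul_X, map_mul, eval_aeval_C_mul_X, Derivation.leibniz, pderiv_C,
    smul_eq_mul, mul_zero, add_zero, eval_C] at h1
  have h2 : (fun j => s n * ((s n)⁻¹ • u n) j) = u n := by
    funext i
    simp [mul_inv_cancel_left₀ (hs0 n hn.1)]
  rw [h2, hn.2 j, mul_zero] at h1
  exact ((mul_eq_zero.1 h1).resolve_left (pow_ne_zero _ (hs0 n hn.1))).symm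

theorem MvPolynomial.IsHomogeneous.eval_smul {σ R : Type*} [CommRing R] {d : ℕ}
    {F : MvPolynomial σ R}
    (hF : F.IsHomogeneous d) (c : R) (v : σ → R) : eval (c • v) F = c ^ d * eval v F := by
  have h : MvPolynomial.aeval (fun j => C c * X j) F = C (c ^ d) * F := by
    ext e
    rw [coeff_aeval_C_mul_X, coeff_C_mul]
    by_cases he : e.degree = d
    · rw [he]
    · rw [hF.coeff_eq_zero he, mul_zero, mul_zero]
  have h1 := congrArg (eval v) h
  rw [eval_aeval_C_mul_X, map_mul, eval_C] at h1
  exact h1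

/-- The reducedness of the tangent cone at `(x, y, 1)` for multiplicity `k`. -/
def ReducedCone (k : ℕ) (x y : ℂ) (F : MvPolynomial (Fin 3) ℂ) : Prop :=
  1 ≤ k → ∀ v : Fin 2 → ℂ, v ≠ 0 →
    ∃ j, eval v (pderiv j (homogeneousComponent k (loc x y F))) ≠ 0

theorem not_tendsto_singular_proj {α : Type*} (U : Ultrafilter α)
    {F : α → MvPolynomial (Fin 3) ℂ} {G : MvPolynomial (Fin 3) ℂ} (hF : CoeffTendsto F U G) {d : ℕ}
    (hd : ∀ n, (F n).IsHomogeneous d) {k : ℕ} (hk1 : 1 ≤ k) {x y : α → ℂ} {a b : ℂ}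
    (hx : Tendsto x U (𝓝 a)) (hy : Tendsto y U (𝓝 b))
    (hk : ∀ n, ∀ e : Fin 2 →₀ ℕ, e.degree < k → coeff e (loc (x n) (y n) (F n)) = 0)
    (hg : ReducedCone k a b G) {Q : α → Fin 3 → ℂ} {c : ℂ} (hc : c ≠ 0)
    (hQ : Tendsto Q U (𝓝 (c • ![a, b, 1])))
    (h : ∀ᶠ n in (U : Filter α), (∀ c' : ℂ, Q n ≠ c' • ![x n, y n, 1]) ∧
      ∀ j, eval (Q n) (pderiv j (F n)) = 0) : False := by
  have hQi := tendsto_pi_nhds.1 hQ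
  have h2 : Tendsto (fun n => Q n 2) U (𝓝 c) := by simpa using hQi 2
  have h0 : Tendsto (fun n => Q n 0) U (𝓝 (c * a)) := by simpa using hQi 0
  have h1 : Tendsto (fun n => Q n 1) U (𝓝 (c * b)) := by simpa using hQi 1
  have hu : Tendsto (fun n => ![Q n 0 / Q n 2 - x n, Q n 1 / Q n 2 - y n]) U (𝓝 0) := by
    rw [tendsto_pi_nhds]
    intro j
    fin_cases j
    · have := (h0.div h2 hc).sub hx
      rw [mul_div_cancel_left₀ _ hc, sub_self] at this
      exact this
    · have := (h1.div h2 hc).sub hy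
      rw [mul_div_cancel_left₀ _ hc, sub_self] at this
      exact this
  refine not_tendsto_singular U (hF.loc hx hy) hk (hg hk1) hu ?_
  filter_upwards [h, h2.eventually_ne hc] with n hn hn2
  have hQn : Q n = Q n 2 • ![Q n 0 / Q n 2, Q n 1 / Q n 2, 1] := by
    funext i
    fin_cases i <;> simp [mul_div_cancel₀ _ hn2]
  refine ⟨fun h0 => hn.1 (Q n 2) ?_, fun j => ?_⟩
  · have e0 := congrFun h0 0
    have e1 := congrFun h0 1
    simp only [Matrix.cons_val_zero, Matrix.cons_val_one, Pi.zero_apply, sub_eq_zero] at e0 e1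
    rw [← e0, ← e1]
    exact hQn
  · have h3 := hn.2 j.castSucc
    rw [hQn, (hd n).pderiv.eval_smul] at h3
    rw [pderiv_loc, eval_loc]
    simpa using (mul_eq_zero.1 h3).resolve_left (pow_ne_zero _ hn2)

theorem MvPolynomial.IsHomogeneous.of_mul_left {σ R : Type*} [CommRing R] [IsDomain R] {d : ℕ}
    {A B : MvPolynomial σ R} (h : (A * B).IsHomogeneous d) (h0 : A * B ≠ 0) :
    ∃ a, A.IsHomogeneous a := by
  let Φ : MvPolynomial σ R →ₐ[R] Polynomial (MvPolynomial σ R) :=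
    MvPolynomial.aeval fun i => Polynomial.C (X i) * Polynomial.X
  have hmon : ∀ (e : σ →₀ ℕ) (r : R),
      Φ (monomial e r) = Polynomial.monomial e.degree (monomial e r) := by
    intro e r
    simp only [Φ, aeval_monomial, Finsupp.prod, mul_pow, Finset.prod_mul_distrib]
    rw [Finset.prod_pow_eq_pow_sum, ← Polynomial.C_mul_X_pow_eq_monomial, ← mul_assoc,
      Finsupp.degree_apply, monomial_eq]
    simp only [Finsupp.prod, IsScalarTower.algebraMap_apply R (MvPolynomial σ R)
      (Polynomial (MvPolynomial σ R)), algebraMap_eq, Polynomial.algebraMap_eq, Polynomial.C_mul,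
      map_prod, map_pow]
  have hΦ : ∀ (P : MvPolynomial σ R) (k : ℕ), (Φ P).coeff k = homogeneousComponent k P := by
    classical
    intro P k
    induction P using MvPolynomial.induction_on' with
    | monomial e r =>
      rw [hmon, Polynomial.coeff_monomial]
      ext e'
      rw [coeff_homogeneousComponent, coeff_monomial]
      by_cases h : e = e'
      · subst h
        rw [if_pos rfl]
        split_ifs with h1 <;> simp
      · split_ifs <;> simp [coeff_monomial, h]
    | add p q hp hq => rw [map_add, Polynomial.coeff_add, hp, hq, map_add]
  have hinj : ∀ P : MvPolynomial σ R, Φ P = 0 → P = 0 := by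
    intro P hP
    rw [← sum_homogeneousComponent P]
    refine Finset.sum_eq_zero fun k _ => ?_
    rw [← hΦ, hP, Polynomial.coeff_zero]
  have hA : Φ A ≠ 0 := fun h => left_ne_zero_of_mul h0 (hinj _ h)
  have hB : Φ B ≠ 0 := fun h => right_ne_zero_of_mul h0 (hinj _ h)
  have hAB : Φ A * Φ B = Polynomial.monomial d (A * B) := by
    rw [← map_mul]
    ext1 k
    rw [hΦ, Polynomial.coeff_monomial, homogeneousComponent_of_mem h]
    simp only [eq_comm]
  have h1 := Polynomial.natDegree_mul hA hB
  have h2 := Polynomial.natTrailingDegree_mul hA hB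
  rw [hAB, Polynomial.natDegree_monomial_eq _ h0] at h1
  rw [hAB, Polynomial.natTrailingDegree_monomial h0] at h2
  have h3 := Polynomial.natTrailingDegree_le_natDegree (Φ A)
  have h4 := Polynomial.natTrailingDegree_le_natDegree (Φ B)
  have : A = homogeneousComponent (Φ A).natDegree A := by
    conv_lhs => rw [← sum_homogeneousComponent A]
    have hz : ∀ k, k ≠ (Φ A).natDegree → homogeneousComponent k A = 0 := by
      intro k hk
      rw [← hΦ]
      rcases lt_or_gt_of_ne hk with hk | hk
      · exact Polynomial.coeff_eq_zero_of_lt_natTrailingDegree (by omega)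
      · exact Polynomial.coeff_eq_zero_of_natDegree_lt hk
    refine Finset.sum_eq_single _ (fun k _ hk => hz k hk) fun hk => ?_
    exact homogeneousComponent_eq_zero _ _ (by simpa using hk)
  have h5 := homogeneousComponent_isHomogeneous (Φ A).natDegree A
  rw [← this] at h5
  exact ⟨_, h5⟩

theorem MvPolynomial.IsHomogeneous.isUnit_iff {σ R : Type*} [Field R] {d : ℕ} {A : MvPolynomial σ R}
    (h : A.IsHomogeneous d) (h0 : A ≠ 0) : IsUnit A ↔ d = 0 := by
  rw [MvPolynomial.isUnit_iff_totalDegree_of_isReduced, h.totalDegree h0]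
  constructor
  · exact fun h => h.2
  · rintro rfl
    refine ⟨?_, rfl⟩
    rw [isUnit_iff_ne_zero]
    intro hc
    rw [← totalDegree_zero_iff_isHomogeneous, totalDegree_eq_zero_iff_eq_C] at h
    exact h0 (by rw [h, hc, C_0])

theorem exists_ultrafilter_of_frequently {α : Type*} {l : Filter α} {p : α → Prop}
    (h : ∃ᶠ n in l, p n) : ∃ U : Ultrafilter {n // p n}, Tendsto (Subtype.val : {n // p n} → α) U
        l := by
  have : (comap (Subtype.val : {n // p n} → α) l).NeBot := by
    rw [comap_neBot_iff_frequently]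
    exact h.mono fun n hn => ⟨⟨n, hn⟩, rfl⟩
  exact ⟨Ultrafilter.of _, tendsto_comap.mono_left (Ultrafilter.of_le _)⟩

theorem exists_tendsto_smul {α κ : Type*} [Fintype κ] (U : Ultrafilter α) {v : α → κ → ℂ}
    (hv : ∀ n, v n ≠ 0) : ∃ (a : α → ℂ) (w : κ → ℂ), (∀ n, a n ≠ 0) ∧ w ≠ 0 ∧
      Tendsto (fun n => a n • v n) U (𝓝 w) := by
  have ha : ∀ n, ((‖v n‖ : ℂ))⁻¹ ≠ 0 := fun n => by simpa using hv n
  have hmem : ∀ n, ((‖v n‖ : ℂ))⁻¹ • v n ∈ Metric.sphere (0 : κ → ℂ) 1 := fun n => by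
    rw [mem_sphere_zero_iff_norm, norm_smul, norm_inv, Complex.norm_real, norm_norm,
      inv_mul_cancel₀ (norm_ne_zero_iff.2 (hv n))]
  obtain ⟨w, hw, hle⟩ := (isCompact_sphere (0 : κ → ℂ) 1).ultrafilter_le_nhds
    (U.map fun n => ((‖v n‖ : ℂ))⁻¹ • v n)
    (by rw [le_principal_iff]; exact mem_map.2 (Filter.univ_mem' hmem))
  refine ⟨fun n => ((‖v n‖ : ℂ))⁻¹, w, ha, fun h0 => ?_, hle⟩
  rw [h0, mem_sphere_zero_iff_norm, norm_zero] at hw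
  exact zero_ne_one hw

/-- `F` is irreducible, its only singular points are the points `(x i, y i, 1)` with `1 ≤ k i`, and
the tangent cones at those points are reduced. -/
structure Nice {ι : Type*} (k : ι → ℕ) (x y : ι → ℂ) (F : MvPolynomial (Fin 3) ℂ) : Prop where
  cone : ∀ i, ReducedCone (k i) (x i) (y i) F
  smooth : ∀ Q : Fin 3 → ℂ, Q ≠ 0 → (∀ j, eval Q (pderiv j F) = 0) →
    ∃ i, 1 ≤ k i ∧ ∃ c : ℂ, Q = c • ![x i, y i, 1]
  irred : Irreducible F

/-- Vanishing to order at least `k` at the point `(x, y, 1)`. -/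
def FatAt {R : Type*} [CommRing R] (k : ℕ) (x y : R) (F : MvPolynomial (Fin 3) R) : Prop :=
  ∀ e : Fin 2 →₀ ℕ, e.degree < k → coeff e (loc x y F) = 0

section
variable {α : Type*} {l : Filter α} {F : α → MvPolynomial (Fin 3) ℂ} {G : MvPolynomial (Fin 3) ℂ}

theorem eventually_reducedCone (hF : CoeffTendsto F l G) {k : ℕ} {x y : α → ℂ} {a b : ℂ}
    (hx : Tendsto x l (𝓝 a)) (hy : Tendsto y l (𝓝 b)) (h : ReducedCone k a b G) :
    ∀ᶠ n in l, ReducedCone k (x n) (y n) (F n) := by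
  by_contra hcon
  rw [not_eventually] at hcon
  obtain ⟨U, hU⟩ := exists_ultrafilter_of_frequently hcon
  have h1 : ∀ n : {n // ¬ ReducedCone k (x n) (y n) (F n)}, 1 ≤ k ∧ ∃ v : Fin 2 → ℂ, v ≠ 0 ∧
      ∀ j, eval v (pderiv j (homogeneousComponent k (loc (x n) (y n) (F n)))) = 0 := by
    intro n
    have := n.2
    unfold ReducedCone at this
    push Not at this
    exact this
  have hk : 1 ≤ k := by
    obtain ⟨n, hn⟩ := hcon.exists
    exact (h1 ⟨n, hn⟩).1
  choose v hv0 hv using fun n => (h1 n).2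
  obtain ⟨c, w, hc, hw, hlim⟩ := exists_tendsto_smul U hv0
  obtain ⟨j, hj⟩ := h hk w hw
  refine hj (tendsto_nhds_unique ((((hF.comp hU).loc (hx.comp hU) (hy.comp hU)).linearMap
    ((pderiv j).toLinearMap ∘ₗ homogeneousComponent k)).eval hlim) ?_)
  refine tendsto_const_nhds.congr fun n => ?_
  have := ((homogeneousComponent_isHomogeneous k (loc (x n.1) (y n.1) (F n.1))).pderiv
    (i := j)).eval_smul (c n) (v n)
  rw [hv n j, mul_zero] at this
  exact this.symm

theorem eventually_nice {ι : Type*} [Finite ι] {k : ι → ℕ} (hF : CoeffTendsto F l G) {d : ℕ}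
    (hd : ∀ n, (F n).IsHomogeneous d) {x y : α → ι → ℂ} {a b : ι → ℂ}
    (hx : Tendsto x l (𝓝 a)) (hy : Tendsto y l (𝓝 b))
    (hfat : ∀ n i, FatAt (k i) (x n i) (y n i) (F n)) (h : Nice k a b G) :
    ∀ᶠ n in l, Nice k (x n) (y n) (F n) := by
  have hx' := tendsto_pi_nhds.1 hx
  have hy' := tendsto_pi_nhds.1 hy
  have c1 : ∀ᶠ n in l, ∀ i, ReducedCone (k i) (x n i) (y n i) (F n) :=
    eventually_all.2 fun i => eventually_reducedCone hF (hx' i) (hy' i) (h.cone i)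
  have c2 : ∀ᶠ n in l, ∀ Q : Fin 3 → ℂ, Q ≠ 0 → (∀ j, eval Q (pderiv j (F n)) = 0) →
      ∃ i, 1 ≤ k i ∧ ∃ c : ℂ, Q = c • ![x n i, y n i, 1] := by
    by_contra hcon
    rw [not_eventually] at hcon
    obtain ⟨U, hU⟩ := exists_ultrafilter_of_frequently hcon
    have h1 := fun n : {n // ¬ ∀ Q : Fin 3 → ℂ, Q ≠ 0 → (∀ j, eval Q (pderiv j (F n)) = 0) →
      ∃ i, 1 ≤ k i ∧ ∃ c : ℂ, Q = c • ![x n i, y n i, 1]} => n.2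
    push Not at h1
    choose Q hQ0 hQ1 hQ2 using h1
    obtain ⟨c, w, hc, hw, hlim⟩ := exists_tendsto_smul U hQ0
    have hz : ∀ n j, eval (c n • Q n) (pderiv j (F n.1)) = 0 := fun n j => by
      rw [(hd n.1).pderiv.eval_smul, hQ1 n j, mul_zero]
    obtain ⟨i, hi, c', hc'⟩ := h.smooth w hw fun j =>
      tendsto_nhds_unique (((hF.comp hU).linearMap (pderiv j).toLinearMap).eval hlim)
        (tendsto_const_nhds.congr fun n => (hz n j).symm)
    have hc0 : c' ≠ 0 := fun h0 => hw (by rw [hc', h0, zero_smul])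
    rw [hc'] at hlim
    refine not_tendsto_singular_proj U (hF.comp hU) (fun n => hd n.1) hi ((hx' i).comp hU)
      ((hy' i).comp hU) (fun n => hfat n.1 i) (h.cone i) hc0 hlim
      (Eventually.of_forall fun n => ⟨fun c'' h' => hQ2 n i hi ((c n)⁻¹ * c'') ?_, hz n⟩)
    rw [mul_smul]
    exact (inv_smul_eq_iff₀ (hc n)).2 h'.symm |>.symm
  have hne : ∀ᶠ n in l, F n ≠ 0 := by
    obtain ⟨e, he⟩ : ∃ e, coeff e G ≠ 0 := by
      by_contra! h'
      exact h.irred.ne_zero (by ext e; simpa using h' e)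
    filter_upwards [(hF.coeff e).eventually_ne he] with n hn h0
    exact hn (by rw [h0, coeff_zero])
  have c3 : ∀ᶠ n in l, Irreducible (F n) := by
    by_contra hcon
    rw [not_eventually] at hcon
    have hcon := hcon.and_eventually hne
    have hl : l.NeBot := by
      by_contra h'
      rw [not_neBot] at h'
      simp [h'] at hcon
    have hGd : G.IsHomogeneous d := hF.isHomogeneous hd
    have hd0 : d ≠ 0 := fun h0 => h.irred.not_isUnit ((hGd.isUnit_iff h.irred.ne_zero).2 h0)
    have h1 : ∃ᶠ n in l, ∃ a : Fin d, 1 ≤ a.1 ∧ ∃ A B, F n = A * B ∧ A ≠ 0 ∧ B ≠ 0 ∧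
        A.IsHomogeneous a ∧ B.IsHomogeneous (d - a) := by
      refine hcon.mono fun n hn => ?_
      have hu : ¬ IsUnit (F n) := fun hu => hd0 (((hd n).isUnit_iff hn.2).1 hu)
      have h2 : ¬ ∀ A B, F n = A * B → IsUnit A ∨ IsUnit B := fun h2 =>
        hn.1 ⟨hu, fun A B => h2 A B⟩
      push Not at h2
      obtain ⟨A, B, hAB, hA, hB⟩ := h2
      have h0 : A * B ≠ 0 := hAB ▸ hn.2
      have hhom : (A * B).IsHomogeneous d := hAB ▸ hd n
      obtain ⟨a, ha⟩ := hhom.of_mul_left h0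
      obtain ⟨b, hb⟩ := (mul_comm A B ▸ hhom : (B * A).IsHomogeneous d).of_mul_left
        (mul_comm A B ▸ h0)
      have hab := (ha.mul hb).inj_right hhom h0
      have ha0 : a ≠ 0 := fun h => hA ((ha.isUnit_iff (left_ne_zero_of_mul h0)).2 h)
      have hb0 : b ≠ 0 := fun h => hB ((hb.isUnit_iff (right_ne_zero_of_mul h0)).2 h)
      refine ⟨⟨a, by omega⟩, by simp; omega, A, B, hAB, left_ne_zero_of_mul h0,
        right_ne_zero_of_mul h0, ha, ?_⟩
      have : d - a = b := by omega
      simpa [this] using hb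
    rw [frequently_exists] at h1
    obtain ⟨a, h1⟩ := h1
    obtain ⟨U, hU⟩ := exists_ultrafilter_of_frequently h1
    obtain ⟨n0, hn0⟩ := h1.exists
    have ha1 := hn0.1
    have h2 := fun n : {n // 1 ≤ a.1 ∧ ∃ A B, F n = A * B ∧ A ≠ 0 ∧ B ≠ 0 ∧
        A.IsHomogeneous a ∧ B.IsHomogeneous (d - a)} => n.2.2
    choose A B hAB hA0 hB0 hA hB using h2
    obtain ⟨-, -, A', B', c, -, -, hA', hB', hAh, hBh, -, -, hG⟩ :=
      exists_limit_factorization U (hF.comp hU) hAB hA hB hA0 hB0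
    have hc : c ≠ 0 := fun h0 => h.irred.ne_zero (by rw [hG, h0, C_0, zero_mul])
    rw [hG, ← mul_assoc] at h
    rcases h.irred.isUnit_or_isUnit rfl with hu | hu
    · have := (hAh.isUnit_iff hA').1 (isUnit_of_mul_isUnit_right hu)
      omega
    · have := (hBh.isUnit_iff hB').1 hu
      have := a.2
      omega
  filter_upwards [c1, c2, c3] with n h1 h2 h3
  exact ⟨h1, h2, h3⟩

end

section Restrict
variable {R : Type*} [CommRing R]

/-- Restriction of a form to the parametrised line `s ↦ P + s Q`. -/
def restrictLine (P Q : Fin 3 → R) : MvPolynomial (Fin 3) R →ₐ[R] Polynomial R :=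
  aeval fun j => Polynomial.C (P j) + Polynomial.C (Q j) * Polynomial.X

theorem eval_restrictLine (P Q : Fin 3 → R) (F : MvPolynomial (Fin 3) R) (s : R) :
    (restrictLine P Q F).eval s = eval (P + s • Q) F := by
  induction F using MvPolynomial.induction_on with
  | C a => simp [restrictLine]
  | add p q hp hq => simp only [map_add, Polynomial.eval_add, hp, hq]
  | mul_X p i hp =>
    rw [map_mul, Polynomial.eval_mul, hp, map_mul, eval_X]
    simp only [restrictLine, aeval_X, Polynomial.eval_add, Polynomial.eval_mul, Polynomial.eval_C,
      Polynomial.eval_X, Pi.add_apply, Pi.smul_apply, smul_eq_mul, mul_comm s]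

theorem natDegree_restrictLine_le (P Q : Fin 3 → R) {F : MvPolynomial (Fin 3) R} {d : ℕ}
    (hF : F.IsHomogeneous d) : (restrictLine P Q F).natDegree ≤ d ∧
      (restrictLine P Q F).coeff d = eval Q F := by
  have hmon : ∀ (e : Fin 3 →₀ ℕ) (r : R), e.degree = d →
      (restrictLine P Q (monomial e r)).natDegree ≤ d ∧
      (restrictLine P Q (monomial e r)).coeff d = eval Q (monomial e r) := by
    intro e r he
    have h1 : ∀ j, (Polynomial.C (P j) + Polynomial.C (Q j) * Polynomial.X).natDegree ≤ 1 :=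
      fun j => by compute_degree
    have h2 : ∀ j, ((Polynomial.C (P j) + Polynomial.C (Q j) * Polynomial.X) ^ e j).natDegree ≤
        e j := fun j => by simpa using Polynomial.natDegree_pow_le_of_le (e j) (h1 j)
    have h3 : ∀ j, ((Polynomial.C (P j) + Polynomial.C (Q j) * Polynomial.X) ^ e j).coeff (e j) =
        Q j ^ e j := fun j => by
      have := Polynomial.coeff_pow_of_natDegree_le (m := e j) (h1 j)
      simpa using this
    have he' : d = (0 + (e 0 + e 1)) + e 2 := by
      rw [← he, Finsupp.degree_eq_sum, Fin.sum_univ_three]; ring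
    have h4 : restrictLine P Q (monomial e r) = Polynomial.C r *
        ((Polynomial.C (P 0) + Polynomial.C (Q 0) * Polynomial.X) ^ e 0 *
         (Polynomial.C (P 1) + Polynomial.C (Q 1) * Polynomial.X) ^ e 1) *
         (Polynomial.C (P 2) + Polynomial.C (Q 2) * Polynomial.X) ^ e 2 := by
      rw [restrictLine, aeval_monomial, Finsupp.prod_fintype _ _ (by simp), Fin.prod_univ_three,
        Polynomial.algebraMap_eq]
      ring
    have h5 := Polynomial.natDegree_mul_le_of_le (h2 0) (h2 1)
    have h6 := Polynomial.natDegree_mul_le_of_le (Polynomial.natDegree_C r).le h5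
    refine ⟨?_, ?_⟩
    · rw [h4, he']
      exact Polynomial.natDegree_mul_le_of_le h6 (h2 2)
    · rw [h4, he', Polynomial.coeff_mul_add_eq_of_natDegree_le h6 (h2 2),
        Polynomial.coeff_mul_add_eq_of_natDegree_le (Polynomial.natDegree_C r).le h5,
        Polynomial.coeff_mul_add_eq_of_natDegree_le (h2 0) (h2 1), h3, h3, h3, eval_monomial,
        Finsupp.prod_fintype _ _ (by simp), Fin.prod_univ_three, Polynomial.coeff_C_zero]
      ring
  have hdeg : ∀ e ∈ F.support, e.degree = d := fun e he => by
    by_contra h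
    exact (mem_support_iff.1 he) (hF.coeff_eq_zero h)
  rw [F.as_sum, map_sum, map_sum, Polynomial.finsetSum_coeff]
  exact ⟨Polynomial.natDegree_sum_le_of_forall_le _ _ fun e he => (hmon e _ (hdeg e he)).1,
    Finset.sum_congr rfl fun e he => (hmon e _ (hdeg e he)).2⟩

/-- The trace of a form on the affine line of height `y`. -/
def tr (y : R) : MvPolynomial (Fin 3) R →ₐ[R] Polynomial R :=
  restrictLine ![0, y, 1] ![1, 0, 0]

theorem eval_tr (y s : R) (F : MvPolynomial (Fin 3) R) :
    (tr y F).eval s = eval ![s, y, 1] F := by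
  rw [tr, eval_restrictLine]
  congr 2
  funext j
  fin_cases j <;> simp

theorem tr_X (y : R) : tr y (X 0) = Polynomial.X ∧ tr y (X 1) = Polynomial.C y ∧ tr y (X 2) = 1 :=
    by
  refine ⟨?_, ?_, ?_⟩ <;> simp [tr, restrictLine]

theorem coeff_loc_single (x y : R) (F : MvPolynomial (Fin 3) R) (a : ℕ) :
    coeff (Finsupp.single 0 a) (loc x y F) = ((tr y F).comp (Polynomial.X + Polynomial.C x)).coeff
        a := by
  let ψ : MvPolynomial (Fin 2) R →ₐ[R] Polynomial R := aeval ![Polynomial.X, 0]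
  have h1 : ∀ g : MvPolynomial (Fin 2) R, (ψ g).coeff a = coeff (Finsupp.single 0 a) g := by
    classical
    intro g
    induction g using MvPolynomial.induction_on' with
    | monomial e r =>
      rw [coeff_monomial]
      simp only [ψ, aeval_monomial, Finsupp.prod_fintype _ _ (fun _ => pow_zero _),
        Fin.prod_univ_two, Matrix.cons_val_zero, Matrix.cons_val_one, Polynomial.algebraMap_eq,
        Polynomial.coeff_C_mul]
      by_cases he : e 1 = 0
      · rw [he, pow_zero, mul_one, Polynomial.coeff_X_pow]
        by_cases ha : a = e 0
        · rw [if_pos ha, if_pos, mul_one]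
          ext j
          fin_cases j <;> simp [ha, he]
        · rw [if_neg ha, if_neg, mul_zero]
          rintro rfl
          simp at ha
      · rw [zero_pow he, mul_zero, Polynomial.coeff_zero, mul_zero, if_neg]
        rintro rfl
        simp at he
    | add p q hp hq => rw [map_add, Polynomial.coeff_add, hp, hq, coeff_add]
  have h2 : ψ (loc x y F) = (tr y F).comp (Polynomial.X + Polynomial.C x) := by
    induction F using MvPolynomial.induction_on with
    | C a => simp [ψ, loc, tr, restrictLine]
    | add p q hp hq => simp only [map_add, hp, hq, Polynomial.add_comp]
    | mul_X p i hp =>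
      simp only [map_mul, hp, Polynomial.mul_comp]
      congr 1
      fin_cases i
      · simp [ψ, loc, (tr_X y).1]
      · simp [ψ, loc, (tr_X y).2.1, Polynomial.algebraMap_eq]
      · simp [ψ, loc, (tr_X y).2.2]
  rw [← h1, h2]

theorem X_sub_C_pow_dvd_tr_iff (x y : R) (F : MvPolynomial (Fin 3) R) (k : ℕ) :
    (Polynomial.X - Polynomial.C x) ^ k ∣ tr y F ↔
      ∀ a < k, coeff (Finsupp.single 0 a) (loc x y F) = 0 := by
  rw [Polynomial.X_sub_C_pow_dvd_iff, Polynomial.X_pow_dvd_iff]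
  simp only [coeff_loc_single]

end Restrict

theorem Polynomial.exists_root_norm_pow_le (h : Polynomial ℂ) (hN : 0 < h.natDegree) :
    ∃ z, h.IsRoot z ∧ ‖z‖ ^ h.natDegree * ‖h.leadingCoeff‖ ≤ ‖h.coeff 0‖ := by
  have hs := IsAlgClosed.splits h
  have h0 : h ≠ 0 := by rintro rfl; simp at hN
  have hcard : h.roots.card = h.natDegree := hs.natDegree_eq_card_roots.symm
  have hprod : ∀ (r : ℝ), 0 ≤ r → ∀ s : Multiset ℂ, (∀ z ∈ s, r ≤ ‖z‖) → r ^ s.card ≤ ‖s.prod‖ := by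
    intro r hr s
    induction s using Multiset.induction_on with
    | empty => simp
    | cons a s ih =>
      intro hz
      rw [Multiset.card_cons, Multiset.prod_cons, norm_mul, pow_succ']
      exact mul_le_mul (hz a (Multiset.mem_cons_self _ _))
        (ih fun z hz' => hz z (Multiset.mem_cons_of_mem hz')) (by positivity) (norm_nonneg _)
  have hne : h.roots.toFinset.Nonempty := by
    obtain ⟨z, hz⟩ := Multiset.card_pos_iff_exists_mem.1 (hcard ▸ hN)
    exact ⟨z, Multiset.mem_toFinset.2 hz⟩
  obtain ⟨z, hz, hmin⟩ := Finset.exists_min_image _ (fun z : ℂ => ‖z‖) hne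
  refine ⟨z, Polynomial.isRoot_of_mem_roots (Multiset.mem_toFinset.1 hz), ?_⟩
  have h1 := hprod ‖z‖ (norm_nonneg _) h.roots fun w hw => hmin w (Multiset.mem_toFinset.2 hw)
  rw [hcard] at h1
  rw [hs.coeff_zero_eq_leadingCoeff_mul_prod_roots, norm_mul, norm_mul, norm_pow, norm_neg,
    norm_one, one_pow, one_mul, mul_comm]
  exact mul_le_mul_of_nonneg_left h1 (norm_nonneg _)

/-- A polynomial of too large degree has roots (possibly at infinity) off a given set. -/
theorem exists_zero_off_points {ι : Type*} {B : Finset ι} {k : ι → ℕ} {a : ι → ℂ} {e : ℕ}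
    {G : MvPolynomial (Fin 3) ℂ} (hG : G.IsHomogeneous e)
    (hc : ∀ i ∈ B, coeff (Finsupp.single 0 (k i)) (loc (a i) 0 G) ≠ 0) (h0 : tr 0 G ≠ 0)
    (hdeg : ∑ i ∈ B, k i + 1 ≤ e) : ∃ Q : Fin 3 → ℂ, Q ≠ 0 ∧ Q 1 = 0 ∧ eval Q G = 0 ∧
      ∀ i ∈ B, ∀ c : ℂ, Q ≠ c • ![a i, 0, 1] := by
  classical
  by_cases hroot : ∀ z ∈ (tr 0 G).roots.toFinset, z ∈ B.image a
  · refine ⟨![1, 0, 0], ?_, rfl, ?_, fun i hi c h => ?_⟩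
    · intro h; simpa using congrFun h 0
    · obtain ⟨h1, h2⟩ := natDegree_restrictLine_le ![0, 0, 1] ![1, 0, 0] hG
      rw [← h2]
      apply Polynomial.coeff_eq_zero_of_natDegree_lt
      have h3 : (tr 0 G).natDegree = (tr 0 G).roots.card :=
        (IsAlgClosed.splits _).natDegree_eq_card_roots
      have h4 : (tr 0 G).roots.card ≤ ∑ z ∈ B.image a, (tr 0 G).roots.count z := by
        rw [← Multiset.toFinset_sum_count_eq]
        exact Finset.sum_le_sum_of_subset hroot
      have h5 : ∑ z ∈ B.image a, (tr 0 G).roots.count z ≤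
          ∑ i ∈ B, (tr 0 G).roots.count (a i) :=
        Finset.sum_image_le_of_nonneg fun _ _ => Nat.zero_le _
      have h6 : ∀ i ∈ B, (tr 0 G).roots.count (a i) ≤ k i := by
        intro i hi
        by_contra hlt
        push Not at hlt
        rw [Polynomial.count_roots] at hlt
        exact hc i hi (((X_sub_C_pow_dvd_tr_iff (a i) 0 G (k i + 1)).1
          ((Polynomial.le_rootMultiplicity_iff h0).1 hlt)) _ (Nat.lt_succ_self _))
      have h7 := Finset.sum_le_sum h6
      change (tr 0 G).natDegree < e
      omega
    · have e0 := congrFun h 0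
      have e2 := congrFun h 2
      simp at e0 e2
      simp [← e2] at e0
  · push Not at hroot
    obtain ⟨z, hz, hz'⟩ := hroot
    refine ⟨![z, 0, 1], ?_, rfl, ?_, fun i hi c h => hz' ?_⟩
    · intro h; simpa using congrFun h 2
    · rw [← eval_tr]
      exact Polynomial.isRoot_of_mem_roots (Multiset.mem_toFinset.1 hz)
    · have e0 := congrFun h 0
      have e2 := congrFun h 2
      simp at e0 e2
      rw [← e2, one_mul] at e0
      exact Finset.mem_image.2 ⟨i, hi, e0.symm⟩

theorem MvPolynomial.IsHomogeneous.sum_mul_eval_pderiv {σ : Type*} [Fintype σ] {d : ℕ}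
    {F : MvPolynomial σ ℂ} (hF : F.IsHomogeneous d) (v : σ → ℂ) :
    ∑ j, v j * eval v (pderiv j F) = d * eval v F := by
  have := congrArg (eval v) hF.sum_X_mul_pderiv
  simpa using this

theorem loc_X_mul {R : Type*} [CommRing R] (x y : R) (G : MvPolynomial (Fin 3) R) :
    loc x y (X 1 * G) = X 1 * loc x y G + C y * loc x y G := by
  rw [map_mul, ← add_mul]
  congr 1
  simp [loc]

theorem homogeneousComponent_X_mul {σ R : Type*} [CommRing R] (i : σ) (k : ℕ)
    (g : MvPolynomial σ R) :
    homogeneousComponent (k + 1) (X i * g) = X i * homogeneousComponent k g := by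
  classical
  ext e
  rw [coeff_homogeneousComponent, coeff_X_mul', coeff_X_mul', coeff_homogeneousComponent]
  by_cases hi : i ∈ e.support
  · have hle : Finsupp.single i 1 ≤ e := by
      rw [Finsupp.single_le_iff]
      exact Nat.one_le_iff_ne_zero.2 (Finsupp.mem_support_iff.1 hi)
    have : e.degree = (e - Finsupp.single i 1).degree + 1 := by
      conv_lhs => rw [← tsub_add_cancel_of_le hle, map_add, Finsupp.degree_single]
    simp only [hi, if_true, this, add_left_inj]
  · simp [hi]

theorem FatAt.homogeneousComponent_eq_zero {R : Type*} [CommRing R] {k : ℕ} {x y : R}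
    {F : MvPolynomial (Fin 3) R} (h : FatAt k x y F) {j : ℕ} (hj : j < k) :
    homogeneousComponent j (loc x y F) = 0 := by
  ext e
  rw [coeff_homogeneousComponent]
  split_ifs with he
  · exact h e (he ▸ hj)
  · rfl

theorem reducedCone_X_mul_off {k : ℕ} {x y : ℂ} {G : MvPolynomial (Fin 3) ℂ} (hy : y ≠ 0)
    (hfat : FatAt k x y G) (hG : ReducedCone k x y G) : ReducedCone k x y (X 1 * G) := by
  intro hk v hv
  obtain ⟨k, rfl⟩ : ∃ k', k = k' + 1 := ⟨k - 1, by omega⟩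
  obtain ⟨j, hj⟩ := hG hk v hv
  refine ⟨j, ?_⟩
  rw [loc_X_mul, map_add, homogeneousComponent_X_mul, homogeneousComponent_C_mul,
    hfat.homogeneousComponent_eq_zero (Nat.lt_succ_self k), mul_zero, zero_add]
  simpa [hy] using hj

theorem reducedCone_X_mul_on {k k' : ℕ} (hk' : k' = k - 1) {x : ℂ} {G : MvPolynomial (Fin 3) ℂ}
    (hc : coeff (Finsupp.single 0 k') (loc x 0 G) ≠ 0) (hG : ReducedCone k' x 0 G) :
    ReducedCone k x 0 (X 1 * G) := by
  intro hk v hv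
  obtain rfl : k = k' + 1 := by omega
  by_contra! hcon
  rw [loc_X_mul, C_0, zero_mul, add_zero, homogeneousComponent_X_mul] at hcon
  set g := homogeneousComponent k' (loc x 0 G) with hg
  have hgh : g.IsHomogeneous k' := homogeneousComponent_isHomogeneous _ _
  have h0 := hcon 0
  have h1 := hcon 1
  have hE := hgh.sum_mul_eval_pderiv v
  rw [Fin.sum_univ_two] at hE
  simp [Derivation.leibniz, pderiv_X] at h0 h1
  have hgv0 : eval ![1, 0] g ≠ 0 := by
    have h2 : eval ![1, 0] g = coeff (Finsupp.single 0 k') (loc x 0 G) := by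
      have h3 : coeff (Finsupp.single 0 k') g = coeff (Finsupp.single 0 k') (loc x 0 G) := by
        rw [hg, coeff_homogeneousComponent, if_pos (Finsupp.degree_single _ _)]
      rw [← h3, eval_eq, Finset.sum_eq_single (Finsupp.single 0 k')]
      · have : ∏ i ∈ (Finsupp.single (0 : Fin 2) k').support,
            (![1, 0] : Fin 2 → ℂ) i ^ (Finsupp.single (0 : Fin 2) k') i = 1 := by
          refine Finset.prod_eq_one fun i hi => ?_
          have := Finsupp.support_single_subset hi
          rw [Finset.mem_singleton] at this
          subst this
          simp
        rw [this, mul_one]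
      · intro b hb hne
        have hbd : b.degree = k' := by
          by_contra hbd
          exact (mem_support_iff.1 hb) (hgh.coeff_eq_zero hbd)
        have hb1 : b 1 ≠ 0 := by
          intro hb1
          apply hne
          rw [Finsupp.degree_eq_sum, Fin.sum_univ_two, hb1, add_zero] at hbd
          ext i
          fin_cases i <;> simp [hbd, hb1]
        rw [Finset.prod_eq_zero (Finsupp.mem_support_iff.2 hb1) (by simp [hb1]), mul_zero]
      · intro h
        rw [notMem_support_iff.1 h, zero_mul]
    rw [h2]
    exact hc
  by_cases hv1 : v 1 = 0
  · have hv0 : v 0 ≠ 0 := by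
      intro hv0
      apply hv
      funext i
      fin_cases i <;> simp [hv0, hv1]
    have hv' : v = v 0 • ![1, 0] := by
      funext i
      fin_cases i <;> simp [hv1]
    rw [hv1, zero_mul, zero_add] at h1
    rw [hv', hgh.eval_smul] at h1
    exact mul_ne_zero (pow_ne_zero _ hv0) hgv0 h1
  · have h0' : eval v (pderiv 0 g) = 0 := h0.resolve_left hv1
    rw [h0', mul_zero, zero_add] at hE
    have hgv : eval v g = 0 := by
      have : ((k' : ℂ) + 1) * eval v g = 0 := by linear_combination h1 - hE
      exact (mul_eq_zero.1 this).resolve_left (by exact_mod_cast Nat.succ_ne_zero k')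
    have h1' : eval v (pderiv 1 g) = 0 := by
      rw [hgv, add_zero] at h1
      exact (mul_eq_zero.1 h1).resolve_left hv1
    rcases Nat.eq_zero_or_pos k' with hk0 | hk0
    · rw [hk0] at hgh
      have hC : g = C (coeff 0 g) :=
        totalDegree_eq_zero_iff_eq_C.1 ((totalDegree_zero_iff_isHomogeneous _).2 hgh)
      rw [hC] at hgv hgv0
      simp at hgv hgv0
      exact hgv0 hgv
    · obtain ⟨j, hj⟩ := hG hk0 v hv
      rw [← hg] at hj
      fin_cases j
      · exact hj h0'
      · exact hj h1'

theorem exists_factors_of_not_irreducible {σ : Type*} {d : ℕ} {F : MvPolynomial σ ℂ}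
    (hF : F.IsHomogeneous d) (hd : d ≠ 0) (hne : F ≠ 0) (h : ¬ Irreducible F) :
    ∃ a : Fin d, 1 ≤ a.1 ∧ ∃ A B, F = A * B ∧ A ≠ 0 ∧ B ≠ 0 ∧
      A.IsHomogeneous a ∧ B.IsHomogeneous (d - a) := by
  have hu : ¬ IsUnit F := fun hu => hd ((hF.isUnit_iff hne).1 hu)
  have h2 : ¬ ∀ A B, F = A * B → IsUnit A ∨ IsUnit B := fun h2 => h ⟨hu, fun A B => h2 A B⟩
  push Not at h2
  obtain ⟨A, B, hAB, hA, hB⟩ := h2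
  have h0 : A * B ≠ 0 := hAB ▸ hne
  have hhom : (A * B).IsHomogeneous d := hAB ▸ hF
  obtain ⟨a, ha⟩ := hhom.of_mul_left h0
  obtain ⟨b, hb⟩ := (mul_comm A B ▸ hhom : (B * A).IsHomogeneous d).of_mul_left
    (mul_comm A B ▸ h0)
  have hab := (ha.mul hb).inj_right hhom h0
  have ha0 : a ≠ 0 := fun h => hA ((ha.isUnit_iff (left_ne_zero_of_mul h0)).2 h)
  have hb0 : b ≠ 0 := fun h => hB ((hb.isUnit_iff (right_ne_zero_of_mul h0)).2 h)
  refine ⟨⟨a, by omega⟩, by simp; omega, A, B, hAB, left_ne_zero_of_mul h0,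
    right_ne_zero_of_mul h0, ha, ?_⟩
  have : d - a = b := by omega
  simpa [this] using hb

theorem MvPolynomial.IsHomogeneous.eval_of_one {F : MvPolynomial (Fin 3) ℂ}
    (hF : F.IsHomogeneous 1) (v : Fin 3 → ℂ) :
    eval v F = ∑ j, v j * MvPolynomial.coeff 0 (pderiv j F) := by
  have h1 := hF.sum_mul_eval_pderiv v
  rw [Nat.cast_one, one_mul] at h1
  rw [← h1]
  refine Finset.sum_congr rfl fun j _ => ?_
  have h2 : (pderiv j F).IsHomogeneous 0 := hF.pderiv
  rw [totalDegree_eq_zero_iff_eq_C.1 ((totalDegree_zero_iff_isHomogeneous _).2 h2), eval_C,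
    coeff_C, if_pos rfl]

/-- Members `A n * B n` of a family tending to `Y * G`, where `A n` tends to a multiple of `Y`, have
singular points tending to any zero of `G` on the line `Y = 0`. -/
theorem exists_singular_tendsto {α : Type*} (U : Ultrafilter α) {A B : α → MvPolynomial (Fin 3) ℂ}
    {B' : MvPolynomial (Fin 3) ℂ} {γ : ℂ} (hγ : γ ≠ 0) {e : ℕ} (he : 0 < e)
    (hA : ∀ n, (A n).IsHomogeneous 1) (hB : ∀ n, (B n).IsHomogeneous e)
    (hAt : CoeffTendsto A U (C γ * X 1)) (hBt : CoeffTendsto B U B') (htr : tr 0 B' ≠ 0)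
    {Q : Fin 3 → ℂ} (hQ1 : Q 1 = 0) (hQ : eval Q B' = 0) :
    ∃ Z : α → Fin 3 → ℂ, Tendsto Z U (𝓝 Q) ∧
      ∀ᶠ n in (U : Filter α), eval (Z n) (A n) = 0 ∧ eval (Z n) (B n) = 0 := by
  obtain ⟨r, hr⟩ : ∃ r, (tr 0 B').eval r ≠ 0 := by
    by_contra! h
    exact htr (Polynomial.funext fun r => by simpa using h r)
  rw [eval_tr] at hr
  let L : α → Fin 3 → ℂ := fun n j => coeff 0 (pderiv j (A n))
  have hL : ∀ j, Tendsto (fun n => L n j) U (𝓝 (if j = 1 then γ else 0)) := by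
    intro j
    have := (hAt.linearMap (pderiv j).toLinearMap).coeff 0
    have h2 : coeff 0 ((pderiv j).toLinearMap (C γ * X 1 : MvPolynomial (Fin 3) ℂ)) =
        if j = 1 then γ else 0 := by
      fin_cases j <;> simp [Derivation.leibniz, pderiv_X]
    rw [h2] at this
    exact this
  have hL0 := hL 0
  have hL1 := hL 1
  have hL2 := hL 2
  rw [if_neg (by decide)] at hL0 hL2
  rw [if_pos rfl] at hL1
  let π : α → (Fin 3 → ℂ) → Fin 3 → ℂ := fun n v =>
    ![v 0, -(L n 0 * v 0 + L n 2 * v 2) / L n 1, v 2]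
  have hπ : ∀ v : Fin 3 → ℂ, v 1 = 0 → Tendsto (fun n => π n v) U (𝓝 v) := by
    intro v hv
    rw [tendsto_pi_nhds]
    intro j
    fin_cases j
    · exact tendsto_const_nhds
    · have := (((hL0.mul_const (v 0)).add (hL2.mul_const (v 2))).neg).div hL1 hγ
      simp only [zero_mul, add_zero, neg_zero, zero_div] at this
      change Tendsto (fun n => -(L n 0 * v 0 + L n 2 * v 2) / L n 1) U (𝓝 (v 1))
      rw [hv]
      exact this
    · exact tendsto_const_nhds
  have hP := hπ Q hQ1
  have hR := hπ ![r, 0, 1] rfl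
  have hPB := hBt.eval hP
  have hRB := hBt.eval hR
  rw [hQ] at hPB
  have h1 : ∀ n, ∃ z : ℂ, eval (π n ![r, 0, 1]) (B n) ≠ 0 →
      eval (π n Q + z • π n ![r, 0, 1]) (B n) = 0 ∧
      ‖z‖ ^ e * ‖eval (π n ![r, 0, 1]) (B n)‖ ≤ ‖eval (π n Q) (B n)‖ := by
    intro n
    by_cases hn : eval (π n ![r, 0, 1]) (B n) ≠ 0
    · obtain ⟨hd, hcoef⟩ := natDegree_restrictLine_le (π n Q) (π n ![r, 0, 1]) (hB n)
      have hdeg : (restrictLine (π n Q) (π n ![r, 0, 1]) (B n)).natDegree = e :=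
        le_antisymm hd (Polynomial.le_natDegree_of_ne_zero (hcoef ▸ hn))
      obtain ⟨z, hz, hle⟩ := Polynomial.exists_root_norm_pow_le _ (hdeg.symm ▸ he)
      refine ⟨z, fun _ => ⟨?_, ?_⟩⟩
      · rw [← eval_restrictLine]; exact hz
      · rw [Polynomial.leadingCoeff, hdeg, hcoef, Polynomial.coeff_zero_eq_eval_zero,
          eval_restrictLine, zero_smul, add_zero] at hle
        exact hle
    · exact ⟨0, fun h => absurd h hn⟩
  choose z hz using h1
  have hev : ∀ᶠ n in (U : Filter α), eval (π n ![r, 0, 1]) (B n) ≠ 0 := hRB.eventually_ne hr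
  have hz0 : Tendsto z U (𝓝 0) := by
    have h2 : Tendsto (fun n => ‖z n‖ ^ e) U (𝓝 0) := by
      have h3 := hPB.norm.div hRB.norm (norm_ne_zero_iff.2 hr)
      rw [norm_zero, zero_div] at h3
      refine tendsto_of_tendsto_of_tendsto_of_le_of_le' tendsto_const_nhds h3
        (Eventually.of_forall fun n => by positivity) ?_
      filter_upwards [hev] with n hn
      exact (le_div_iff₀ (norm_pos_iff.2 hn)).2 (hz n hn).2
    rw [tendsto_zero_iff_norm_tendsto_zero]
    have h4 : Tendsto (fun n => (‖z n‖ ^ e) ^ ((e : ℝ)⁻¹)) U (𝓝 ((0 : ℝ) ^ ((e : ℝ)⁻¹))) :=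
      h2.rpow_const (Or.inr (by positivity))
    rw [Real.zero_rpow (by positivity)] at h4
    refine h4.congr fun n => ?_
    exact Real.pow_rpow_inv_natCast (norm_nonneg _) he.ne'
  refine ⟨fun n => π n Q + z n • π n ![r, 0, 1], ?_, ?_⟩
  · have := hP.add (hz0.smul hR)
    rwa [zero_smul, add_zero] at this
  · filter_upwards [hev, hL1.eventually_ne hγ] with n hn hn1
    refine ⟨?_, (hz n hn).1⟩
    rw [(hA n).eval_of_one, Fin.sum_univ_three]
    change (Q 0 + z n * r) * L n 0 + (-(L n 0 * Q 0 + L n 2 * Q 2) / L n 1 +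
      z n * (-(L n 0 * r + L n 2 * 1) / L n 1)) * L n 1 + (Q 2 + z n * 1) * L n 2 = 0
    field_simp
    ring

theorem eventually_nice_of_mul_X {ι : Type*} [Finite ι] {k k' : ι → ℕ} {B : Finset ι}
    (hkB : ∀ i ∈ B, k' i = k i - 1) (hkB' : ∀ i ∉ B, k' i = k i) {e : ℕ}
    {x y : ι → Polynomial ℂ} {F : MvPolynomial (Fin 3) (Polynomial ℂ)}
    (hF : F.IsHomogeneous (e + 1)) (hfat : ∀ i, FatAt (k i) (x i) (y i) F)
    {G : MvPolynomial (Fin 3) ℂ} (hG : G.IsHomogeneous e)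
    (h0 : map (Polynomial.evalRingHom 0) F = X 1 * G)
    (hGfat : ∀ i, FatAt (k' i) ((x i).eval 0) ((y i).eval 0) G)
    (hGn : Nice k' (fun i => (x i).eval 0) (fun i => (y i).eval 0) G)
    (hB : ∀ i, (y i).eval 0 = 0 ↔ i ∈ B)
    (hc : ∀ i ∈ B, coeff (Finsupp.single 0 (k' i)) (loc ((x i).eval 0) 0 G) ≠ 0)
    (htr : tr 0 G ≠ 0) (hdeg : ∑ i ∈ B, k' i + 1 ≤ e)
    (hF1 : ∀ Q : Fin 3 → ℂ, Q ≠ 0 → Q 1 = 0 → eval Q G = 0 →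
      eval Q (map (Polynomial.evalRingHom 0) (paramDeriv F)) = 0 →
      ∃ i ∈ B, 1 ≤ k i ∧ ∃ c : ℂ, Q = c • ![(x i).eval 0, 0, 1]) :
    ∀ᶠ t in 𝓝[≠] (0 : ℂ), Nice k (fun i => (x i).eval t) (fun i => (y i).eval t)
      (map (Polynomial.evalRingHom t) F) := by
  classical
  have hFt : CoeffTendsto (fun t => map (Polynomial.evalRingHom t) F) (𝓝[≠] 0) (X 1 * G) :=
    h0 ▸ coeffTendsto_map_eval F 0
  have hFh : ∀ t : ℂ, (map (Polynomial.evalRingHom t) F).IsHomogeneous (e + 1) := fun t => hF.map _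
  have hF1t := coeffTendsto_map_eval (paramDeriv F) 0
  have hpt : ∀ p : Polynomial ℂ, Tendsto (fun t => p.eval t) (𝓝[≠] (0 : ℂ)) (𝓝 (p.eval 0)) :=
    fun p => (p.continuous.tendsto 0).mono_left nhdsWithin_le_nhds
  have hfat' : ∀ (t : ℂ) i, FatAt (k i) ((x i).eval t) ((y i).eval t)
      (map (Polynomial.evalRingHom t) F) := by
    intro t i e' he'
    have := hfat i e' he'
    have h1 := congrArg (Polynomial.evalRingHom t) this
    rw [← coeff_map, map_loc, map_zero] at h1
    exact h1
  have hcone : ∀ i, ReducedCone (k i) ((x i).eval 0) ((y i).eval 0) (X 1 * G) := by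
    intro i
    by_cases hi : i ∈ B
    · rw [(hB i).2 hi]
      refine reducedCone_X_mul_on (hkB i hi) (hc i hi) ?_
      have := hGn.cone i
      rwa [(hB i).2 hi] at this
    · have hy : (y i).eval 0 ≠ 0 := fun h => hi ((hB i).1 h)
      refine reducedCone_X_mul_off hy ?_ ?_
      · rw [← hkB' i hi]; exact hGfat i
      · rw [← hkB' i hi]; exact hGn.cone i
  have c1 : ∀ᶠ t in 𝓝[≠] (0 : ℂ), ∀ i, ReducedCone (k i) ((x i).eval t) ((y i).eval t)
      (map (Polynomial.evalRingHom t) F) :=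
    eventually_all.2 fun i => eventually_reducedCone hFt (hpt _) (hpt _) (hcone i)
  have c2 : ∀ᶠ t in 𝓝[≠] (0 : ℂ), ∀ Q : Fin 3 → ℂ, Q ≠ 0 →
      (∀ j, eval Q (pderiv j (map (Polynomial.evalRingHom t) F)) = 0) →
      ∃ i, 1 ≤ k i ∧ ∃ c : ℂ, Q = c • ![(x i).eval t, (y i).eval t, 1] := by
    by_contra hcon
    rw [not_eventually] at hcon
    have hcon := hcon.and_eventually (paramDeriv_eq_zero_of_singular F)
    obtain ⟨U, hU⟩ := exists_ultrafilter_of_frequently hcon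
    have h1 := fun t : {t : ℂ // (¬ ∀ Q : Fin 3 → ℂ, Q ≠ 0 →
      (∀ j, eval Q (pderiv j (map (Polynomial.evalRingHom t) F)) = 0) →
      ∃ i, 1 ≤ k i ∧ ∃ c : ℂ, Q = c • ![(x i).eval t, (y i).eval t, 1]) ∧
      ∀ Q : Fin 3 → ℂ, eval₂ (Polynomial.evalRingHom t) Q F = 0 →
      (∀ j, eval₂ (Polynomial.evalRingHom t) Q (pderiv j F) = 0) →
      eval₂ (Polynomial.evalRingHom t) Q (paramDeriv F) = 0} => t.2.1
    push Not at h1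
    choose Q hQ0 hQ1 hQ2 using h1
    obtain ⟨c, w, hc', hw, hlim⟩ := exists_tendsto_smul U hQ0
    have hz : ∀ n j, eval (c n • Q n) (pderiv j (map (Polynomial.evalRingHom n.1) F)) = 0 :=
      fun n j => by rw [(hFh n.1).pderiv.eval_smul, hQ1 n j, mul_zero]
    have hz0 : ∀ n, eval (c n • Q n) (map (Polynomial.evalRingHom n.1) F) = 0 := by
      intro n
      have := (hFh n.1).sum_mul_eval_pderiv (c n • Q n)
      simp only [hz n, mul_zero, Finset.sum_const_zero] at this
      exact (mul_eq_zero.1 this.symm).resolve_left (by exact_mod_cast Nat.succ_ne_zero e)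
    have hz1 : ∀ n, eval (c n • Q n) (map (Polynomial.evalRingHom n.1) (paramDeriv F)) = 0 := by
      intro n
      rw [eval_map]
      refine n.2.2 _ ?_ fun j => ?_
      · rw [← eval_map]; exact hz0 n
      · rw [← eval_map, ← pderiv_map]; exact hz n j
    have hw1 : eval w (map (Polynomial.evalRingHom 0) (paramDeriv F)) = 0 :=
      tendsto_nhds_unique ((hF1t.comp hU).eval hlim)
        (tendsto_const_nhds.congr fun n => (hz1 n).symm)
    have hwd : ∀ j, eval w (pderiv j (X 1 * G)) = 0 := fun j =>
      tendsto_nhds_unique (((hFt.comp hU).linearMap (pderiv j).toLinearMap).eval hlim)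
        (tendsto_const_nhds.congr fun n => (hz n j).symm)
    have hfin : ∃ i, 1 ≤ k i ∧ ∃ c' : ℂ, w = c' • ![(x i).eval 0, (y i).eval 0, 1] := by
      have d0 := hwd 0
      have d1 := hwd 1
      have d2 := hwd 2
      simp [Derivation.leibniz, pderiv_X] at d0 d1 d2
      by_cases hw1' : w 1 = 0
      · rw [hw1', zero_mul, zero_add] at d1
        obtain ⟨i, hi, hki, c', hc'⟩ := hF1 w hw hw1' d1 hw1
        exact ⟨i, hki, c', by rw [(hB i).2 hi]; exact hc'⟩
      · have d0' := d0.resolve_left hw1'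
        have d2' := d2.resolve_left hw1'
        have hE := hG.sum_mul_eval_pderiv w
        rw [Fin.sum_univ_three, d0', d2', mul_zero, mul_zero, zero_add, add_zero] at hE
        have hG0 : eval w G = 0 := by
          have : ((e : ℂ) + 1) * eval w G = 0 := by linear_combination d1 - hE
          exact (mul_eq_zero.1 this).resolve_left (by exact_mod_cast Nat.succ_ne_zero e)
        rw [hG0, add_zero] at d1
        have d1' := (mul_eq_zero.1 d1).resolve_left hw1'
        obtain ⟨i, hi, c', hc'⟩ := hGn.smooth w hw fun j => by
          fin_cases j
          · exact d0'
          · exact d1'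
          · exact d2'
        have hiB : i ∉ B := fun hiB => hw1' (by rw [hc', (hB i).2 hiB]; simp)
        exact ⟨i, hkB' i hiB ▸ hi, c', hc'⟩
    obtain ⟨i, hi, c', hc''⟩ := hfin
    have hc0 : c' ≠ 0 := fun h0 => hw (by rw [hc'', h0, zero_smul])
    rw [hc''] at hlim
    refine not_tendsto_singular_proj U (hFt.comp hU) (fun n => hFh n.1) hi ((hpt (x i)).comp hU)
      ((hpt (y i)).comp hU) (fun n => hfat' n.1 i) (hcone i) hc0 hlim
      (Eventually.of_forall fun n => ⟨fun c3 h' => hQ2 n i hi ((c n)⁻¹ * c3) ?_, hz n⟩)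
    rw [mul_smul]
    exact (inv_smul_eq_iff₀ (hc' n)).2 h'.symm |>.symm
  have hX : Prime (X 1 : MvPolynomial (Fin 3) ℂ) := X_prime
  have hXG : X 1 * G ≠ 0 := mul_ne_zero hX.ne_zero hGn.irred.ne_zero
  obtain ⟨Q, hQ0, hQ1, hQG, hQ⟩ := exists_zero_off_points hG hc htr hdeg
  have key : ∀ (p : ℂ → Prop) (U : Ultrafilter {t // p t})
      (_ : Tendsto (Subtype.val : {t // p t} → ℂ) U (𝓝[≠] 0))
      (A B : {t // p t} → MvPolynomial (Fin 3) ℂ) (a b : ℕ) (_ : a + b = e + 1) (_ : 1 ≤ b)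
      (_ : ∀ t, map (Polynomial.evalRingHom t.1) F = A t * B t)
      (_ : ∀ t, (A t).IsHomogeneous a) (_ : ∀ t, (B t).IsHomogeneous b) (α β : {t // p t} → ℂ)
      (A' B' : MvPolynomial (Fin 3) ℂ) (c : ℂ) (_ : ∀ t, α t ≠ 0) (_ : ∀ t, β t ≠ 0)
      (_ : A'.IsHomogeneous a) (_ : B'.IsHomogeneous b)
      (_ : CoeffTendsto (fun t => C (α t) * A t) U A')
      (_ : CoeffTendsto (fun t => C (β t) * B t) U B')
      (_ : X 1 * G = C c * (A' * B')), X 1 ∣ A' → False := by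
    intro p U hU A B a b hab hb hAB hA hB' α β A' B' c hα hβ hA' hBh hAt hBt hGc hdvd
    obtain ⟨A2, rfl⟩ := hdvd
    have hG2 : G = C c * A2 * B' := mul_left_cancel₀ hX.ne_zero (by rw [hGc]; ring)
    have hne : C c * A2 * B' ≠ 0 := hG2 ▸ hGn.irred.ne_zero
    have hu : IsUnit (C c * A2) := (hGn.irred.isUnit_or_isUnit hG2).resolve_right fun hu => by
      have := (hBh.isUnit_iff (right_ne_zero_of_mul hne)).1 hu
      omega
    have hu2 : IsUnit A2 := isUnit_of_mul_isUnit_right hu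
    obtain ⟨γ, hγ, rfl⟩ : ∃ γ : ℂ, γ ≠ 0 ∧ A2 = C γ := by
      rw [MvPolynomial.isUnit_iff_eq_C_of_isReduced] at hu2
      obtain ⟨γ, hγ, h⟩ := hu2
      exact ⟨γ, hγ.ne_zero, h⟩
    have hAγ : (X 1 * C γ : MvPolynomial (Fin 3) ℂ).IsHomogeneous 1 :=
      (isHomogeneous_X _ _).mul (isHomogeneous_C _ _)
    obtain rfl : a = 1 := hA'.inj_right hAγ (mul_ne_zero hX.ne_zero (by simpa using hγ))
    obtain rfl : b = e := by omega
    have hcc : C (c * γ) ≠ (0 : MvPolynomial (Fin 3) ℂ) := by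
      rw [C_mul]; exact left_ne_zero_of_mul hne
    have hQB : eval Q B' = 0 := by
      rw [hG2, map_mul] at hQG
      refine (mul_eq_zero.1 hQG).resolve_left ?_
      rw [← C_mul, eval_C]
      simpa using hcc
    have htrB : tr 0 B' ≠ 0 := fun h => htr (by rw [hG2, map_mul, h, mul_zero])
    rw [mul_comm] at hAt
    obtain ⟨Z, hZ, hZ0⟩ := exists_singular_tendsto U hγ (by omega : 0 < b)
      (fun t => by simpa using (isHomogeneous_C _ (α t)).mul (hA t))
      (fun t => by simpa using (isHomogeneous_C _ (β t)).mul (hB' t))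
      hAt hBt htrB hQ1 hQB
    have hfr : ∀ᶠ t in (U : Filter {t // p t}), ∃ i, 1 ≤ k i ∧
        Z t - Z t 2 • ![(x i).eval t.1, (y i).eval t.1, 1] ∈ ({0} : Set (Fin 3 → ℂ)) := by
      filter_upwards [hZ0, hZ.eventually_ne hQ0, hU.eventually c2] with t ht htQ hts
      obtain ⟨i, hi, c', hc'⟩ := hts (Z t) htQ fun j => by
        have h1 := ht.1
        have h2 := ht.2
        simp only [map_mul, eval_C, mul_eq_zero, hα, hβ, false_or] at h1 h2
        rw [hAB, Derivation.leibniz]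
        simp [h1, h2]
      refine ⟨i, hi, ?_⟩
      have : Z t 2 = c' := by rw [hc']; simp
      rw [Set.mem_singleton_iff, this, sub_eq_zero]
      exact hc'
    obtain ⟨i, hi⟩ := frequently_exists.1 hfr.frequently
    obtain ⟨t0, hki, -⟩ := hi.exists
    have hlim : Tendsto (fun t : {t // p t} => Z t - Z t 2 • ![(x i).eval t.1, (y i).eval t.1, 1])
        U (𝓝 (Q - Q 2 • ![(x i).eval 0, (y i).eval 0, 1])) := by
      refine hZ.sub (((tendsto_pi_nhds.1 hZ) 2).smul ?_)
      rw [tendsto_pi_nhds]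
      intro j
      fin_cases j
      · exact (hpt (x i)).comp hU
      · exact (hpt (y i)).comp hU
      · exact tendsto_const_nhds
    have := isClosed_singleton.mem_of_frequently_of_tendsto (hi.mono fun _ h => h.2) hlim
    rw [Set.mem_singleton_iff, sub_eq_zero] at this
    have hQ2 : Q 2 ≠ 0 := fun h => hQ0 (by rw [this, h, zero_smul])
    have hyi : (y i).eval 0 = 0 := by
      have h1 := congrFun this 1
      rw [hQ1] at h1
      simpa [hQ2] using h1.symm
    exact hQ i ((hB i).1 hyi) (Q 2) (by rw [hyi] at this; exact this)
  have hne : ∀ᶠ t in 𝓝[≠] (0 : ℂ), map (Polynomial.evalRingHom t) F ≠ 0 := by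
    obtain ⟨m, hm⟩ := ne_zero_iff.1 hXG
    filter_upwards [(hFt.coeff m).eventually_ne hm] with t ht h
    exact ht (by rw [h, coeff_zero])
  have c3 : ∀ᶠ t in 𝓝[≠] (0 : ℂ), Irreducible (map (Polynomial.evalRingHom t) F) := by
    by_contra hcon
    rw [not_eventually] at hcon
    have h1 := (hcon.and_eventually hne).mono fun t ht =>
      exists_factors_of_not_irreducible (hFh t) (Nat.succ_ne_zero e) ht.2 ht.1
    rw [frequently_exists] at h1
    obtain ⟨a, h1⟩ := h1
    obtain ⟨U, hU⟩ := exists_ultrafilter_of_frequently h1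
    obtain ⟨n0, hn0⟩ := h1.exists
    have ha1 := hn0.1
    have h2 := fun n : {t : ℂ // 1 ≤ a.1 ∧ ∃ A B, map (Polynomial.evalRingHom t) F = A * B ∧
      A ≠ 0 ∧ B ≠ 0 ∧ A.IsHomogeneous a ∧ B.IsHomogeneous (e + 1 - a)} => n.2.2
    choose A B hAB hA0 hB0 hA hB' using h2
    obtain ⟨α, β, A', B', c, hα, hβ, hA', hB0', hAh, hBh, hAt, hBt, hGc⟩ :=
      exists_limit_factorization U (hFt.comp hU) hAB hA hB' hA0 hB0
    have hdvd : X 1 ∣ C c * (A' * B') := hGc ▸ dvd_mul_right _ _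
    have hc0 : c ≠ 0 := fun h => hXG (by rw [hGc, h, C_0, zero_mul])
    have hlt := a.2
    rcases hX.dvd_or_dvd hdvd with h | h
    · have := isUnit_of_dvd_unit h ((isUnit_iff_ne_zero.2 hc0).map C)
      exact hX.not_isUnit this
    · rcases hX.dvd_or_dvd h with h | h
      · exact key _ U hU A B a (e + 1 - a) (by omega) (by omega) hAB hA hB' α β A' B' c hα hβ
          hAh hBh hAt hBt hGc h
      · exact key _ U hU B A (e + 1 - a) a (by omega) (by omega)
          (fun t => by rw [hAB, mul_comm]) hB' hA β α B' A' c hβ hα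
          hBh hAh hBt hAt (by rw [hGc, mul_comm A']) h
  filter_upwards [c1, c2, c3] with t h1 h2 h3
  exact ⟨h1, h2, h3⟩

/-- Homogeneous polynomials of degree `d` whose local expansion at each point `(x i, y i, 1)` has
no monomial with exponent in `N i`. -/
def sys {ι R : Type*} [CommRing R] (d : ℕ) (x y : ι → R) (N : ι → Finset (Fin 2 →₀ ℕ)) :
    Submodule R (MvPolynomial (Fin 3) R) :=
  homogeneousSubmodule (Fin 3) R d ⊓
    ⨅ i, ⨅ e ∈ N i, LinearMap.ker (lcoeff R e ∘ₗ (loc (x i) (y i)).toLinearMap)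

theorem mem_sys {ι R : Type*} [CommRing R] {d : ℕ} {x y : ι → R} {N : ι → Finset (Fin 2 →₀ ℕ)}
    {F : MvPolynomial (Fin 3) R} : F ∈ sys d x y N ↔
      F.IsHomogeneous d ∧ ∀ i, ∀ e ∈ N i, coeff e (loc (x i) (y i) F) = 0 := by
  simp [sys, Submodule.mem_iInf]

theorem map_mem_sys {ι R S : Type*} [CommRing R] [CommRing S] (φ : R →+* S) {d : ℕ} {x y : ι → R}
    {N : ι → Finset (Fin 2 →₀ ℕ)} {F : MvPolynomial (Fin 3) R} (h : F ∈ sys d x y N) :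
    map φ F ∈ sys d (fun i => φ (x i)) (fun i => φ (y i)) N := by
  rw [mem_sys] at h ⊢
  refine ⟨h.1.map φ, fun i e he => ?_⟩
  rw [← map_loc, coeff_map, h.2 i e he, map_zero]

/-- Exponents of degree less than `k`. -/
def fatSet (k : ℕ) : Finset (Fin 2 →₀ ℕ) :=
  (Finset.range k).biUnion fun j => Finset.univ.finsuppAntidiag j

theorem mem_fatSet {k : ℕ} {e : Fin 2 →₀ ℕ} : e ∈ fatSet k ↔ e.degree < k := by
  simp [fatSet, Finsupp.degree_eq_sum]

theorem card_fatSet (k : ℕ) : (fatSet k).card = (k + 1).choose 2 := by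
  rw [fatSet, Finset.card_biUnion]
  · simp only [Finset.card_finsuppAntidiag_nat_eq_choose, Finset.card_univ, Fintype.card_fin]
    induction k with
    | zero => rfl
    | succ k ih =>
      rw [Finset.sum_range_succ, ih, Nat.choose_succ_succ' (k + 1) 1, Nat.choose_one_right,
        Nat.choose_symm_of_eq_add (show 2 + k - 1 = k + 1 by omega), Nat.choose_one_right, add_comm,
        show 2 + k - 1 = k + 1 by omega]
  · intro i _ j _ hij
    rw [Function.onFun, Finset.disjoint_left]
    intro e he he₁
    simp only [Finset.mem_finsuppAntidiag] at he he₁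
    exact hij (he.1.symm.trans he₁.1)

/-- Exponents of the monomials of degree `d` in three variables. -/
abbrev Idx (d : ℕ) : Type := ↥(Finset.univ.finsuppAntidiag d : Finset (Fin 3 →₀ ℕ))

theorem card_idx (d : ℕ) : Fintype.card (Idx d) = (d + 2).choose 2 := by
  rw [Fintype.card_coe, Finset.card_finsuppAntidiag_nat_eq_choose]
  rw [Finset.card_univ, Fintype.card_fin, show 3 + d - 1 = d + 2 by omega]
  exact Nat.choose_symm_of_eq_add rfl

section
variable {ι R : Type*} [CommRing R]

/-- The polynomial with given coefficients in degree `d`. -/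
def toPoly (R : Type*) [CommRing R] (d : ℕ) : (Idx d → R) →ₗ[R] MvPolynomial (Fin 3) R :=
  Fintype.linearCombination R fun e : Idx d => monomial e.1 (1 : R)

theorem coeff_toPoly {d : ℕ} (c : Idx d → R) (e : Idx d) : coeff e.1 (toPoly R d c) = c e := by
  classical
  simp [toPoly, Fintype.linearCombination_apply, coeff_sum, coeff_monomial]

theorem toPoly_isHomogeneous {d : ℕ} (c : Idx d → R) : (toPoly R d c).IsHomogeneous d := by
  rw [toPoly, Fintype.linearCombination_apply]
  refine IsHomogeneous.sum _ _ _ fun e _ => ?_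
  rw [smul_monomial]
  refine isHomogeneous_monomial _ ?_
  have := (Finset.mem_finsuppAntidiag.1 e.2).1
  rwa [Finsupp.degree_eq_sum]

theorem toPoly_coeff {d : ℕ} {F : MvPolynomial (Fin 3) R} (hF : F.IsHomogeneous d) :
    toPoly R d (fun e => coeff e.1 F) = F := by
  ext e
  by_cases he : e.degree = d
  · exact coeff_toPoly _ ⟨e, by simpa [Finsupp.degree_eq_sum] using he⟩
  · rw [(toPoly_isHomogeneous _).coeff_eq_zero he, hF.coeff_eq_zero he]

theorem toPoly_injective (R : Type*) [CommRing R] (d : ℕ) : Function.Injective (toPoly R d) := by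
  intro a b h
  ext e
  rw [← coeff_toPoly a, h, coeff_toPoly]

theorem map_toPoly {S : Type*} [CommRing S] (φ : R →+* S) {d : ℕ} (c : Idx d → R) :
    map φ (toPoly R d c) = toPoly S d (fun e => φ (c e)) := by
  rw [← toPoly_coeff ((toPoly_isHomogeneous c).map φ)]
  simp only [coeff_map, coeff_toPoly]

/-- The matrix of the linear conditions defining `sys`. -/
def condMatrix (d : ℕ) (x y : ι → R) (N : ι → Finset (Fin 2 →₀ ℕ)) :
    Matrix (Σ i, ↥(N i)) (Idx d) R :=
  fun p e => coeff p.2.1 (loc (x p.1) (y p.1) (monomial e.1 1))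

theorem condMatrix_map {S : Type*} [CommRing S] (φ : R →+* S) (d : ℕ) (x y : ι → R)
    (N : ι → Finset (Fin 2 →₀ ℕ)) : (condMatrix d x y N).map φ =
      condMatrix d (fun i => φ (x i)) (fun i => φ (y i)) N := by
  ext p e
  simp only [condMatrix, Matrix.map_apply]
  rw [← coeff_map, map_loc, map_monomial, map_one]

theorem condMatrix_mulVec (d : ℕ) (x y : ι → R) (N : ι → Finset (Fin 2 →₀ ℕ)) (c : Idx d → R)
    (p : Σ i, ↥(N i)) : (condMatrix d x y N).mulVec c p =
      coeff p.2.1 (loc (x p.1) (y p.1) (toPoly R d c)) := by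
  rw [toPoly, Fintype.linearCombination_apply, map_sum, coeff_sum]
  simp only [Matrix.mulVec, dotProduct, condMatrix, map_smul, coeff_smul, smul_eq_mul, mul_comm]

theorem toPoly_mem_sys_iff {d : ℕ} {x y : ι → R} {N : ι → Finset (Fin 2 →₀ ℕ)} {c : Idx d → R} :
    toPoly R d c ∈ sys d x y N ↔ (condMatrix d x y N).mulVec c = 0 := by
  rw [mem_sys]
  constructor
  · rintro ⟨-, h⟩
    ext p
    rw [condMatrix_mulVec]
    exact h _ _ p.2.2
  · exact fun h => ⟨toPoly_isHomogeneous c, fun i e he => by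
      have := congrFun h ⟨i, e, he⟩
      rwa [condMatrix_mulVec] at this⟩

theorem sys_eq_map (d : ℕ) (x y : ι → R) (N : ι → Finset (Fin 2 →₀ ℕ)) :
    sys d x y N = (LinearMap.ker (condMatrix d x y N).mulVecLin).map (toPoly R d) := by
  ext F
  constructor
  · intro h
    have h1 := toPoly_coeff (mem_sys.1 h).1
    refine ⟨_, ?_, h1⟩
    rw [← h1] at h
    exact toPoly_mem_sys_iff.1 h
  · rintro ⟨c, hc, rfl⟩
    exact toPoly_mem_sys_iff.2 hc

end

theorem finrank_map_toPoly (d : ℕ) (V : Submodule ℂ (Idx d → ℂ)) :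
    Module.finrank ℂ (V.map (toPoly ℂ d)) = Module.finrank ℂ V :=
  (V.equivMapOfInjective _ (toPoly_injective ℂ d)).finrank_eq.symm

instance (d : ℕ) : FiniteDimensional ℂ (homogeneousSubmodule (Fin 3) ℂ d) := by
  have : homogeneousSubmodule (Fin 3) ℂ d = LinearMap.range (toPoly ℂ d) := by
    ext F
    exact ⟨fun h => ⟨_, toPoly_coeff h⟩, by rintro ⟨c, rfl⟩; exact toPoly_isHomogeneous c⟩
  rw [this]
  infer_instance

theorem sys_le {ι R : Type*} [CommRing R] (d : ℕ) (x y : ι → R) (N : ι → Finset (Fin 2 →₀ ℕ)) :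
    sys d x y N ≤ homogeneousSubmodule (Fin 3) R d := inf_le_left

instance {ι : Type*} (d : ℕ) (x y : ι → ℂ) (N : ι → Finset (Fin 2 →₀ ℕ)) :
    FiniteDimensional ℂ (sys d x y N) :=
  Submodule.finiteDimensional_of_le (sys_le d x y N)

theorem le_finrank_sys {ι : Type*} [Fintype ι] (d : ℕ) (x y : ι → ℂ)
    (N : ι → Finset (Fin 2 →₀ ℕ)) :
    (d + 2).choose 2 ≤ Module.finrank ℂ (sys d x y N) + ∑ i, (N i).card := by
  classical
  rw [sys_eq_map, finrank_map_toPoly]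
  have h1 := LinearMap.finrank_range_add_finrank_ker (condMatrix d x y N).mulVecLin
  have h2 := Submodule.finrank_le (LinearMap.range (condMatrix d x y N).mulVecLin)
  rw [Module.finrank_fintype_fun_eq_card, card_idx] at h1
  simp only [Module.finrank_fintype_fun_eq_card, Fintype.card_sigma, Fintype.card_coe] at h2
  omega

theorem sys_limit {ι : Type*} [Fintype ι] {d : ℕ} {x y : ι → Polynomial ℂ}
    {N : ι → Finset (Fin 2 →₀ ℕ)} {S : Submodule ℂ (MvPolynomial (Fin 3) ℂ)}
    (hS : S ≤ homogeneousSubmodule (Fin 3) ℂ d)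
    (h : ∀ F ∈ sys d x y N, map (Polynomial.evalRingHom 0) F ∈ S) :
    (∀ᶠ t in 𝓝[≠] (0 : ℂ), Module.finrank ℂ
      (sys d (fun i => (x i).eval t) (fun i => (y i).eval t) N) ≤ Module.finrank ℂ S) ∧
    ((∃ᶠ t in 𝓝[≠] (0 : ℂ), Module.finrank ℂ S ≤
      Module.finrank ℂ (sys d (fun i => (x i).eval t) (fun i => (y i).eval t) N)) →
      ∀ s ∈ S, ∃ F ∈ sys d x y N, map (Polynomial.evalRingHom 0) F = s) := by
  classical
  have hcomap : (S.comap (toPoly ℂ d)).map (toPoly ℂ d) = S := by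
    rw [Submodule.map_comap_eq, inf_eq_right]
    exact fun F hF => ⟨_, toPoly_coeff (hS hF)⟩
  have h1 := kernel_limit (condMatrix d x y N) (S.comap (toPoly ℂ d)) fun c hc => by
    have := h _ (toPoly_mem_sys_iff.2 hc)
    rw [map_toPoly] at this
    exact this
  have hfin : Module.finrank ℂ (S.comap (toPoly ℂ d)) = Module.finrank ℂ S := by
    rw [← finrank_map_toPoly, hcomap]
  have hfin' : ∀ t : ℂ, Module.finrank ℂ (LinearMap.ker
      ((condMatrix d x y N).map (Polynomial.evalRingHom t)).mulVecLin) =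
      Module.finrank ℂ (sys d (fun i => (x i).eval t) (fun i => (y i).eval t) N) := by
    intro t
    rw [sys_eq_map, finrank_map_toPoly, condMatrix_map]
    rfl
  simp only [hfin, hfin'] at h1
  refine ⟨h1.1, fun hf s hs => ?_⟩
  obtain ⟨c, hc, hcs⟩ := h1.2 hf (fun e => coeff e.1 s) (by
    rw [Submodule.mem_comap, toPoly_coeff (hS hs)]; exact hs)
  refine ⟨toPoly _ d c, toPoly_mem_sys_iff.2 hc, ?_⟩
  rw [map_toPoly, ← toPoly_coeff (hS hs), ← hcs]
  rfl

/-- The expected dimension of the system of forms of degree `d` with multiplicities `k`. -/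
def chi {ι : Type*} [Fintype ι] (d : ℕ) (k : ι → ℕ) : ℤ :=
  ((d + 2).choose 2 : ℤ) - ∑ i, ((k i + 1).choose 2 : ℤ)

/-- Exponent sets of fat points. -/
abbrev fats {ι : Type*} (k : ι → ℕ) : ι → Finset (Fin 2 →₀ ℕ) := fun i => fatSet (k i)

theorem mem_sys_fats {ι R : Type*} [CommRing R] {d : ℕ} {x y : ι → R} {k : ι → ℕ}
    {F : MvPolynomial (Fin 3) R} : F ∈ sys d x y (fats k) ↔
      F.IsHomogeneous d ∧ ∀ i, FatAt (k i) (x i) (y i) F := by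
  simp only [mem_sys, mem_fatSet, FatAt]

theorem chi_le_finrank {ι : Type*} [Fintype ι] (d : ℕ) (k : ι → ℕ) (x y : ι → ℂ) :
    chi d k ≤ Module.finrank ℂ (sys d x y (fats k)) := by
  have := le_finrank_sys d x y (fats k)
  simp only [card_fatSet] at this
  zify at this
  rw [chi]
  linarith

/-- Residual multiplicities with respect to a line through the points of `B`. -/
def res {ι : Type*} [DecidableEq ι] (B : Finset ι) (k : ι → ℕ) : ι → ℕ :=
  fun i => if i ∈ B then k i - 1 else k i

section
variable {ι : Type*} [DecidableEq ι] {B : Finset ι} {k : ι → ℕ}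

theorem res_on {i : ι} (hi : i ∈ B) : res B k i = k i - 1 := if_pos hi

theorem res_off {i : ι} (hi : i ∉ B) : res B k i = k i := if_neg hi

theorem res_le (i : ι) : res B k i ≤ k i := by
  rw [res]; split_ifs <;> omega

theorem chi_succ [Fintype ι] (d : ℕ) (B : Finset ι) (k : ι → ℕ) :
    chi (d + 1) k = chi d (res B k) + (d + 2) - ∑ i ∈ B, (k i : ℤ) := by
  have h : ∀ i, ((k i + 1).choose 2 : ℤ) = ((res B k i + 1).choose 2 : ℤ) +
      if i ∈ B then (k i : ℤ) else 0 := by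
    intro i
    by_cases hi : i ∈ B
    · rw [res_on hi, if_pos hi]
      cases k i with
      | zero => simp
      | succ n =>
        rw [Nat.choose_succ_succ' (n + 1) 1, Nat.choose_one_right]
        push_cast
        ring
    · rw [res_off hi, if_neg hi, add_zero]
  simp only [chi, h, Finset.sum_add_distrib, Finset.sum_ite_mem, Finset.univ_inter]
  rw [show d + 1 + 2 = (d + 2) + 1 by ring, Nat.choose_succ_succ' (d + 2) 1, Nat.choose_one_right]
  push_cast
  ring

end

theorem coeff_X_one_add_C_mul {R : Type*} [CommRing R] (y : R) (g : MvPolynomial (Fin 2) R)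
    (e : Fin 2 →₀ ℕ) : coeff e ((X 1 + C y) * g) =
      (if e 1 = 0 then 0 else coeff (e - Finsupp.single 1 1) g) + y * coeff e g := by
  rw [add_mul, coeff_add, coeff_C_mul, mul_comm, coeff_mul_X']
  simp only [Finsupp.mem_support_iff, ite_not]

theorem fatAt_X_mul_of_fatAt {R : Type*} [CommRing R] {k : ℕ} {x y : R}
    {G : MvPolynomial (Fin 3) R} (h : FatAt k x y G) : FatAt k x y (X 1 * G) := by
  intro e he
  rw [loc_X_mul, ← add_mul, coeff_X_one_add_C_mul, h e he, mul_zero, add_zero]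
  split_ifs
  · rfl
  · refine h _ (lt_of_le_of_lt ?_ he)
    exact Finsupp.degree_mono tsub_le_self

theorem fatAt_of_X_mul {R : Type*} [CommRing R] [IsDomain R] {k : ℕ} {x y : R} (hy : y ≠ 0)
    {G : MvPolynomial (Fin 3) R} (h : FatAt k x y (X 1 * G)) : FatAt k x y G := by
  suffices ∀ n, ∀ e : Fin 2 →₀ ℕ, e.degree = n → n < k → coeff e (loc x y G) = 0 from
    fun e he => this _ e rfl he
  intro n
  induction n using Nat.strong_induction_on with
  | _ n ih =>
    intro e he hn
    have h1 := h e (he ▸ hn)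
    rw [loc_X_mul, ← add_mul, coeff_X_one_add_C_mul] at h1
    split_ifs at h1 with h0
    · simpa [hy] using h1
    · have h2 : (e - Finsupp.single 1 1).degree + 1 = n := by
        simp only [Finsupp.degree_eq_sum, Fin.sum_univ_two] at he ⊢
        simp
        omega
      rw [ih _ (by omega) _ rfl (by omega), zero_add] at h1
      exact (mul_eq_zero.1 h1).resolve_left hy

theorem coeff_X_one_mul {R : Type*} [CommRing R] (g : MvPolynomial (Fin 2) R)
    (e : Fin 2 →₀ ℕ) : coeff (e + Finsupp.single 1 1) (X 1 * g) = coeff e g := by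
  rw [add_comm, coeff_X_mul]

theorem fatAt_X_mul_iff {R : Type*} [CommRing R] {k : ℕ} {x : R}
    {G : MvPolynomial (Fin 3) R} : FatAt k x 0 (X 1 * G) ↔ FatAt (k - 1) x 0 G := by
  constructor
  · intro h e he
    have := h (e + Finsupp.single 1 1) (by simp; omega)
    rwa [loc_X_mul, C_0, zero_mul, add_zero, coeff_X_one_mul] at this
  · intro h e he
    rw [loc_X_mul, ← add_mul, coeff_X_one_add_C_mul, zero_mul, add_zero]
    split_ifs with h0
    · rfl
    · refine h _ ?_
      simp only [Finsupp.degree_eq_sum, Fin.sum_univ_two] at he ⊢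
      simp
      omega

theorem tr_X_mul {R : Type*} [CommRing R] (y : R) (G : MvPolynomial (Fin 3) R) :
    tr y (X 1 * G) = Polynomial.C y * tr y G := by
  rw [map_mul, (tr_X y).2.1]

theorem coeff_tr {R : Type*} [CommRing R] {d : ℕ} {F : MvPolynomial (Fin 3) R}
    (hF : F.IsHomogeneous d) {e : Fin 3 →₀ ℕ} (he : e 1 = 0) (hed : e.degree = d) :
    (tr 0 F).coeff (e 0) = coeff e F := by
  have h1 : tr 0 F = ∑ a ∈ F.support, Polynomial.C (coeff a F) *
      (Polynomial.X ^ (a 0) * (0 ^ (a 1) * 1)) := by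
    conv_lhs => rw [F.as_sum]
    rw [map_sum]
    refine Finset.sum_congr rfl fun a _ => ?_
    rw [tr, restrictLine, aeval_monomial, Finsupp.prod_fintype _ _ (by simp), Fin.prod_univ_three]
    simp
  rw [h1, Polynomial.finsetSum_coeff, Finset.sum_eq_single e]
  · simp [he]
  · intro a ha hae
    by_cases h2 : a 1 = 0
    · rw [h2, pow_zero, one_mul, mul_one, Polynomial.coeff_C_mul, Polynomial.coeff_X_pow,
        if_neg, mul_zero]
      intro h3
      apply hae
      have h4 : a.degree = d := by
        by_contra h5
        exact mem_support_iff.1 ha (hF.coeff_eq_zero h5)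
      rw [Finsupp.degree_eq_sum, Fin.sum_univ_three] at h4 hed
      ext j
      fin_cases j <;> simp <;> omega
    · simp [h2]
  · intro h; simp [notMem_support_iff.1 h]

theorem exists_eq_X_mul {R : Type*} [CommRing R] [IsDomain R] {d : ℕ} {F : MvPolynomial (Fin 3) R}
    (hF : F.IsHomogeneous (d + 1)) (h : tr 0 F = 0) : ∃ G, G.IsHomogeneous d ∧ F = X 1 * G := by
  have hdvd : X 1 ∣ F := by
    rw [X_dvd_iff_modMonomial_eq_zero]
    ext e
    rw [coeff_zero]
    by_cases he1 : Finsupp.single 1 1 ≤ e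
    · exact coeff_modMonomial_of_le _ he1
    rw [coeff_modMonomial_of_not_le _ he1]
    rw [Finsupp.single_le_iff] at he1
    by_cases hed : e.degree = d + 1
    · rw [← coeff_tr hF (by omega) hed, h, Polynomial.coeff_zero]
    · exact hF.coeff_eq_zero hed
  obtain ⟨G, rfl⟩ := hdvd
  refine ⟨G, fun e he => ?_, rfl⟩
  have h1 := hF (d := e + Finsupp.single 1 1) (by rwa [add_comm, coeff_X_mul])
  rw [Finsupp.weight_apply, Finsupp.sum_fintype _ _ (by simp), Fin.sum_univ_three] at h1 ⊢
  simp at h1 ⊢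
  omega

/-- A curve of the expected system with all required generic properties, together with control of
its trace on the line `Y = 0`. -/
structure Good {ι : Type*} [Fintype ι] (d : ℕ) (k : ι → ℕ) (B : Finset ι) (x y : ι → ℂ)
    (F : MvPolynomial (Fin 3) ℂ) : Prop where
  hom : F.IsHomogeneous d
  fat : ∀ i, FatAt (k i) (x i) (y i) F
  on_iff : ∀ i, y i = 0 ↔ i ∈ B
  inj : Function.Injective x
  dim : (Module.finrank ℂ (sys d x y (fats k)) : ℤ) = chi d k
  nice : Nice k x y F
  order : ∀ i ∈ B, coeff (Finsupp.single 0 (k i)) (loc (x i) 0 F) ≠ 0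
  trace : tr 0 F ≠ 0

section
variable {ι : Type*} [Fintype ι] {d : ℕ} {k : ι → ℕ} {B : Finset ι}

theorem map_tr {R S : Type*} [CommRing R] [CommRing S] (φ : R →+* S) (y : R)
    (F : MvPolynomial (Fin 3) R) : (tr y F).map φ = tr (φ y) (map φ F) := by
  induction F using MvPolynomial.induction_on with
  | C a => simp [tr, restrictLine]
  | add p q hp hq => simp only [map_add, Polynomial.map_add, hp, hq]
  | mul_X p i hp =>
    simp only [map_mul, Polynomial.map_mul, hp, map_X]
    congr 1
    fin_cases i <;> simp [tr, restrictLine]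

theorem eventually_good {x y : ι → Polynomial ℂ} {F : MvPolynomial (Fin 3) (Polynomial ℂ)}
    (hF : F.IsHomogeneous d) (hfat : ∀ i, FatAt (k i) (x i) (y i) F) (hB : ∀ i ∈ B, y i = 0)
    (hB' : ∀ i ∉ B, y i ≠ 0) (hinj : Function.Injective x)
    (hdim : ∀ᶠ t in 𝓝[≠] (0 : ℂ), (Module.finrank ℂ
      (sys d (fun i => (x i).eval t) (fun i => (y i).eval t) (fats k)) : ℤ) ≤ chi d k)
    (hnice : ∀ᶠ t in 𝓝[≠] (0 : ℂ), Nice k (fun i => (x i).eval t) (fun i => (y i).eval t)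
      (map (Polynomial.evalRingHom t) F))
    (horder : ∀ i ∈ B, coeff (Finsupp.single 0 (k i)) (loc (x i) 0 F) ≠ 0) (htr : tr 0 F ≠ 0) :
    ∀ᶠ t in 𝓝[≠] (0 : ℂ), Good d k B (fun i => (x i).eval t) (fun i => (y i).eval t)
      (map (Polynomial.evalRingHom t) F) := by
  classical
  obtain ⟨a, ha⟩ : ∃ a, (tr 0 F).coeff a ≠ 0 := by
    by_contra! h
    exact htr (Polynomial.ext h)
  have h1 : ∀ᶠ t in 𝓝[≠] (0 : ℂ), ∀ i, i ∉ B → (y i).eval t ≠ 0 :=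
    eventually_all.2 fun i => by
      by_cases hi : i ∈ B
      · simp [hi]
      · exact (eventually_eval_ne_zero (hB' i hi) 0).mono fun t ht _ => ht
  have h2 : ∀ᶠ t in 𝓝[≠] (0 : ℂ), ∀ i j, i ≠ j → (x i - x j).eval t ≠ 0 :=
    eventually_all.2 fun i => eventually_all.2 fun j => by
      by_cases hij : i = j
      · simp [hij]
      · exact (eventually_eval_ne_zero (sub_ne_zero.2 (hinj.ne hij)) 0).mono fun t ht _ => ht
  have h3 : ∀ᶠ t in 𝓝[≠] (0 : ℂ), ∀ i, i ∈ B →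
      (coeff (Finsupp.single 0 (k i)) (loc (x i) 0 F)).eval t ≠ 0 :=
    eventually_all.2 fun i => by
      by_cases hi : i ∈ B
      · exact (eventually_eval_ne_zero (horder i hi) 0).mono fun t ht _ => ht
      · simp [hi]
  filter_upwards [hdim, hnice, h1, h2, h3, eventually_eval_ne_zero ha 0] with t t1 t2 t3 t4 t5 t6
  refine ⟨hF.map _, ?_, fun i => ⟨fun h => by_contra fun hi => t3 i hi h, fun hi => ?_⟩, ?_,
    le_antisymm t1 (chi_le_finrank _ _ _ _), t2, fun i hi => ?_, fun h => t6 ?_⟩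
  · exact (mem_sys_fats.1 (map_mem_sys (Polynomial.evalRingHom t)
      (mem_sys_fats.2 ⟨hF, hfat⟩))).2
  · rw [hB i hi, Polynomial.eval_zero]
  · intro i j hij
    by_contra hne
    exact t4 i j hne (by rw [Polynomial.eval_sub]; exact sub_eq_zero.2 hij)
  · have := t5 i hi
    rw [← Polynomial.coe_evalRingHom, ← coeff_map, map_loc, map_zero] at this
    exact this
  · have h7 := map_tr (Polynomial.evalRingHom t) 0 F
    rw [map_zero, h] at h7
    have := congrArg (fun p => p.coeff a) h7
    simpa using this

theorem Good.eventually_exists {B₁ : Finset ι} {a b : ι → ℂ} {F : MvPolynomial (Fin 3) ℂ}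
    (h : Good d k B₁ a b F) (hBB : B ⊆ B₁) {x y : ι → Polynomial ℂ} (hx : ∀ i, (x i).eval 0 = a i)
    (hy : ∀ i, (y i).eval 0 = b i) (hB : ∀ i ∈ B, y i = 0) (hB' : ∀ i ∉ B, y i ≠ 0) :
    ∀ᶠ t in 𝓝[≠] (0 : ℂ), ∃ F, Good d k B (fun i => (x i).eval t) (fun i => (y i).eval t) F := by
  have hx' : (fun i => (x i).eval 0) = a := funext hx
  have hy' : (fun i => (y i).eval 0) = b := funext hy
  obtain ⟨hle, hlift⟩ := sys_limit (d := d) (x := x) (y := y) (N := fats k)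
    (sys_le d a b (fats k)) fun F hF => by
      have := map_mem_sys (Polynomial.evalRingHom 0) hF
      simp only [Polynomial.coe_evalRingHom] at this
      rwa [hx', hy'] at this
  obtain ⟨G, hG, hG0⟩ := hlift (Eventually.frequently (Eventually.of_forall fun t => by
    zify
    rw [h.dim]
    exact chi_le_finrank _ _ _ _)) F (mem_sys_fats.2 ⟨h.hom, h.fat⟩)
  rw [mem_sys_fats] at hG
  have hpt : ∀ p : Polynomial ℂ, Tendsto (fun t => p.eval t) (𝓝[≠] (0 : ℂ)) (𝓝 (p.eval 0)) :=
    fun p => (p.continuous.tendsto 0).mono_left nhdsWithin_le_nhds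
  refine (eventually_good hG.1 hG.2 hB hB' ?_ ?_ ?_ ?_ ?_).mono fun t ht => ⟨_, ht⟩
  · intro i j hij
    apply h.inj
    rw [← hx, ← hx, hij]
  · filter_upwards [hle] with t ht
    rw [← h.dim]
    exact_mod_cast ht
  · refine eventually_nice (l := 𝓝[≠] (0 : ℂ)) (G := F) (a := a) (b := b) ?_
      (fun t => hG.1.map _) ?_ ?_ (fun t => ?_) h.nice
    · exact hG0 ▸ coeffTendsto_map_eval G 0
    · rw [← hx']
      exact tendsto_pi_nhds.2 fun i => hpt _
    · rw [← hy']
      exact tendsto_pi_nhds.2 fun i => hpt _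
    · exact (mem_sys_fats.1 (map_mem_sys (Polynomial.evalRingHom t) (mem_sys_fats.2 hG))).2
  · intro i hi h0
    apply h.order i (hBB hi)
    have h1 := map_loc (Polynomial.evalRingHom 0) (x i) 0 G
    rw [map_zero, hG0, Polynomial.coe_evalRingHom, hx] at h1
    rw [← h1, coeff_map, h0, map_zero]
  · intro h0
    apply h.trace
    have := map_tr (Polynomial.evalRingHom 0) 0 G
    rw [h0, hG0, map_zero, Polynomial.map_zero] at this
    exact this.symm

end

theorem exists_param_split {σ : Type*} (F : MvPolynomial σ (Polynomial ℂ)) :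
    ∃ F₂ : MvPolynomial σ (Polynomial ℂ),
      F = map Polynomial.C (map (Polynomial.evalRingHom 0) F) + C Polynomial.X * F₂ ∧
      map (Polynomial.evalRingHom 0) F₂ = map (Polynomial.evalRingHom 0) (paramDeriv F) := by
  classical
  have hc : ∀ e, coeff e (∑ a ∈ F.support, monomial a (Polynomial.divX (coeff a F))) =
      Polynomial.divX (coeff e F) := by
    intro e
    simp only [coeff_sum, coeff_monomial, Finset.sum_ite_eq', mem_support_iff]
    split_ifs with h
    · rfl
    · rw [not_not.1 h, Polynomial.divX_zero]
  refine ⟨∑ a ∈ F.support, monomial a (Polynomial.divX (coeff a F)), ?_, ?_⟩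
  · ext1 e
    rw [coeff_add, coeff_C_mul, hc, coeff_map, coeff_map, Polynomial.coe_evalRingHom,
      ← Polynomial.coeff_zero_eq_eval_zero, add_comm, Polynomial.X_mul_divX_add]
  · ext1 e
    rw [coeff_map, coeff_map, hc, coeff_paramDeriv, Polynomial.coe_evalRingHom,
      ← Polynomial.coeff_zero_eq_eval_zero, ← Polynomial.coeff_zero_eq_eval_zero,
      Polynomial.coeff_divX, Polynomial.coeff_derivative]
    simp

theorem MvPolynomial.IsHomogeneous.paramDeriv {σ : Type*} {d : ℕ}
    {F : MvPolynomial σ (Polynomial ℂ)} (h : F.IsHomogeneous d) :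
    (_root_.paramDeriv F).IsHomogeneous d := by
  intro e he
  rw [coeff_paramDeriv] at he
  exact h fun h0 => he (by rw [h0, Polynomial.derivative_zero])

section
variable {ι : Type*} [Fintype ι] [DecidableEq ι] {e : ℕ} {k : ι → ℕ} {B B₁ : Finset ι}

theorem eventually_good_of_X_mul {x b : ι → ℂ} {y : ι → Polynomial ℂ}
    {F : MvPolynomial (Fin 3) (Polynomial ℂ)} (hF : F.IsHomogeneous (e + 1))
    (hfat : ∀ i, FatAt (k i) (Polynomial.C (x i)) (y i) F) {G : MvPolynomial (Fin 3) ℂ}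
    (hG : Good e (res B₁ k) B₁ x b G) (hy : ∀ i, (y i).eval 0 = b i)
    (h0 : map (Polynomial.evalRingHom 0) F = X 1 * G) (hB : ∀ i ∈ B, y i = 0)
    (hB' : ∀ i ∉ B, y i ≠ 0) (hdim : ∀ᶠ t in 𝓝[≠] (0 : ℂ), (Module.finrank ℂ
      (sys (e + 1) x (fun i => (y i).eval t) (fats k)) : ℤ) ≤ chi (e + 1) k)
    (hdeg : ∑ i ∈ B₁, res B₁ k i + 1 ≤ e) {φ : Polynomial ℂ}
    (hφ : tr 0 (map (Polynomial.evalRingHom 0) (paramDeriv F)) = φ) (hφd : φ.natDegree = e + 1)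
    (hroot : ∀ z, (tr 0 G).eval z = 0 → φ.eval z = 0 → ∃ i ∈ B₁, 1 ≤ k i ∧ z = x i)
    (hord : ∀ i ∈ B, ¬ (Polynomial.X - Polynomial.C (x i)) ^ (k i + 1) ∣ φ) :
    ∀ᶠ t in 𝓝[≠] (0 : ℂ), Good (e + 1) k B x (fun i => (y i).eval t)
      (map (Polynomial.evalRingHom t) F) := by
  have hy' : (fun i => (y i).eval 0) = b := funext hy
  have hφ0 : φ ≠ 0 := by rintro rfl; simp at hφd
  obtain ⟨F₂, hF₂, hF₂'⟩ := exists_param_split F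
  rw [← hF₂'] at hφ
  have htr : tr 0 F = Polynomial.C Polynomial.X * tr 0 F₂ := by
    conv_lhs => rw [hF₂, h0, map_mul, map_X, map_add, tr_X_mul, map_mul]
    rw [Polynomial.C_0, zero_mul, zero_add]
    congr 1
    simp [tr, restrictLine]
  have hmap : (tr 0 F₂).map (Polynomial.evalRingHom 0) = φ := by rw [map_tr, map_zero, hφ]
  refine (eventually_good (d := e + 1) (k := k) (B := B) (x := fun i => Polynomial.C (x i))
    (y := y) (F := F) hF hfat hB hB' ?_ ?_ ?_ ?_ ?_).mono
    fun t ht => by simp only [Polynomial.eval_C] at ht; exact ht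
  · intro i j hij
    exact hG.inj (Polynomial.C_injective hij)
  · filter_upwards [hdim] with t ht
    rw [show (fun i => (Polynomial.C (x i)).eval t) = x from funext fun i => Polynomial.eval_C]
    exact ht
  · refine eventually_nice_of_mul_X (ι := ι) (B := B₁) (k := k) (k' := res B₁ k) (e := e)
      (x := fun i => Polynomial.C (x i)) (y := y) (F := F) (G := G) (fun i hi => res_on hi)
      (fun i hi => res_off hi) hF hfat hG.hom h0 ?_ ?_ ?_ ?_ hG.trace hdeg ?_
    · simpa only [Polynomial.eval_C, hy] using hG.fat
    · simpa only [Polynomial.eval_C, hy] using hG.nice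
    · simpa only [hy] using hG.on_iff
    · simpa only [Polynomial.eval_C] using hG.order
    · intro Q hQ hQ1 hQG hQF
      rw [← hF₂'] at hQF
      have hh : (map (Polynomial.evalRingHom 0) F₂).IsHomogeneous (e + 1) :=
        hF₂' ▸ hF.paramDeriv.map _
      have hQ2 : Q 2 ≠ 0 := by
        intro hQ2
        have hQ' : Q = Q 0 • ![1, 0, 0] := by
          ext j; fin_cases j <;> simp [hQ1, hQ2]
        have hQ0 : Q 0 ≠ 0 := by
          intro h; apply hQ; rw [hQ', h, zero_smul]
        rw [hQ', hh.eval_smul, ← (natDegree_restrictLine_le ![0, 0, 1] ![1, 0, 0] hh).2] at hQF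
        change _ * (tr 0 _).coeff _ = 0 at hQF
        rw [hφ, ← hφd] at hQF
        rcases mul_eq_zero.1 hQF with h | h
        · exact hQ0 (pow_eq_zero_iff (by omega) |>.1 h)
        · exact hφ0 (Polynomial.leadingCoeff_eq_zero.1 h)
      have hQ' : Q = Q 2 • ![Q 0 / Q 2, 0, 1] := by
        ext j; fin_cases j <;> simp [hQ1, mul_div_cancel₀, hQ2]
      rw [hQ', hh.eval_smul, ← eval_tr, hφ] at hQF
      rw [hQ', hG.hom.eval_smul, ← eval_tr] at hQG
      obtain ⟨i, hi, hi1, hz⟩ := hroot _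
        ((mul_eq_zero.1 hQG).resolve_left (pow_ne_zero _ hQ2))
        ((mul_eq_zero.1 hQF).resolve_left (pow_ne_zero _ hQ2))
      refine ⟨i, hi, hi1, Q 2, ?_⟩
      rw [Polynomial.eval_C, ← hz]
      exact hQ'
  · intro i hi hz
    apply hord i hi
    have h1 : (Polynomial.X - Polynomial.C (Polynomial.C (x i))) ^ (k i + 1) ∣ tr 0 F := by
      rw [X_sub_C_pow_dvd_tr_iff]
      intro a ha
      rcases Nat.lt_succ_iff_lt_or_eq.1 ha with ha | rfl
      · have := hfat i (Finsupp.single 0 a) (by simpa using ha)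
        rwa [hB i hi] at this
      · exact hz
    have h2 : (Polynomial.X - Polynomial.C (Polynomial.C (x i))) ^ (k i + 1) ∣ tr 0 F₂ := by
      rw [htr] at h1
      rw [Polynomial.X_sub_C_pow_dvd_iff, Polynomial.X_pow_dvd_iff] at h1 ⊢
      intro a ha
      have := h1 a ha
      rw [Polynomial.mul_comp, Polynomial.C_comp, Polynomial.coeff_C_mul] at this
      exact (mul_eq_zero.1 this).resolve_left Polynomial.X_ne_zero
    have h3 := Polynomial.map_dvd (Polynomial.evalRingHom 0) h2
    rw [hmap] at h3
    simpa using h3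
  · rw [htr]
    refine mul_ne_zero (by simp [Polynomial.X_ne_zero]) fun h => hφ0 ?_
    rw [← hmap, h, Polynomial.map_zero]

end

theorem finrank_map_add_finrank_inf_ker {K V W : Type*} [Field K] [AddCommGroup V] [Module K V]
    [AddCommGroup W] [Module K W] (S : Submodule K V) [FiniteDimensional K S] (T : V →ₗ[K] W) :
    Module.finrank K (S.map T) + Module.finrank K (S ⊓ LinearMap.ker T : Submodule K V) =
      Module.finrank K S := by
  rw [← LinearMap.finrank_range_add_finrank_ker (T.domRestrict S), LinearMap.range_domRestrict,
    LinearMap.ker_domRestrict]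
  congr 1
  rw [← Submodule.finrank_map_subtype_eq, Submodule.map_comap_subtype]

section
variable {ι : Type*} [DecidableEq ι] {e : ℕ} {k : ι → ℕ} {B : Finset ι}

theorem X_mul_mem_sys_iff {R : Type*} [CommRing R] [IsDomain R] {x y : ι → R}
    (hB : ∀ i, y i = 0 ↔ i ∈ B) {G : MvPolynomial (Fin 3) R} (hG : G.IsHomogeneous e) :
    X 1 * G ∈ sys (e + 1) x y (fats k) ↔ G ∈ sys e x y (fats (res B k)) := by
  rw [mem_sys_fats, mem_sys_fats]
  have h1 : (X 1 * G).IsHomogeneous (e + 1) := by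
    rw [add_comm]
    exact (isHomogeneous_X _ _).mul hG
  simp only [h1, hG, true_and]
  refine forall_congr' fun i => ?_
  by_cases hi : i ∈ B
  · rw [res_on hi, (hB i).2 hi, fatAt_X_mul_iff]
  · rw [res_off hi]
    exact ⟨fatAt_of_X_mul fun h => hi ((hB i).1 h), fatAt_X_mul_of_fatAt⟩

theorem sys_inf_ker_tr {x y : ι → ℂ} (hB : ∀ i, y i = 0 ↔ i ∈ B) :
    sys (e + 1) x y (fats k) ⊓ LinearMap.ker (tr (0 : ℂ)).toLinearMap =
      (sys e x y (fats (res B k))).map (LinearMap.mulLeft ℂ (X 1)) := by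
  refine le_antisymm (fun F hF => ?_) (fun F hF => ?_)
  · obtain ⟨hF, hF0⟩ := Submodule.mem_inf.1 hF
    obtain ⟨G, hG, rfl⟩ := exists_eq_X_mul (sys_le _ _ _ _ hF) hF0
    exact Submodule.mem_map.2 ⟨G, (X_mul_mem_sys_iff hB hG).1 hF, LinearMap.mulLeft_apply _ _ _⟩
  · obtain ⟨G, hG, rfl⟩ := Submodule.mem_map.1 hF
    rw [LinearMap.mulLeft_apply, Submodule.mem_inf, LinearMap.mem_ker]
    refine ⟨(X_mul_mem_sys_iff hB (sys_le _ _ _ _ hG)).2 hG, ?_⟩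
    rw [AlgHom.toLinearMap_apply, tr_X_mul, Polynomial.C_0, zero_mul]

theorem mulLeft_X_injective {σ : Type*} (i : σ) : Function.Injective
    (LinearMap.mulLeft ℂ (X i : MvPolynomial σ ℂ)) := by
  intro a b h
  exact mul_left_cancel₀ (X_ne_zero i) h

theorem finrank_sys_succ {x y : ι → ℂ} (hB : ∀ i, y i = 0 ↔ i ∈ B) :
    Module.finrank ℂ ((sys (e + 1) x y (fats k)).map (tr (0 : ℂ)).toLinearMap) +
      Module.finrank ℂ (sys e x y (fats (res B k))) =
      Module.finrank ℂ (sys (e + 1) x y (fats k)) := by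
  have h := finrank_map_add_finrank_inf_ker (sys (e + 1) x y (fats k)) (tr (0 : ℂ)).toLinearMap
  rw [sys_inf_ker_tr hB] at h
  rw [← h]
  congr 1
  exact ((sys e x y (fats (res B k))).equivMapOfInjective _ (mulLeft_X_injective 1)).finrank_eq

/-- Multiples of `P` of the form `P * q` with `deg q < c`. -/
def multiples (P : Polynomial ℂ) (c : ℕ) : Submodule ℂ (Polynomial ℂ) :=
  (Polynomial.degreeLT ℂ c).map (LinearMap.mulLeft ℂ P)

theorem finrank_multiples {P : Polynomial ℂ} (hP : P ≠ 0) (c : ℕ) :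
    Module.finrank ℂ (multiples P c) = c := by
  have h1 : Function.Injective (LinearMap.mulLeft ℂ P) := fun a b h => mul_left_cancel₀ hP h
  rw [multiples, ← ((Polynomial.degreeLT ℂ c).equivMapOfInjective _ h1).finrank_eq,
    (Polynomial.degreeLTEquiv ℂ c).finrank_eq, Module.finrank_fin_fun]

instance (P : Polynomial ℂ) (c : ℕ) : FiniteDimensional ℂ (multiples P c) := by
  have : FiniteDimensional ℂ (Polynomial.degreeLT ℂ c) :=
    Module.Finite.equiv (Polynomial.degreeLTEquiv ℂ c).symm
  unfold multiples
  infer_instance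

theorem mem_multiples {P p : Polynomial ℂ} (hP : P ≠ 0) {c n : ℕ} (hc : P.natDegree + c = n + 1)
    (hp : p.natDegree ≤ n) (h : P ∣ p) : p ∈ multiples P c := by
  obtain ⟨q, rfl⟩ := h
  refine ⟨q, ?_, rfl⟩
  rw [SetLike.mem_coe, Polynomial.mem_degreeLT]
  by_cases hq : q = 0
  · subst hq; simp
  rw [Polynomial.natDegree_mul hP hq] at hp
  exact (Polynomial.natDegree_lt_iff_degree_lt hq).1 (by omega)

end

section
variable {ι : Type*} {e : ℕ} {k : ι → ℕ} {B : Finset ι}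

/-- The product of `(X - x i) ^ k i` over `i ∈ B`. -/
def pointsPoly (B : Finset ι) (k : ι → ℕ) (x : ι → ℂ) : Polynomial ℂ :=
  ∏ i ∈ B, (Polynomial.X - Polynomial.C (x i)) ^ k i

theorem pointsPoly_monic (B : Finset ι) (k : ι → ℕ) (x : ι → ℂ) : (pointsPoly B k x).Monic :=
  Polynomial.monic_prod_of_monic _ _ fun _ _ => (Polynomial.monic_X_sub_C _).pow _

theorem natDegree_pointsPoly (B : Finset ι) (k : ι → ℕ) (x : ι → ℂ) :
    (pointsPoly B k x).natDegree = ∑ i ∈ B, k i := by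
  rw [pointsPoly, Polynomial.natDegree_prod_of_monic _ _ fun _ _ => (Polynomial.monic_X_sub_C _).pow
      _]
  simp

theorem pointsPoly_dvd {x : ι → ℂ} (hx : Function.Injective x) {p : Polynomial ℂ}
    (h : ∀ i ∈ B, (Polynomial.X - Polynomial.C (x i)) ^ k i ∣ p) : pointsPoly B k x ∣ p :=
  Finset.prod_dvd_of_coprime
    (fun _ _ _ _ hij => (Polynomial.pairwise_coprime_X_sub_C hx hij).pow) h

theorem eval_pointsPoly_eq_zero {x : ι → ℂ} {z : ℂ} (h : (pointsPoly B k x).eval z = 0) :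
    ∃ i ∈ B, 1 ≤ k i ∧ z = x i := by
  rw [pointsPoly, Polynomial.eval_prod, Finset.prod_eq_zero_iff] at h
  obtain ⟨i, hi, h⟩ := h
  rw [Polynomial.eval_pow, Polynomial.eval_sub, Polynomial.eval_X, Polynomial.eval_C] at h
  exact ⟨i, hi, Nat.one_le_iff_ne_zero.2 fun h0 => by simp [h0] at h,
    sub_eq_zero.1 (eq_zero_of_pow_eq_zero h)⟩

end

section
variable {ι : Type*} [DecidableEq ι] {e : ℕ} {k : ι → ℕ} {B : Finset ι}

theorem pow_succ_not_dvd_pointsPoly_mul {x : ι → ℂ} (hx : Function.Injective x) {i : ι} (hi : i ∈ B)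
    {q : Polynomial ℂ} (hq : q.eval (x i) ≠ 0) :
    ¬ (Polynomial.X - Polynomial.C (x i)) ^ (k i + 1) ∣ pointsPoly B k x * q := by
  rw [pointsPoly, ← Finset.mul_prod_erase _ _ hi, pow_succ, mul_assoc]
  intro h
  have h1 := (mul_dvd_mul_iff_left (pow_ne_zero _ (Polynomial.X_sub_C_ne_zero _))).1 h
  rw [Polynomial.dvd_iff_isRoot, Polynomial.IsRoot, Polynomial.eval_mul] at h1
  have h2 := (mul_eq_zero.1 h1).resolve_right hq
  obtain ⟨j, hj, -, hij⟩ := eval_pointsPoly_eq_zero (B := B.erase i) h2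
  exact Finset.ne_of_mem_erase hj (hx hij).symm

theorem dvd_tr_of_fatAt {k : ℕ} {x : ℂ} {F : MvPolynomial (Fin 3) ℂ} (h : FatAt k x 0 F) :
    (Polynomial.X - Polynomial.C x) ^ k ∣ tr 0 F := by
  rw [X_sub_C_pow_dvd_tr_iff]
  exact fun a ha => h _ (by simpa using ha)

theorem exists_mem_sys_tr_eq [Fintype ι] {x y : ι → ℂ} (hB : ∀ i, y i = 0 ↔ i ∈ B)
    (hx : Function.Injective x) (hk : ∑ i ∈ B, k i ≤ e + 2)
    (hdim : (Module.finrank ℂ (sys e x y (fats (res B k))) : ℤ) = chi e (res B k)) :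
    (Module.finrank ℂ (sys (e + 1) x y (fats k)) : ℤ) = chi (e + 1) k ∧
      ∀ p : Polynomial ℂ, p.natDegree ≤ e + 1 → pointsPoly B k x ∣ p →
        ∃ F ∈ sys (e + 1) x y (fats k), tr 0 F = p := by
  obtain ⟨c, hc⟩ := Nat.exists_eq_add_of_le hk
  have hP := (pointsPoly_monic B k x).ne_zero
  have hc' : (pointsPoly B k x).natDegree + c = (e + 1) + 1 := by rw [natDegree_pointsPoly]; omega
  have hle : (sys (e + 1) x y (fats k)).map (tr (0 : ℂ)).toLinearMap ≤
      multiples (pointsPoly B k x) c := by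
    rintro _ ⟨F, hF, rfl⟩
    have hF' := mem_sys_fats.1 hF
    refine mem_multiples hP hc' (natDegree_restrictLine_le _ _ hF'.1).1
      (pointsPoly_dvd hx fun i hi => dvd_tr_of_fatAt ?_)
    have := hF'.2 i
    rwa [(hB i).2 hi] at this
  have h1 := Submodule.finrank_mono hle
  have h2 := finrank_sys_succ (e := e) (k := k) (x := x) hB
  have h3 := chi_le_finrank (e + 1) k x y
  have h4 := chi_succ e B k
  rw [finrank_multiples hP] at h1
  have h5 : (∑ i ∈ B, (k i : ℤ)) + c = e + 2 := by exact_mod_cast hc.symm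
  have h6 : Module.finrank ℂ ((sys (e + 1) x y (fats k)).map (tr (0 : ℂ)).toLinearMap) = c := by
    zify at h1 h2 ⊢
    linarith
  refine ⟨by zify at h2 h6; linarith, fun p hp hdvd => ?_⟩
  have h7 := Submodule.eq_of_le_of_finrank_eq hle (by rw [h6, finrank_multiples hP])
  have h8 := mem_multiples hP hc' hp hdvd
  rw [← h7] at h8
  exact h8

theorem Good.underfill [Fintype ι] {x y : ι → ℂ} {G : MvPolynomial (Fin 3) ℂ}
    (hG : Good e (res B k) B x y G) (hk : ∑ i ∈ B, k i ≤ e + 1)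
    (hdeg : ∑ i ∈ B, res B k i + 1 ≤ e) : ∃ F, Good (e + 1) k B x y F := by
  obtain ⟨hdim, hsurj⟩ := exists_mem_sys_tr_eq hG.on_iff hG.inj (by omega) hG.dim
  obtain ⟨c, hc⟩ := Nat.exists_eq_add_of_le hk
  obtain ⟨ξ, hξ⟩ : ∃ ξ, ξ ∉ (tr 0 G).roots.toFinset ∪ B.image x :=
    Infinite.exists_notMem_finset _
  rw [Finset.mem_union, not_or, Multiset.mem_toFinset, Polynomial.mem_roots hG.trace] at hξ
  have hq : ((Polynomial.X - Polynomial.C ξ) ^ c).Monic := (Polynomial.monic_X_sub_C _).pow _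
  set φ := pointsPoly B k x * (Polynomial.X - Polynomial.C ξ) ^ c with hφ
  have hφd : φ.natDegree = e + 1 := by
    rw [hφ, (pointsPoly_monic B k x).natDegree_mul hq, natDegree_pointsPoly]
    simp [hc]
  obtain ⟨F₁, hF₁, htr⟩ := hsurj φ hφd.le (dvd_mul_right _ _)
  set F : MvPolynomial (Fin 3) (Polynomial ℂ) :=
    map Polynomial.C (X 1 * G) + C Polynomial.X * map Polynomial.C F₁ with hFdef
  have hid : (Polynomial.evalRingHom (0 : ℂ)).comp Polynomial.C = RingHom.id ℂ := by
    ext; simp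
  have hF : F ∈ sys (e + 1) (fun i => Polynomial.C (x i)) (fun i => Polynomial.C (y i)) (fats k) :=
      by
    refine Submodule.add_mem _ (map_mem_sys _ ?_) ?_
    · exact (X_mul_mem_sys_iff hG.on_iff hG.hom).2 (mem_sys_fats.2 ⟨hG.hom, hG.fat⟩)
    · rw [C_mul']
      exact Submodule.smul_mem _ _ (map_mem_sys _ hF₁)
  rw [mem_sys_fats] at hF
  have h := eventually_good_of_X_mul (B := B) (φ := φ) hF.1 hF.2 hG (fun i => Polynomial.eval_C) ?_
      ?_
    ?_ ?_ hdeg ?_ hφd ?_ ?_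
  · obtain ⟨t, ht⟩ := h.exists
    refine ⟨map (Polynomial.evalRingHom t) F, ?_⟩
    simp only [Polynomial.eval_C] at ht
    exact ht
  · rw [hFdef, map_add, MvPolynomial.map_map, hid, MvPolynomial.map_id, map_mul, map_C]
    simp
  · intro i hi
    rw [(hG.on_iff i).2 hi, Polynomial.C_0]
  · intro i hi h0
    exact hi ((hG.on_iff i).1 (by simpa using h0))
  · refine Eventually.of_forall fun t => ?_
    rw [show (fun i => (Polynomial.C (y i)).eval t) = y from funext fun i => Polynomial.eval_C]
    exact hdim.le
  · rw [← htr]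
    congr 1
    ext1 a
    rw [coeff_map, coeff_paramDeriv, hFdef, coeff_add, coeff_C_mul, coeff_map, coeff_map]
    simp
  · intro z hz hz'
    rw [hφ, Polynomial.eval_mul] at hz'
    rcases mul_eq_zero.1 hz' with h | h
    · exact eval_pointsPoly_eq_zero h
    · rw [Polynomial.eval_pow, Polynomial.eval_sub, Polynomial.eval_X, Polynomial.eval_C] at h
      have := sub_eq_zero.1 (eq_zero_of_pow_eq_zero h)
      exact absurd (this ▸ hz) hξ.1
  · intro i hi
    refine pow_succ_not_dvd_pointsPoly_mul hG.inj hi ?_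
    rw [Polynomial.eval_pow, Polynomial.eval_sub, Polynomial.eval_X, Polynomial.eval_C]
    exact pow_ne_zero _ (sub_ne_zero.2 fun h => hξ.2 (Finset.mem_image.2 ⟨i, hi, h⟩))

end

theorem evalRingHom_zero_comp_C :
    (Polynomial.evalRingHom (0 : ℂ)).comp Polynomial.C = RingHom.id ℂ := by
  ext; simp

/-- First-order expansion at a moving point `(x, t * w)` of a family specializing to `Y * G`. -/
theorem coeff_paramDeriv_of_X_mul {x : ℂ} {w : Polynomial ℂ}
    {F : MvPolynomial (Fin 3) (Polynomial ℂ)} {G : MvPolynomial (Fin 3) ℂ}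
    (h0 : map (Polynomial.evalRingHom 0) F = X 1 * G) {a : ℕ}
    (ha : coeff (Finsupp.single 0 a) (loc (Polynomial.C x) (Polynomial.X * w) F) = 0) :
    w.eval 0 * coeff (Finsupp.single 0 a) (loc x 0 G) +
      coeff (Finsupp.single 0 a) (loc x 0 (map (Polynomial.evalRingHom 0) (paramDeriv F))) = 0 := by
  obtain ⟨F₂, hF, hF₂⟩ := exists_param_split F
  have hev (H : MvPolynomial (Fin 3) (Polynomial ℂ)) :
      (coeff (Finsupp.single 0 a) (loc (Polynomial.C x) (Polynomial.X * w) H)).eval 0 =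
        coeff (Finsupp.single 0 a) (loc x 0 (map (Polynomial.evalRingHom 0) H)) := by
    rw [← Polynomial.coe_evalRingHom, ← coeff_map, map_loc]
    simp
  rw [hF, h0, map_mul, map_X, map_add, loc_X_mul, ← add_mul, C_mul', map_smul, coeff_add,
    coeff_X_one_add_C_mul, if_pos (by simp), zero_add, coeff_smul, smul_eq_mul, mul_assoc,
    ← mul_add] at ha
  have h1 := congrArg (Polynomial.eval 0) ((mul_eq_zero.1 ha).resolve_left Polynomial.X_ne_zero)
  rw [Polynomial.eval_add, Polynomial.eval_mul, hev, hev, MvPolynomial.map_map,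
    evalRingHom_zero_comp_C, MvPolynomial.map_id, hF₂, Polynomial.eval_zero] at h1
  exact h1

theorem exists_eq_C_mul_of_dvd {P p : Polynomial ℂ} (hP : P.Monic)
    (hp : p.natDegree ≤ P.natDegree) (h : P ∣ p) : ∃ c, p = Polynomial.C c * P := by
  obtain ⟨q, rfl⟩ := h
  by_cases hq : q = 0
  · exact ⟨0, by simp [hq]⟩
  rw [hP.natDegree_mul' hq] at hp
  exact ⟨q.coeff 0, by rw [mul_comm, ← Polynomial.eq_C_of_natDegree_eq_zero (by omega)]⟩

/-- The submodule of elements mapped by `T` into the line spanned by `u`. -/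
theorem finrank_inf_comap_span {K V W : Type*} [Field K] [AddCommGroup V] [Module K V]
    [AddCommGroup W] [Module K W] (R : Submodule K V) [FiniteDimensional K R]
    (T : V →ₗ[K] W) (hT : R.map T = ⊤) {u : W} (hu : u ≠ 0) :
    Module.finrank K (R ⊓ (K ∙ u).comap T : Submodule K V) + Module.finrank K W =
      Module.finrank K R + 1 := by
  have h1 := finrank_map_add_finrank_inf_ker R T
  have : FiniteDimensional K (R ⊓ (K ∙ u).comap T : Submodule K V) :=
    Submodule.finiteDimensional_of_le inf_le_left
  have h2 := finrank_map_add_finrank_inf_ker (R ⊓ (K ∙ u).comap T) T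
  have h3 : (R ⊓ (K ∙ u).comap T) ⊓ LinearMap.ker T = R ⊓ LinearMap.ker T := by
    have h : LinearMap.ker T ≤ (K ∙ u).comap T := fun v hv => by
      rw [LinearMap.mem_ker] at hv
      rw [Submodule.mem_comap, hv]
      exact zero_mem _
    rw [inf_assoc, inf_eq_right.2 h]
  have h4 : (R ⊓ (K ∙ u).comap T).map T = K ∙ u := by
    refine le_antisymm ?_ fun w hw => ?_
    · rintro _ ⟨v, hv, rfl⟩
      exact hv.2
    · obtain ⟨v, hv, rfl⟩ : w ∈ R.map T := hT ▸ Submodule.mem_top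
      exact ⟨v, ⟨hv, hw⟩, rfl⟩
  rw [h3, h4, finrank_span_singleton hu] at h2
  rw [hT, finrank_top] at h1
  omega

section
variable {ι : Type*} {e : ℕ} {k : ι → ℕ} {B : Finset ι}

/-- The coefficients of order `n i` along the line `Y = 0` at the points of `E`. -/
def traceCoeffs (x : ι → ℂ) (n : ι → ℕ) (E : Finset ι) :
    MvPolynomial (Fin 3) ℂ →ₗ[ℂ] (E → ℂ) :=
  LinearMap.pi fun i => lcoeff ℂ (Finsupp.single 0 (n i)) ∘ₗ (loc (x i) 0).toLinearMap

theorem traceCoeffs_apply (x : ι → ℂ) (n : ι → ℕ) (E : Finset ι) (F : MvPolynomial (Fin 3) ℂ)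
    (i : E) : traceCoeffs x n E F i = coeff (Finsupp.single 0 (n i)) (loc (x i) 0 F) := rfl

theorem tr_eq_zero_of_fatAt {x : ι → ℂ} (hx : Function.Injective x) {F : MvPolynomial (Fin 3) ℂ}
    (hF : F.IsHomogeneous e) (hfat : ∀ i ∈ B, ∀ a < k i, coeff (Finsupp.single 0 a) (loc (x i) 0 F)
        = 0)
    (hk : e < ∑ i ∈ B, k i) : tr 0 F = 0 := by
  by_contra h
  have h1 := Polynomial.natDegree_le_of_dvd (pointsPoly_dvd (B := B) (k := k) hx fun i hi =>
    (X_sub_C_pow_dvd_tr_iff _ _ _ _).2 (hfat i hi)) h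
  rw [natDegree_pointsPoly] at h1
  have := (natDegree_restrictLine_le ![0, 0, 1] ![1, 0, 0] hF).1
  rw [tr] at h1
  omega

end

section
variable {ι : Type*} [DecidableEq ι] {e : ℕ} {k : ι → ℕ} {B B₁ : Finset ι}

theorem coeff_pointsPoly_comp_ne_zero {x : ι → ℂ} (hx : Function.Injective x) {i : ι} (hi : i ∈ B) :
    ((pointsPoly B k x).comp (Polynomial.X + Polynomial.C (x i))).coeff (k i) ≠ 0 := by
  intro h
  have h1 : (Polynomial.X - Polynomial.C (x i)) ^ k i ∣ pointsPoly B k x :=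
    Finset.dvd_prod_of_mem _ hi
  have h2 := pow_succ_not_dvd_pointsPoly_mul hx hi (k := k) (q := 1) (by simp)
  rw [mul_one, Polynomial.X_sub_C_pow_dvd_iff, Polynomial.X_pow_dvd_iff] at h2
  rw [Polynomial.X_sub_C_pow_dvd_iff, Polynomial.X_pow_dvd_iff] at h1
  refine h2 fun a ha => ?_
  rcases Nat.lt_succ_iff_lt_or_eq.1 ha with h3 | rfl
  · exact h1 a h3
  · exact h

theorem sum_res_of_subset {E : Finset ι} (hE : E ⊆ B) (hk : ∀ i ∈ E, 1 ≤ k i) :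
    ∑ i ∈ B, res E k i + E.card = ∑ i ∈ B, k i := by
  rw [Finset.card_eq_sum_ones, ← Finset.sum_sdiff hE, ← Finset.sum_sdiff hE (f := k), add_assoc,
    ← Finset.sum_add_distrib]
  congr 1
  · exact Finset.sum_congr rfl fun i hi => res_off (Finset.mem_sdiff.1 hi).2
  · refine Finset.sum_congr rfl fun i hi => ?_
    rw [res_on hi]
    have := hk i hi
    omega

theorem overshoot_limit {x b : ι → ℂ} (hx : Function.Injective x) (hb : ∀ i, b i = 0 ↔ i ∈ B₁)
    {E : Finset ι} (hE : E ⊆ B₁) (hk : ∀ i ∈ E, 1 ≤ k i)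
    (hsum : ∑ i ∈ B₁, k i = e + 1 + E.card) (hE1 : E.Nonempty) {u : E → ℂ} (hu : ∀ i, u i ≠ 0)
    {y w : ι → Polynomial ℂ} (hy : ∀ i ∈ B₁, y i = Polynomial.X * w i)
    (hy' : ∀ i, (y i).eval 0 = b i) (hw : ∀ i ∈ B₁, i ∉ E → (w i).eval 0 = 0)
    (hwE : ∀ i : E, (w i).eval 0 = -((pointsPoly B₁ (res E k) x).comp
      (Polynomial.X + Polynomial.C (x i))).coeff (res B₁ k i) / u i)
    {F : MvPolynomial (Fin 3) (Polynomial ℂ)}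
    (hF : F ∈ sys (e + 1) (fun i => Polynomial.C (x i)) y (fats k)) :
    ∃ G ∈ sys e x b (fats (res B₁ k)), ∃ c : ℂ, map (Polynomial.evalRingHom 0) F = X 1 * G ∧
      tr 0 (map (Polynomial.evalRingHom 0) (paramDeriv F)) =
        Polynomial.C c * pointsPoly B₁ (res E k) x ∧
      traceCoeffs x (res B₁ k) E G = c • u := by
  have hF0 := map_mem_sys (Polynomial.evalRingHom 0) hF
  simp only [Polynomial.coe_evalRingHom, Polynomial.eval_C, hy'] at hF0
  have hF0' := mem_sys_fats.1 hF0
  have hcard := hE1.card_pos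
  have htr : tr 0 (map (Polynomial.evalRingHom 0) F) = 0 :=
    tr_eq_zero_of_fatAt hx hF0'.1 (B := B₁) (k := k) (fun i hi a ha => by
      have := hF0'.2 i (Finsupp.single 0 a) (by simpa using ha)
      rwa [(hb i).2 hi] at this) (by omega)
  obtain ⟨G, hG, hFG⟩ := exists_eq_X_mul hF0'.1 htr
  rw [hFG] at hF0
  have hGR := (X_mul_mem_sys_iff hb hG).1 hF0
  have hkey : ∀ i ∈ B₁, ∀ a < k i, (w i).eval 0 * coeff (Finsupp.single 0 a) (loc (x i) 0 G) +
      coeff (Finsupp.single 0 a) (loc (x i) 0 (map (Polynomial.evalRingHom 0) (paramDeriv F))) =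
          0 := by
    intro i hi a ha
    refine coeff_paramDeriv_of_X_mul hFG ?_
    rw [← hy i hi]
    exact (mem_sys_fats.1 hF).2 i _ (by simpa using ha)
  have hEres : ∀ i ∈ E, res E k i = res B₁ k i := fun i hi => by rw [res_on hi, res_on (hE hi)]
  obtain ⟨c, hc⟩ := exists_eq_C_mul_of_dvd (pointsPoly_monic B₁ (res E k) x)
    (p := tr 0 (map (Polynomial.evalRingHom 0) (paramDeriv F))) (by
      have := sum_res_of_subset hE hk
      rw [natDegree_pointsPoly, show ∑ i ∈ B₁, res E k i = e + 1 by omega]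
      exact (natDegree_restrictLine_le _ _ ((mem_sys_fats.1 hF).1.paramDeriv.map _)).1) (by
      refine pointsPoly_dvd hx fun i hi => (X_sub_C_pow_dvd_tr_iff _ _ _ _).2 fun a ha => ?_
      have h1 := hkey i hi a (ha.trans_le (res_le i))
      by_cases hiE : i ∈ E
      · have h2 : coeff (Finsupp.single 0 a) (loc (x i) 0 G) = 0 := by
          have := (mem_sys_fats.1 hGR).2 i (Finsupp.single 0 a) (by
            rw [← hEres i hiE]; simpa using ha)
          rwa [(hb i).2 hi] at this
        rwa [h2, mul_zero, zero_add] at h1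
      · rwa [hw i hi hiE, zero_mul, zero_add] at h1)
  refine ⟨G, hGR, c, hFG, hc, ?_⟩
  funext i
  have h1 := hkey i (hE i.2) (res B₁ k i) (by
    rw [res_on (hE i.2)]; have := hk i i.2; omega)
  rw [hwE, coeff_loc_single _ _ (map _ (paramDeriv F)), hc, Polynomial.mul_comp, Polynomial.C_comp,
    Polynomial.coeff_C_mul] at h1
  rw [traceCoeffs_apply, Pi.smul_apply, smul_eq_mul]
  have h2 : ((pointsPoly B₁ (res E k) x).comp
      (Polynomial.X + Polynomial.C (x i))).coeff (res B₁ k i) ≠ 0 := by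
    rw [← hEres i i.2]
    exact coeff_pointsPoly_comp_ne_zero hx (hE i.2)
  have h3 := hu i
  field_simp at h1
  refine mul_left_cancel₀ h2 ?_
  linear_combination -h1

end

section
variable {ι : Type*} [Fintype ι] [DecidableEq ι] {e : ℕ} {k : ι → ℕ} {B B₁ : Finset ι}

theorem Good.overshoot {x b : ι → ℂ} {G : MvPolynomial (Fin 3) ℂ}
    (hG : Good e (res B₁ k) B₁ x b G) (hBB : B ⊆ B₁) {E : Finset ι} (hE : E ⊆ B₁ \ B)
    (hE1 : E.Nonempty) (hk : ∀ i ∈ E, 1 ≤ k i) (hsum : ∑ i ∈ B₁, k i = e + 1 + E.card)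
    (hγ : (sys e x b (fats (res B₁ k))).map (traceCoeffs x (res B₁ k) E) = ⊤)
    (hdeg : ∑ i ∈ B₁, res B₁ k i + 1 ≤ e) : ∃ y F, Good (e + 1) k B x y F := by
  have hEB : E ⊆ B₁ := hE.trans Finset.sdiff_subset
  have hEB' : ∀ i ∈ E, i ∉ B := fun i hi => (Finset.mem_sdiff.1 (hE hi)).2
  set u := traceCoeffs x (res B₁ k) E G with hu_def
  have hu : ∀ i, u i ≠ 0 := fun i => hG.order i (hEB i.2)
  have hu0 : u ≠ 0 := fun h => hu ⟨_, hE1.choose_spec⟩ (congrFun h _)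
  set w : ι → Polynomial ℂ := fun i => if hi : i ∈ E then
    Polynomial.C (-((pointsPoly B₁ (res E k) x).comp
      (Polynomial.X + Polynomial.C (x i))).coeff (res B₁ k i) / u ⟨i, hi⟩)
    else if i ∈ B then 0 else Polynomial.X with hw_def
  set y : ι → Polynomial ℂ := fun i => if i ∈ B₁ then Polynomial.X * w i else Polynomial.C (b i)
    with hy_def
  have hw1 : ∀ i ∉ B, w i ≠ 0 := by
    intro i hi
    by_cases hiE : i ∈ E
    · simp only [hw_def, dif_pos hiE]
      rw [Ne, Polynomial.C_eq_zero]
      refine div_ne_zero (neg_ne_zero.2 ?_) (hu _)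
      rw [show res B₁ k i = res E k i by rw [res_on hiE, res_on (hEB hiE)]]
      exact coeff_pointsPoly_comp_ne_zero hG.inj (hEB hiE)
    · simp only [hw_def, dif_neg hiE, if_neg hi]
      exact Polynomial.X_ne_zero
  have hy0 : ∀ i, (y i).eval 0 = b i := by
    intro i
    by_cases hi : i ∈ B₁
    · simp only [hy_def, if_pos hi]
      simp [(hG.on_iff i).2 hi]
    · simp only [hy_def, if_neg hi, Polynomial.eval_C]
  have hlim := fun (F : MvPolynomial (Fin 3) (Polynomial ℂ))
    (hF : F ∈ sys (e + 1) (fun i => Polynomial.C (x i)) y (fats k)) =>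
    overshoot_limit hG.inj hG.on_iff hEB hk hsum hE1 hu (fun i hi => if_pos hi) hy0
    (fun i hi hiE => by
      simp only [hw_def, dif_neg hiE]
      split_ifs <;> simp) (fun i => by simp only [hw_def, dif_pos i.2, Polynomial.eval_C]) hF
  have hR : FiniteDimensional ℂ (sys e x b (fats (res B₁ k))) := inferInstance
  set γ := traceCoeffs x (res B₁ k) E with hγ_def
  set S := (sys e x b (fats (res B₁ k)) ⊓ (ℂ ∙ u).comap γ).map (LinearMap.mulLeft ℂ (X 1)) with hS
  have hSdim : (Module.finrank ℂ S : ℤ) = chi (e + 1) k := by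
    have h1 := finrank_inf_comap_span _ _ hγ hu0
    rw [((sys e x b (fats (res B₁ k)) ⊓ (ℂ ∙ u).comap γ).equivMapOfInjective _
      (mulLeft_X_injective 1)).finrank_eq, Module.finrank_fintype_fun_eq_card,
      Fintype.card_coe] at h1
    have h2 := hG.dim
    have h3 := chi_succ e B₁ k
    have h4 : ∑ i ∈ B₁, (k i : ℤ) = e + 1 + E.card := by exact_mod_cast hsum
    zify at h1
    linarith
  obtain ⟨hle, hlift⟩ := sys_limit (d := e + 1) (x := fun i => Polynomial.C (x i)) (y := y)
    (N := fats k) (S := S) (by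
      intro F hF
      obtain ⟨H, hH, rfl⟩ := Submodule.mem_map.1 hF
      rw [LinearMap.mulLeft_apply, mem_homogeneousSubmodule, add_comm]
      exact (isHomogeneous_X _ _).mul (sys_le _ _ _ _ (Submodule.mem_inf.1 hH).1)) (by
      intro F hF
      obtain ⟨H, hH, c, h1, -, h2⟩ := hlim F hF
      rw [h1]
      refine Submodule.mem_map.2 ⟨H, Submodule.mem_inf.2 ⟨hH, ?_⟩, LinearMap.mulLeft_apply _ _ _⟩
      rw [Submodule.mem_comap, h2]
      exact Submodule.smul_mem _ _ (Submodule.mem_span_singleton_self _))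
  obtain ⟨F, hF, hF0⟩ := hlift (Eventually.frequently (Eventually.of_forall fun t => by
      zify
      rw [hSdim]
      exact chi_le_finrank _ _ _ _)) (X 1 * G) (Submodule.mem_map.2 ⟨G, Submodule.mem_inf.2
        ⟨mem_sys_fats.2 ⟨hG.hom, hG.fat⟩, Submodule.mem_span_singleton_self _⟩,
        LinearMap.mulLeft_apply _ _ _⟩)
  obtain ⟨G', -, c, h1, h2, h3⟩ := hlim F hF
  have hGG : G = G' := mul_left_cancel₀ (X_ne_zero 1) (hF0.symm.trans h1)
  rw [← hGG, ← hu_def] at h3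
  have hc : c = 1 := by
    have h4 := congrFun h3 ⟨_, hE1.choose_spec⟩
    rw [Pi.smul_apply, smul_eq_mul] at h4
    exact (mul_right_cancel₀ (hu _) ((one_mul _).trans h4)).symm
  rw [hc, Polynomial.C_1, one_mul] at h2
  have hF' := mem_sys_fats.1 hF
  have hfin := eventually_good_of_X_mul hF'.1 hF'.2 hG hy0 hF0 (B := B) (fun i hi => ?_)
    (fun i hi => ?_) ?_ hdeg h2 ?_ (fun z _ hz => ?_) (fun i hi => ?_)
  · obtain ⟨t, ht⟩ := hfin.exists
    exact ⟨_, _, ht⟩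
  · simp only [hy_def, if_pos (hBB hi), hw_def, dif_neg fun h => hEB' i h hi, if_pos hi, mul_zero]
  · by_cases hi1 : i ∈ B₁
    · simp only [hy_def, if_pos hi1]
      exact mul_ne_zero Polynomial.X_ne_zero (hw1 i hi)
    · simp only [hy_def, if_neg hi1]
      rw [Ne, Polynomial.C_eq_zero]
      exact fun h => hi1 ((hG.on_iff i).1 h)
  · filter_upwards [hle] with t ht
    rw [← hSdim]
    rw [show (fun i => (Polynomial.C (x i)).eval t) = x from
      funext fun i => Polynomial.eval_C] at ht
    exact_mod_cast ht
  · rw [natDegree_pointsPoly]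
    have := sum_res_of_subset hEB hk
    omega
  · obtain ⟨i, hi, h4, h5⟩ := eval_pointsPoly_eq_zero hz
    exact ⟨i, hi, h4.trans (res_le i), h5⟩
  · have h6 := pow_succ_not_dvd_pointsPoly_mul hG.inj (hBB hi) (k := res E k) (q := 1) (by simp)
    rwa [mul_one, res_off fun h => hEB' i h hi] at h6

end

theorem finrank_semicontinuous {ι : Type*} [Fintype ι] {d : ℕ} {x y : ι → Polynomial ℂ}
    {N : ι → Finset (Fin 2 →₀ ℕ)}
    {a b : ι → ℂ} (hx : ∀ i, (x i).eval 0 = a i) (hy : ∀ i, (y i).eval 0 = b i) :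
    ∀ᶠ t in 𝓝[≠] (0 : ℂ), Module.finrank ℂ
      (sys d (fun i => (x i).eval t) (fun i => (y i).eval t) N) ≤
        Module.finrank ℂ (sys d a b N) := by
  refine (sys_limit (sys_le d a b N) fun F hF => ?_).1
  have := map_mem_sys (Polynomial.evalRingHom 0) hF
  simp only [Polynomial.coe_evalRingHom] at this
  rwa [show (fun i => (x i).eval 0) = a from funext hx,
    show (fun i => (y i).eval 0) = b from funext hy] at this

section
variable {ι : Type*} [DecidableEq ι]

/-- Exponent sets of fat points, with one more condition along the line `Y = 0` on `T`. -/
def tang (k : ι → ℕ) (T : Finset ι) : ι → Finset (Fin 2 →₀ ℕ) := fun i =>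
  if i ∈ T then insert (Finsupp.single 0 (k i)) (fatSet (k i)) else fatSet (k i)

/-- Orders of vanishing along the line `Y = 0`. -/
def ord (k : ι → ℕ) (T : Finset ι) : ι → ℕ := fun i => if i ∈ T then k i + 1 else k i

variable {d : ℕ} {k : ι → ℕ} {B B₁ T E : Finset ι}

theorem mem_sys_tang {R : Type*} [CommRing R] {x y : ι → R} {F : MvPolynomial (Fin 3) R} :
    F ∈ sys d x y (tang k T) ↔ F ∈ sys d x y (fats k) ∧
      ∀ i ∈ T, coeff (Finsupp.single 0 (k i)) (loc (x i) (y i) F) = 0 := by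
  rw [mem_sys, mem_sys, and_assoc, and_congr_right_iff]
  intro _
  constructor
  · intro h
    refine ⟨fun i e he => h i e ?_, fun i hi => h i _ ?_⟩
    · rw [tang]; split_ifs
      · exact Finset.mem_insert_of_mem he
      · exact he
    · rw [tang, if_pos hi]; exact Finset.mem_insert_self _ _
  · rintro ⟨h1, h2⟩ i e he
    rw [tang] at he
    split_ifs at he with hi
    · rcases Finset.mem_insert.1 he with rfl | he
      · exact h2 i hi
      · exact h1 i e he
    · exact h1 i e he

theorem tang_empty : tang k ∅ = fats k := by
  funext i; simp [tang]

theorem coeff_eq_zero_of_mem_sys_tang {R : Type*} [CommRing R] {x y : ι → R}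
    {F : MvPolynomial (Fin 3) R} (h : F ∈ sys d x y (tang k T)) (i : ι) {a : ℕ}
    (ha : a < ord k T i) : coeff (Finsupp.single 0 a) (loc (x i) (y i) F) = 0 := by
  obtain ⟨h1, h2⟩ := mem_sys_tang.1 h
  by_cases hak : a < k i
  · exact (mem_sys_fats.1 h1).2 i _ (by simpa using hak)
  · rw [ord] at ha
    split_ifs at ha with hi
    · rw [show a = k i by omega]
      exact h2 i hi
    · exact absurd ha hak

theorem sum_ord (hT : T ⊆ B) : ∑ i ∈ B, ord k T i = ∑ i ∈ B, k i + T.card := by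
  have : ∀ i, ord k T i = k i + if i ∈ T then 1 else 0 := fun i => by
    rw [ord]; split_ifs <;> rfl
  simp only [this, Finset.sum_add_distrib]
  rw [Finset.sum_ite_mem, Finset.inter_eq_right.2 hT, Finset.card_eq_sum_ones]

theorem finrank_le_of_residual [Fintype ι] {x b : ι → ℂ} (hx : Function.Injective x)
    (hb : ∀ i, b i = 0 ↔ i ∈ B₁) (hT : T ⊆ B) (hB : B ⊆ B₁) (hE : E ⊆ B₁ \ B)
    (hk : ∀ i ∈ E, 1 ≤ k i) (hsum : d + 2 + E.card ≤ ∑ i ∈ B₁, k i + T.card) :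
    ∃ y : ι → ℂ, (∀ i, y i = 0 ↔ i ∈ B) ∧ Module.finrank ℂ (sys (d + 1) x y (tang k T)) ≤
      Module.finrank ℂ (sys d x b (tang (res B₁ k) E)) := by
  have hEB : E ⊆ B₁ := hE.trans Finset.sdiff_subset
  have hEB' : ∀ i ∈ E, i ∉ B := fun i hi => (Finset.mem_sdiff.1 (hE hi)).2
  set w : ι → Polynomial ℂ := fun i => if i ∈ E then 1 else if i ∈ B then 0 else Polynomial.X
    with hw_def
  set y : ι → Polynomial ℂ := fun i => if i ∈ B₁ then Polynomial.X * w i else Polynomial.C (b i)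
    with hy_def
  have hyB : ∀ i ∈ B, y i = 0 := fun i hi => by
    simp only [hy_def, hw_def, if_pos (hB hi), if_neg fun h => hEB' i h hi, if_pos hi, mul_zero]
  have hyB' : ∀ i ∉ B, y i ≠ 0 := fun i hi => by
    by_cases hi1 : i ∈ B₁
    · simp only [hy_def, hw_def, if_pos hi1, if_neg hi]
      refine mul_ne_zero Polynomial.X_ne_zero ?_
      split_ifs
      exacts [one_ne_zero, Polynomial.X_ne_zero]
    · simp only [hy_def, if_neg hi1]
      rw [Ne, Polynomial.C_eq_zero]
      exact fun h => hi1 ((hb i).1 h)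
  have hy0 : ∀ i, (y i).eval 0 = b i := by
    intro i
    by_cases hi : i ∈ B₁
    · simp only [hy_def, if_pos hi]
      simp [(hb i).2 hi]
    · simp only [hy_def, if_neg hi, Polynomial.eval_C]
  have hTB := hT.trans hB
  obtain ⟨hle, -⟩ := sys_limit (d := d + 1) (x := fun i => Polynomial.C (x i)) (y := y)
    (N := tang k T)
    (S := (sys d x b (tang (res B₁ k) E)).map (LinearMap.mulLeft ℂ (X 1))) (by
      intro F hF
      obtain ⟨H, hH, rfl⟩ := Submodule.mem_map.1 hF
      rw [LinearMap.mulLeft_apply, mem_homogeneousSubmodule, add_comm]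
      exact (isHomogeneous_X _ _).mul (sys_le _ _ _ _ hH)) (by
    intro F hF
    have hF0 := map_mem_sys (Polynomial.evalRingHom 0) hF
    simp only [Polynomial.coe_evalRingHom, Polynomial.eval_C, hy0] at hF0
    have hFh := sys_le _ _ _ _ hF
    have htr : tr 0 (map (Polynomial.evalRingHom 0) F) = 0 :=
      tr_eq_zero_of_fatAt hx (sys_le _ _ _ _ hF0) (B := B₁) (k := ord k T) (fun i hi a ha => by
        have := coeff_eq_zero_of_mem_sys_tang hF0 i ha
        rwa [(hb i).2 hi] at this) (by rw [sum_ord hTB]; omega)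
    obtain ⟨G, hG, hFG⟩ := exists_eq_X_mul (sys_le _ _ _ _ hF0) htr
    rw [hFG] at hF0 ⊢
    have hGR := (X_mul_mem_sys_iff hb hG).1 (mem_sys_tang.1 hF0).1
    refine Submodule.mem_map.2 ⟨G, mem_sys_tang.2 ⟨hGR, fun i hi => ?_⟩,
      LinearMap.mulLeft_apply _ _ _⟩
    have hkey : ∀ i ∈ B₁, ∀ a < ord k T i,
        (w i).eval 0 * coeff (Finsupp.single 0 a) (loc (x i) 0 G) +
        coeff (Finsupp.single 0 a) (loc (x i) 0
          (map (Polynomial.evalRingHom 0) (paramDeriv F))) = 0 := by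
      intro i hi a ha
      refine coeff_paramDeriv_of_X_mul hFG ?_
      rw [show Polynomial.X * w i = y i from (if_pos hi).symm]
      exact coeff_eq_zero_of_mem_sys_tang hF i ha
    have hET : ∀ i ∈ E, ord k T i = k i := fun i hi => if_neg fun h => hEB' i hi (hT h)
    have htr1 : tr 0 (map (Polynomial.evalRingHom 0) (paramDeriv F)) = 0 := by
      refine tr_eq_zero_of_fatAt hx (e := d + 1) (IsHomogeneous.paramDeriv hFh |>.map _) (B := B₁)
        (k := res E (ord k T)) (fun i hi a ha => ?_) ?_
      · have h1 := hkey i hi a (ha.trans_le (res_le i))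
        by_cases hiE : i ∈ E
        · have h2 : coeff (Finsupp.single 0 a) (loc (x i) 0 G) = 0 := by
            have := (mem_sys_fats.1 hGR).2 i (Finsupp.single 0 a) (by
              rw [res_on (hEB hiE)]; rw [res_on hiE, hET i hiE] at ha; simpa using ha)
            rwa [(hb i).2 hi] at this
          rwa [h2, mul_zero, zero_add] at h1
        · have h2 : (w i).eval 0 = 0 := by
            simp only [hw_def, if_neg hiE]
            split_ifs <;> simp
          rwa [h2, zero_mul, zero_add] at h1
      · have h1 := sum_res_of_subset (k := ord k T) hEB fun i hi => (hET i hi) ▸ hk i hi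
        rw [sum_ord hTB] at h1
        omega
    have h1 := hkey i (hEB hi) (res B₁ k i) (by
      rw [hET i hi, res_on (hEB hi)]; have := hk i hi; omega)
    rw [coeff_loc_single _ _ (map _ (paramDeriv F)), htr1, Polynomial.zero_comp,
      Polynomial.coeff_zero, add_zero] at h1
    simp only [hw_def, if_pos hi, Polynomial.eval_one, one_mul] at h1
    rw [(hb i).2 (hEB hi)]
    exact h1)
  rw [← ((sys d x b (tang (res B₁ k) E)).equivMapOfInjective _
    (mulLeft_X_injective 1)).finrank_eq] at hle
  have h1 : ∀ᶠ t in 𝓝[≠] (0 : ℂ), ∀ i, i ∉ B → (y i).eval t ≠ 0 :=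
    eventually_all.2 fun i => by
      by_cases hi : i ∈ B
      · simp [hi]
      · exact (eventually_eval_ne_zero (hyB' i hi) 0).mono fun t ht _ => ht
  obtain ⟨t, ht, ht'⟩ := (hle.and h1).exists
  rw [show (fun i => (Polynomial.C (x i)).eval t) = x from funext fun i => Polynomial.eval_C] at ht
  refine ⟨fun i => (y i).eval t, fun i => ⟨fun h => ?_, fun hi => ?_⟩, ht⟩
  · by_contra hi
    exact ht' i hi h
  · simp only [hyB i hi, Polynomial.eval_zero]

/-- Some admissible configuration has a small system. -/
def SmallSys (d : ℕ) (k : ι → ℕ) (B T : Finset ι) (D : ℤ) : Prop :=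
  ∃ x y : ι → ℂ, Function.Injective x ∧ (∀ i, y i = 0 ↔ i ∈ B) ∧
    (Module.finrank ℂ (sys d x y (tang k T)) : ℤ) ≤ D

theorem SmallSys.mono {D D' : ℤ} (h : SmallSys d k B T D) (hD : D ≤ D') : SmallSys d k B T D' := by
  obtain ⟨x, y, h1, h2, h3⟩ := h
  exact ⟨x, y, h1, h2, h3.trans hD⟩

theorem SmallSys.succ [Fintype ι] {D : ℤ} (h : SmallSys d (res B₁ k) B₁ E D)
    (hT : T ⊆ B) (hB : B ⊆ B₁) (hE : E ⊆ B₁ \ B)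
    (hk : ∀ i ∈ E, 1 ≤ k i) (hsum : d + 2 + E.card ≤ ∑ i ∈ B₁, k i + T.card) :
    SmallSys (d + 1) k B T D := by
  obtain ⟨x, b, h1, h2, h3⟩ := h
  obtain ⟨y, h4, h5⟩ := finrank_le_of_residual h1 h2 hT hB hE hk hsum
  exact ⟨x, y, h1, h4, le_trans (by exact_mod_cast h5) h3⟩

end

theorem exists_subset_sum_lt {ι : Type*} [DecidableEq ι] {f : ι → ℕ} {m n : ℕ} (hm : 1 ≤ m)
    (hf : ∀ i, f i ≤ m) (C : Finset ι) (h : n ≤ ∑ i ∈ C, f i) :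
    ∃ A ⊆ C, (∀ i ∈ A, 1 ≤ f i) ∧ n ≤ ∑ i ∈ A, f i ∧ ∑ i ∈ A, f i < n + m := by
  induction C using Finset.induction_on with
  | empty => exact ⟨∅, subset_rfl, by simp, h, by simp; omega⟩
  | insert a C ha ih =>
    by_cases h1 : n ≤ ∑ i ∈ C, f i
    · obtain ⟨A, hA, h2⟩ := ih h1
      exact ⟨A, hA.trans (Finset.subset_insert _ _), h2⟩
    · have h2 : ∑ i ∈ (insert a C).filter (fun i => f i ≠ 0), f i = ∑ i ∈ insert a C, f i :=
        Finset.sum_filter_ne_zero _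
      refine ⟨(insert a C).filter (fun i => f i ≠ 0), Finset.filter_subset _ _, fun i hi => ?_, ?_,
          ?_⟩
      · exact Nat.one_le_iff_ne_zero.2 (Finset.mem_filter.1 hi).2
      · rwa [h2]
      · rw [h2, Finset.sum_insert ha]
        have := hf a
        omega

theorem exists_injective_complex (ι : Type*) [Fintype ι] : ∃ x : ι → ℂ, Function.Injective x :=
  ⟨fun i => ((Fintype.equivFin ι i : ℕ) : ℂ), fun i j h => by
    have : (Fintype.equivFin ι i : ℕ) = Fintype.equivFin ι j := by 
      have h' : (((Fintype.equivFin ι i : Fin _) : ℕ) : ℂ) = ((Fintype.equivFin ι j : Fin _) : ℕ) :=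
          h
      exact_mod_cast h'
    exact (Fintype.equivFin ι).injective (Fin.ext this)⟩

theorem finrank_homogeneousSubmodule (d : ℕ) :
    Module.finrank ℂ (homogeneousSubmodule (Fin 3) ℂ d) = (d + 2).choose 2 := by
  have h := finrank_map_toPoly d ⊤
  rw [finrank_top, Module.finrank_fintype_fun_eq_card, card_idx] at h
  have he : homogeneousSubmodule (Fin 3) ℂ d = (⊤ : Submodule ℂ _).map (toPoly ℂ d) := ?_
  · rw [he, h]
  refine le_antisymm (fun F hF => ?_) ?_
  · exact Submodule.mem_map.2 ⟨fun e => coeff e.1 F, Submodule.mem_top, toPoly_coeff hF⟩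
  · rintro _ ⟨c, -, rfl⟩
    exact toPoly_isHomogeneous c

theorem finrank_sys_le {ι : Type*} (d : ℕ) (x y : ι → ℂ) (N : ι → Finset (Fin 2 →₀ ℕ)) :
    Module.finrank ℂ (sys d x y N) ≤ (d + 2).choose 2 := by
  rw [← finrank_homogeneousSubmodule]
  exact Submodule.finrank_mono (sys_le d x y N)

theorem sum_le_card_mul {ι : Type*} {k : ι → ℕ} {m : ℕ} (hk : ∀ i, k i ≤ m) (B : Finset ι) :
    ∑ i ∈ B, k i ≤ (B.filter fun i => k i ≠ 0).card * m := by
  rw [← Finset.sum_filter_ne_zero]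
  exact Finset.sum_le_card_nsmul _ _ _ fun i _ => hk i

section
variable {ι : Type*} [DecidableEq ι] {d : ℕ} {k : ι → ℕ} {B T : Finset ι}

theorem sum_res_add_card (B : Finset ι) (k : ι → ℕ) :
    ∑ i ∈ B, res B k i + (B.filter fun i => k i ≠ 0).card = ∑ i ∈ B, k i := by
  rw [Finset.card_filter, ← Finset.sum_add_distrib]
  refine Finset.sum_congr rfl fun i hi => ?_
  rw [res_on hi]
  split_ifs <;> omega

theorem finrank_le_of_sum_le [Fintype ι] {x : ι → ℂ} (hx : Function.Injective x)
    (hk : ∑ i, k i + T.card ≤ d + 1) :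
    (Module.finrank ℂ (sys d x 0 (tang k T)) : ℤ) ≤ chi d k - T.card := by
  induction d generalizing k T with
  | zero => ?_
  | succ d ih => ?_
  all_goals
    obtain ⟨c, hc⟩ := Nat.exists_eq_add_of_le hk
    have hP := pointsPoly_monic Finset.univ (ord k T) x
    have hsum := sum_ord (k := k) (Finset.subset_univ T)
  · have hle : (sys 0 x 0 (tang k T)).map (tr (0 : ℂ)).toLinearMap ≤
        multiples (pointsPoly Finset.univ (ord k T) x) c := by
      rintro _ ⟨F, hF, rfl⟩
      refine mem_multiples hP.ne_zero (n := 0) ?_ (natDegree_restrictLine_le _ _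
        (sys_le _ _ _ _ hF)).1 (pointsPoly_dvd hx fun i hi => ?_)
      · rw [natDegree_pointsPoly, hsum, ← hc]
      · exact (X_sub_C_pow_dvd_tr_iff _ _ _ _).2 fun a ha =>
          coeff_eq_zero_of_mem_sys_tang hF i ha
    have h1 := finrank_map_add_finrank_inf_ker (sys 0 x 0 (tang k T)) (tr (0 : ℂ)).toLinearMap
    have h2 : sys 0 x 0 (tang k T) ⊓ LinearMap.ker (tr (0 : ℂ)).toLinearMap = ⊥ := by
      rw [eq_bot_iff]
      intro F hF
      obtain ⟨hF, hF0⟩ := Submodule.mem_inf.1 hF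
      have hF' : F.IsHomogeneous 0 := sys_le _ _ _ _ hF
      have hF1 : tr (0 : ℂ) F = 0 := hF0
      refine (Submodule.mem_bot ℂ).2 (MvPolynomial.ext _ _ fun e => ?_)
      by_cases he : e.degree = 0
      · have h3 := (Finsupp.degree_eq_zero_iff e).1 he
        rw [← coeff_tr hF' (by simp [h3]) he, hF1, Polynomial.coeff_zero, coeff_zero]
      · exact hF'.coeff_eq_zero he
    have h3 := Submodule.finrank_mono hle
    rw [finrank_multiples hP.ne_zero] at h3
    rw [h2, finrank_bot] at h1
    have h4 : ∀ i, (k i + 1).choose 2 = k i := by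
      intro i
      have : k i ≤ 1 := by
        have := Finset.single_le_sum (f := k) (fun _ _ => Nat.zero_le _) (Finset.mem_univ i)
        omega
      interval_cases k i <;> rfl
    simp only [chi, h4]
    have h5 : (∑ i, (k i : ℤ)) + T.card + c = 1 := by exact_mod_cast hc.symm
    simp
    zify at h1 h3
    linarith
  · have hle : (sys (d + 1) x 0 (tang k T)).map (tr (0 : ℂ)).toLinearMap ≤
        multiples (pointsPoly Finset.univ (ord k T) x) c := by
      rintro _ ⟨F, hF, rfl⟩
      refine mem_multiples hP.ne_zero (n := d + 1) ?_ (natDegree_restrictLine_le _ _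
        (sys_le _ _ _ _ hF)).1 (pointsPoly_dvd hx fun i hi => ?_)
      · rw [natDegree_pointsPoly, hsum, ← hc]
      · exact (X_sub_C_pow_dvd_tr_iff _ _ _ _).2 fun a ha =>
          coeff_eq_zero_of_mem_sys_tang hF i ha
    have h1 := finrank_map_add_finrank_inf_ker (sys (d + 1) x 0 (tang k T))
      (tr (0 : ℂ)).toLinearMap
    have h2 : sys (d + 1) x 0 (tang k T) ⊓ LinearMap.ker (tr (0 : ℂ)).toLinearMap ≤
        (sys d x 0 (fats (res Finset.univ k))).map (LinearMap.mulLeft ℂ (X 1)) := by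
      rw [← sys_inf_ker_tr (by simp)]
      exact inf_le_inf_right _ fun F hF => (mem_sys_tang.1 hF).1
    have h2' := Submodule.finrank_mono h2
    have h3 := Submodule.finrank_mono hle
    rw [finrank_multiples hP.ne_zero] at h3
    rw [← ((sys d x 0 (fats (res Finset.univ k))).equivMapOfInjective _
      (mulLeft_X_injective 1)).finrank_eq, ← tang_empty] at h2'
    have h6 : ∑ i, res Finset.univ k i + (∅ : Finset ι).card ≤ d + 1 := by
      have h7 := sum_res_add_card Finset.univ k
      by_cases h8 : ∑ i, k i = 0
      · simp only [Finset.card_empty]; omega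
      · obtain ⟨i, hi, h9⟩ := Finset.exists_ne_zero_of_sum_ne_zero h8
        have : 0 < (Finset.univ.filter fun i => k i ≠ 0).card :=
          Finset.card_pos.2 ⟨i, Finset.mem_filter.2 ⟨hi, h9⟩⟩
        simp only [Finset.card_empty]; omega
    have h7 := ih h6
    rw [Finset.card_empty] at h7
    have h8 := chi_succ d Finset.univ k
    have h5 : (∑ i, (k i : ℤ)) + T.card + c = d + 2 := by exact_mod_cast hc.symm
    zify at h1 h2' h3
    push_cast at h7
    linarith

theorem smallSys_of_sum_le [Fintype ι] (hk : ∑ i, k i + T.card ≤ d + 1) :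
    SmallSys d k B T (chi d k - T.card) := by
  obtain ⟨x, hx⟩ := exists_injective_complex ι
  have h1 := finrank_semicontinuous (d := d) (x := fun i => Polynomial.C (x i))
    (y := fun i => if i ∈ B then 0 else Polynomial.X) (N := tang k T) (a := x) (b := 0)
    (fun i => Polynomial.eval_C) (fun i => by split_ifs <;> simp)
  obtain ⟨t, ht, ht0⟩ := (h1.and self_mem_nhdsWithin).exists
  rw [show (fun i => (Polynomial.C (x i)).eval t) = x from funext fun i => Polynomial.eval_C] at ht
  refine ⟨x, _, hx, fun i => ?_, le_trans (by exact_mod_cast ht) (finrank_le_of_sum_le hx hk)⟩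
  by_cases hi : i ∈ B
  · simp [hi]
  · simpa [hi] using ht0

theorem smallSys_choose [Fintype ι] : SmallSys d k B T ((d + 2).choose 2) := by
  obtain ⟨x, hx⟩ := exists_injective_complex ι
  refine ⟨x, fun i => if i ∈ B then 0 else 1, hx, fun i => ?_, ?_⟩
  · by_cases hi : i ∈ B <;> simp [hi]
  · exact_mod_cast finrank_sys_le d x _ _

theorem smallSys_of_room [Fintype ι] {m : ℕ} (hm : 1 ≤ m) (hk : ∀ i, k i ≤ m) (hT : T ⊆ B)
    (hTm : T.card ≤ m) (hB : ∑ i ∈ B, k i + T.card + m ^ 2 ≤ d + 1) :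
    SmallSys d k B T (max (chi d k - T.card) ((3 * m ^ 3 + 2).choose 2)) := by
  induction d generalizing k B T with
  | zero => exact smallSys_choose.mono (le_max_of_le_right (by
      exact_mod_cast Nat.choose_le_choose 2 (by omega)))
  | succ d ih =>
    by_cases hd : d + 1 ≤ 3 * m ^ 3
    · exact smallSys_choose.mono (le_max_of_le_right (by
        exact_mod_cast Nat.choose_le_choose 2 (by omega)))
    by_cases hall : ∑ i, k i + T.card ≤ d + 1 + 1
    · exact (smallSys_of_sum_le hall).mono (le_max_left _ _)
    have hsplit := Finset.sum_add_sum_compl B k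
    obtain ⟨A, hA, hA1, hA2, hA3⟩ := exists_subset_sum_lt hm hk Bᶜ
      (n := d + 2 - (∑ i ∈ B, k i + T.card)) (by omega)
    have hdisj : Disjoint B A := Finset.disjoint_right.2 fun i hi => by simpa using hA hi
    have hsum : ∑ i ∈ B ∪ A, k i = ∑ i ∈ B, k i + ∑ i ∈ A, k i := Finset.sum_union hdisj
    have hAm : ∑ i ∈ A, k i ≤ A.card * m := Finset.sum_le_card_nsmul _ _ _ fun i _ => hk i
    have hAcard : m ≤ A.card := by
      by_contra h
      push Not at h
      have : A.card * m < m ^ 2 := by nlinarith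
      omega
    obtain ⟨E, hE, hEcard⟩ := Finset.exists_subset_card_eq
      (s := A) (n := ∑ i ∈ A, k i + (∑ i ∈ B, k i + T.card) - (d + 2)) (by omega)
    have hact := sum_res_add_card (B ∪ A) k
    have hactm := sum_le_card_mul hk (B ∪ A)
    set act := ((B ∪ A).filter fun i => k i ≠ 0).card
    have hactge : m ^ 2 + 2 * m ≤ act + 1 := by
      by_contra h
      push Not at h
      have h1 : (act + 2) * m ≤ (m ^ 2 + 2 * m) * m := Nat.mul_le_mul_right _ (by omega)
      have h2 : (m ^ 2 + 2 * m) * m ≤ 3 * m ^ 3 := by nlinarith [sq_nonneg m]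
      have h3 : (act + 2) * m = act * m + 2 * m := by ring
      omega
    have h := ih (k := res (B ∪ A) k) (B := B ∪ A) (T := E) (fun i => (res_le i).trans (hk i))
      (hE.trans Finset.subset_union_right) (by omega) (by omega)
    refine (h.succ hT Finset.subset_union_left (fun i hi => ?_) (fun i hi => hA1 i (hE hi))
      (by omega)).mono (max_le_max ?_ le_rfl)
    · have := hA (hE hi)
      simp only [Finset.mem_sdiff, Finset.mem_union]
      exact ⟨Or.inr (hE hi), by simpa using this⟩
    · have h3 := chi_succ d (B ∪ A) k
      have h4 : (∑ i ∈ B ∪ A, (k i : ℤ)) + T.card = d + 2 + E.card := by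
        have : ∑ i ∈ B ∪ A, k i + T.card = d + 2 + E.card := by omega
        exact_mod_cast this
      linarith

theorem smallSys_of_overfill [Fintype ι] {m K : ℕ} (hm : 1 ≤ m) (hk : ∀ i, k i ≤ m) (hT : T ⊆ B)
    (hB : ∑ i ∈ B, k i + T.card ≤ d + 1 + K) (hd : m * (m ^ 2 + m + K + 2) ≤ d) :
    SmallSys d k B T (max (chi d k - T.card + K + m) ((3 * m ^ 3 + 2).choose 2)) := by
  obtain ⟨d, rfl⟩ : ∃ d', d = d' + 1 := Nat.exists_eq_add_one.2 (lt_of_lt_of_le (by positivity) hd)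
  by_cases hall : ∑ i, k i + T.card ≤ d + 1 + 1
  · exact (smallSys_of_sum_le hall).mono (le_max_of_le_left (by linarith))
  have hsplit := Finset.sum_add_sum_compl B k
  obtain ⟨A, hA, hA1, hA2, hA3⟩ := exists_subset_sum_lt hm hk Bᶜ
    (n := d + 2 - (∑ i ∈ B, k i + T.card)) (by omega)
  have hdisj : Disjoint B A := Finset.disjoint_right.2 fun i hi => by simpa using hA hi
  have hsum : ∑ i ∈ B ∪ A, k i = ∑ i ∈ B, k i + ∑ i ∈ A, k i := Finset.sum_union hdisj
  have hact := sum_res_add_card (B ∪ A) k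
  have hactm := sum_le_card_mul hk (B ∪ A)
  set act := ((B ∪ A).filter fun i => k i ≠ 0).card
  have hactge : m ^ 2 + m + K + 1 ≤ act + T.card := by
    by_contra h
    push Not at h
    have h1 : (act + T.card) * m ≤ (m ^ 2 + m + K + 2) * m := Nat.mul_le_mul_right _ (by omega)
    have h2 : T.card ≤ T.card * m := Nat.le_mul_of_pos_right _ hm
    have h3 : d + 2 ≤ act * m + T.card * m := by omega
    nlinarith
  have h := smallSys_of_room hm (k := res (B ∪ A) k) (B := B ∪ A) (T := ∅) (d := d)
    (fun i => (res_le i).trans (hk i)) (Finset.empty_subset _) (by simp) (by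
      rw [Finset.card_empty]; omega)
  refine (h.succ hT Finset.subset_union_left (Finset.empty_subset _) (by simp)
    (by rw [Finset.card_empty]; omega)).mono (max_le_max ?_ le_rfl)
  have h3 := chi_succ d (B ∪ A) k
  have h4 : (∑ i ∈ B ∪ A, (k i : ℤ)) + T.card ≤ d + 2 + K + m := by
    have : ∑ i ∈ B ∪ A, k i + T.card ≤ d + 2 + K + m := by omega
    exact_mod_cast this
  rw [Finset.card_empty]
  push_cast
  linarith

end

theorem Good.exists_of_subset {ι : Type*} [Fintype ι] [DecidableEq ι] {d : ℕ} {k : ι → ℕ}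
    {B B₁ : Finset ι} {a b : ι → ℂ}
    {G : MvPolynomial (Fin 3) ℂ} (h : Good d k B₁ a b G) (hB : B ⊆ B₁) :
    ∃ x y F, Good d k B x y F := by
  obtain ⟨t, F, hF⟩ := (h.eventually_exists hB (x := fun i => Polynomial.C (a i))
    (y := fun i => if i ∈ B then 0 else Polynomial.X + Polynomial.C (b i))
    (fun i => Polynomial.eval_C) (fun i => by
      by_cases hi : i ∈ B
      · simp [hi, (h.on_iff i).2 (hB hi)]
      · simp [hi]) (fun i hi => if_pos hi) (fun i hi => by
        rw [if_neg hi]; exact Polynomial.X_add_C_ne_zero _)).exists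
  exact ⟨_, _, F, hF⟩

theorem exists_good_one {ι : Type*} [Fintype ι] [DecidableEq ι] :
    ∃ x y F, Good 1 (0 : ι → ℕ) Finset.univ x y F := by
  obtain ⟨x, hx⟩ := exists_injective_complex ι
  obtain ⟨ξ, hξ⟩ : ∃ ξ, ξ ∉ Finset.univ.image x := Infinite.exists_notMem_finset _
  set F : MvPolynomial (Fin 3) ℂ := X 0 - C ξ * X 2 + X 1 with hF_def
  have hF : F.IsHomogeneous 1 := by
    refine IsHomogeneous.add (IsHomogeneous.sub (isHomogeneous_X _ _) ?_) (isHomogeneous_X _ _)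
    simpa using (isHomogeneous_C (Fin 3) ξ).mul (isHomogeneous_X ℂ 2)
  have hF0 : coeff (Finsupp.single 0 1) F = 1 := by
    simp [hF_def, coeff_C_mul, coeff_X, Finsupp.single_left_inj]
  have hF1 : F ≠ 0 := fun h => by simp [h] at hF0
  have htr : tr 0 F = Polynomial.X - Polynomial.C ξ := by
    obtain ⟨h0, h1, h2⟩ := tr_X (0 : ℂ)
    rw [hF_def, map_add, map_sub, map_mul, h0, h1, h2, algHom_C, Polynomial.algebraMap_eq]
    simp
  refine ⟨x, 0, F, hF, fun i e he => absurd he (Nat.not_lt_zero _), fun i => by simp, hx, ?_,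
    ⟨fun i hi => absurd hi (by simp), fun Q _ hQ => ?_, ?_⟩, fun i _ => ?_, ?_⟩
  · have h : sys 1 x 0 (fats (0 : ι → ℕ)) = homogeneousSubmodule (Fin 3) ℂ 1 := by
      ext G
      rw [mem_sys_fats]
      exact and_iff_left fun i e he => absurd he (Nat.not_lt_zero _)
    rw [h, finrank_homogeneousSubmodule, chi]
    simp
  · have := hQ 0
    simp [hF_def, pderiv_X] at this
  · refine irreducible_of_totalDegree_eq_one (hF.totalDegree hF1) fun r hr => ?_
    refine isUnit_iff_ne_zero.2 ?_
    rintro rfl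
    have := hr (Finsupp.single 0 1)
    rw [hF0, zero_dvd_iff] at this
    exact one_ne_zero this
  · rw [coeff_loc_single, htr]
    have : x i - ξ ≠ 0 := fun h => hξ (Finset.mem_image.2 ⟨i, Finset.mem_univ _, sub_eq_zero.1 h⟩)
    simpa [Polynomial.coeff_zero_eq_eval_zero] using this
  · rw [htr]; exact Polynomial.X_sub_C_ne_zero ξ

theorem exists_good_univ {ι : Type*} [Fintype ι] [DecidableEq ι] {d : ℕ} (hd : 1 ≤ d) {k : ι → ℕ}
    (hk : ∀ i, k i + 1 ≤ d) (hsum : ∑ i, k i ≤ d) : ∃ x y F, Good d k Finset.univ x y F := by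
  induction d, hd using Nat.le_induction generalizing k with
  | base =>
    obtain rfl : k = 0 := funext fun i => by simpa using hk i
    exact exists_good_one
  | succ d hd ih =>
    have h1 := sum_res_add_card Finset.univ k
    have h2 := sum_le_card_mul (k := k) (m := d) (fun i => by have := hk i; omega) Finset.univ
    set act := (Finset.univ.filter fun i => k i ≠ 0).card
    have h3 : ∑ i, res Finset.univ k i + 1 ≤ d := by
      rcases (by omega : act = 0 ∨ act = 1 ∨ 2 ≤ act) with h | h | h
      · rw [h] at h2; omega
      · rw [h] at h2; omega
      · omega
    obtain ⟨x, y, G, hG⟩ := ih (k := res Finset.univ k) (fun i => by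
      rw [res_on (Finset.mem_univ i)]; have := hk i; omega) (by omega)
    obtain ⟨F, hF⟩ := hG.underfill hsum h3
    exact ⟨x, y, F, hF⟩

theorem exists_good_of_large_chi {ι : Type*} [Fintype ι] [DecidableEq ι] {m : ℕ} (hm : 1 ≤ m)
    {d : ℕ} {k : ι → ℕ}
    {B : Finset ι} (hk : ∀ i, k i ≤ m) (hchi : ((m : ℤ) + 1) * (d + 1) ≤ chi d k)
    (hB : ∑ i ∈ B, k i ≤ d) : ∃ x y F, Good d k B x y F := by
  induction d generalizing k B with
  | zero =>
    have h : chi 0 k ≤ 1 := by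
      rw [chi]
      have : (0 : ℤ) ≤ ∑ i, ((k i + 1).choose 2 : ℤ) := Finset.sum_nonneg fun _ _ => by positivity
      simp only [zero_add, Nat.choose_self, Nat.cast_one]
      linarith
    push_cast at hchi
    have : (1 : ℤ) ≤ m := by exact_mod_cast hm
    linarith
  | succ d ih =>
    have hd : 2 * m ≤ d + 1 := by
      have h : chi (d + 1) k ≤ ((d + 3).choose 2 : ℕ) := by
        rw [chi]
        have : (0 : ℤ) ≤ ∑ i, ((k i + 1).choose 2 : ℤ) := Finset.sum_nonneg fun _ _ => by positivity
        linarith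
      have h2 : (m + 1) * (d + 1 + 1) ≤ (d + 3).choose 2 := by
        have := hchi.trans h
        push_cast at this
        exact_mod_cast this
      rw [Nat.choose_two_right] at h2
      have h3 := (Nat.le_div_iff_mul_le (by norm_num)).1 h2
      have h4 : (d + 2) * (2 * (m + 1)) ≤ (d + 2) * (d + 3) := by
        have : d + 3 - 1 = d + 2 := rfl
        rw [this] at h3
        nlinarith
      have := Nat.le_of_mul_le_mul_left h4 (by omega)
      omega
    by_cases hall : ∑ i, k i ≤ d + 1
    · obtain ⟨x, y, F, hF⟩ := exists_good_univ (d := d + 1) (by omega)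
        (fun i => by have := hk i; omega) hall
      exact hF.exists_of_subset (Finset.subset_univ B)
    have hsplit := Finset.sum_add_sum_compl B k
    obtain ⟨A, hA, hA1, hA2⟩ : ∃ A ⊆ Bᶜ, d + 2 ≤ ∑ i ∈ B, k i + ∑ i ∈ A, k i + m ∧
        ∑ i ∈ B, k i + ∑ i ∈ A, k i ≤ d + 1 := by
      by_cases h : d + 2 ≤ ∑ i ∈ B, k i + m
      · exact ⟨∅, Finset.empty_subset _, by simpa using h, by simpa using hB⟩
      · obtain ⟨A, hA, -, hA1, hA2⟩ := exists_subset_sum_lt hm hk Bᶜ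
          (n := d + 2 - m - ∑ i ∈ B, k i) (by omega)
        exact ⟨A, hA, by omega, by omega⟩
    have hdisj : Disjoint B A := Finset.disjoint_right.2 fun i hi => by simpa using hA hi
    rw [← Finset.sum_union hdisj] at hA1 hA2
    have hact := sum_res_add_card (B ∪ A) k
    have hactm := sum_le_card_mul hk (B ∪ A)
    set act := ((B ∪ A).filter fun i => k i ≠ 0).card
    have hact2 : 2 ≤ act := by
      by_contra h
      have : act * m ≤ 1 * m := Nat.mul_le_mul_right _ (by omega)
      omega
    have h3 := chi_succ d (B ∪ A) k
    have h4 : ((d : ℤ) + 2) ≤ ∑ i ∈ B ∪ A, (k i : ℤ) + m := by exact_mod_cast hA1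
    obtain ⟨x, y, G, hG⟩ := ih (k := res (B ∪ A) k) (B := B ∪ A)
      (fun i => (res_le i).trans (hk i)) (by push_cast at hchi; linarith) (by omega)
    obtain ⟨F, hF⟩ := hG.underfill hA2 (by omega)
    exact hF.exists_of_subset Finset.subset_union_left

theorem eventually_finrank_sys_le {ι : Type*} [Fintype ι] {d : ℕ} (x y : ι → Polynomial ℂ)
    (N : ι → Finset (Fin 2 →₀ ℕ)) (z w : ℂ) :
    ∀ᶠ t in 𝓝[≠] z, Module.finrank ℂ
      (sys d (fun i => (x i).eval t) (fun i => (y i).eval t) N) ≤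
      Module.finrank ℂ (sys d (fun i => (x i).eval w) (fun i => (y i).eval w) N) := by
  classical
  have hfin : ∀ p : Polynomial ℂ →+* ℂ, Module.finrank ℂ (LinearMap.ker
      ((condMatrix d x y N).map p).mulVecLin) =
      Module.finrank ℂ (sys d (fun i => p (x i)) (fun i => p (y i)) N) := by
    intro t
    rw [sys_eq_map, finrank_map_toPoly, condMatrix_map]
  set σ : Polynomial ℂ →+* Polynomial ℂ :=
    Polynomial.compRingHom (Polynomial.X + Polynomial.C w) with hσ
  have hσt : ∀ t, (Polynomial.evalRingHom t).comp σ = Polynomial.evalRingHom (t + w) := by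
    intro t
    ext <;> simp [hσ]
  have hM : ∀ t, ((condMatrix d x y N).map σ).map (Polynomial.evalRingHom t) =
      (condMatrix d x y N).map (Polynomial.evalRingHom (t + w)) := by
    intro t
    rw [Matrix.map_map, ← hσt]
    rfl
  obtain ⟨q, hq, h⟩ := (kernel_limit_of_ne_zero ((condMatrix d x y N).map σ)
    (LinearMap.ker ((condMatrix d x y N).map (Polynomial.evalRingHom w)).mulVecLin)
    fun c hc => by
      have h1 : (fun i => (c i).eval 0) = fun i => Polynomial.evalRingHom 0 (c i) := rfl
      have h2 := hM 0
      rw [zero_add] at h2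
      rw [h1, LinearMap.mem_ker, Matrix.mulVecLin_apply, ← h2]
      funext j
      have h3 := congrArg (Polynomial.evalRingHom 0) (congrFun hc j)
      rw [Matrix.mulVec, dotProduct, map_sum] at h3
      simp only [map_mul] at h3
      rw [Pi.zero_apply, map_zero] at h3
      exact h3).1
  have hq' : q.comp (Polynomial.X - Polynomial.C w) ≠ 0 := by
    intro h0
    apply hq
    have := congrArg (fun p => p.comp (Polynomial.X + Polynomial.C w)) h0
    simpa [Polynomial.comp_assoc] using this
  filter_upwards [eventually_eval_ne_zero hq' z] with t ht
  have h4 := h (t - w) (by simpa using ht)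
  rw [hM, hfin, hfin, sub_add_cancel] at h4
  exact h4

theorem exists_subset_functionals {ι V : Type*} [AddCommGroup V] [Module ℂ V] {R K : Submodule ℂ V}
    [FiniteDimensional ℂ R] [FiniteDimensional ℂ K] {f : ι → V →ₗ[ℂ] ℂ} {A : Finset ι}
    (hK : ∀ v ∈ R, (∀ i ∈ A, f i v = 0) → v ∈ K) {n : ℕ}
    (hn : n + Module.finrank ℂ K ≤ Module.finrank ℂ R) :
    ∃ E ⊆ A, E.card = n ∧ ∀ w : ι → ℂ, ∃ v ∈ R, ∀ i ∈ E, f i v = w i := by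
  classical
  induction n with
  | zero => exact ⟨∅, Finset.empty_subset _, rfl, fun w => ⟨0, R.zero_mem, by simp⟩⟩
  | succ n ih =>
    obtain ⟨E, hE, hcard, hsurj⟩ := ih (by omega)
    obtain ⟨v, hv, hvE, j, hj, hvj⟩ : ∃ v ∈ R, (∀ i ∈ E, f i v = 0) ∧ ∃ j ∈ A, f j v ≠ 0 := by
      by_contra! hcon
      have h1 := finrank_map_add_finrank_inf_ker R (LinearMap.pi fun i : E => f i)
      have h2 : R ⊓ LinearMap.ker (LinearMap.pi fun i : E => f i) ≤ K := by
        intro v hv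
        obtain ⟨hv, hv0⟩ := Submodule.mem_inf.1 hv
        exact hK v hv (hcon v hv fun i hi => congrFun (LinearMap.mem_ker.1 hv0) ⟨i, hi⟩)
      have h3 := Submodule.finrank_mono h2
      have h4 := Submodule.finrank_le (R.map (LinearMap.pi fun i : E => f i))
      rw [Module.finrank_fintype_fun_eq_card, Fintype.card_coe, hcard] at h4
      omega
    have hjE : j ∉ E := fun h => hvj (hvE j h)
    refine ⟨insert j E, Finset.insert_subset hj hE, by rw [Finset.card_insert_of_notMem hjE, hcard],
      fun w => ?_⟩
    obtain ⟨u, hu, huw⟩ := hsurj w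
    refine ⟨u + ((w j - f j u) / f j v) • v, R.add_mem hu (R.smul_mem _ hv), fun i hi => ?_⟩
    rw [map_add, map_smul, smul_eq_mul]
    rcases Finset.mem_insert.1 hi with rfl | hi
    · rw [div_mul_cancel₀ _ hvj, add_sub_cancel]
    · rw [hvE i hi, mul_zero, add_zero, huw i hi]

section
variable {ι : Type*} [Fintype ι] [DecidableEq ι] {d : ℕ} {k : ι → ℕ} {B B₁ T : Finset ι}

theorem Good.exists_finrank_le {a b : ι → ℂ} {G : MvPolynomial (Fin 3) ℂ} {D : ℤ}
    (h : Good d k B a b G) (hs : SmallSys d k B T D) :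
    ∃ x y F, Good d k B x y F ∧ (Module.finrank ℂ (sys d x y (tang k T)) : ℤ) ≤ D := by
  obtain ⟨a', b', -, hb', hD⟩ := hs
  set x : ι → Polynomial ℂ := fun i => Polynomial.C (a i) + Polynomial.X * Polynomial.C (a' i - a i)
  set y : ι → Polynomial ℂ := fun i => Polynomial.C (b i) + Polynomial.X * Polynomial.C (b' i - b i)
  have h1 := h.eventually_exists subset_rfl (x := x) (y := y) (fun i => by simp [x])
    (fun i => by simp [y]) (fun i hi => by simp [y, (h.on_iff i).2 hi, (hb' i).2 hi])
    (fun i hi h0 => hi ((h.on_iff i).1 (by simpa [y] using congrArg (Polynomial.eval 0) h0)))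
  have h2 := eventually_finrank_sys_le (d := d) x y (tang k T) 0 1
  rw [show (fun i => (x i).eval 1) = a' from funext fun i => by simp [x],
    show (fun i => (y i).eval 1) = b' from funext fun i => by simp [y]] at h2
  obtain ⟨t, ⟨F, hF⟩, ht⟩ := (h1.and h2).exists
  exact ⟨_, _, F, hF, le_trans (by exact_mod_cast ht) hD⟩

theorem Good.exists_overshoot {a b : ι → ℂ} {G : MvPolynomial (Fin 3) ℂ} {D : ℤ} {n : ℕ}
    (h : Good d (res B₁ k) B₁ a b G) (hBB : B ⊆ B₁)
    (hs : SmallSys d (res B₁ k) B₁ (B₁ \ B) D) (hD : D + n ≤ chi d (res B₁ k)) (hn : 1 ≤ n)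
    (hk : ∀ i ∈ B₁ \ B, 1 ≤ k i) (hsum : ∑ i ∈ B₁, k i = d + 1 + n)
    (hdeg : ∑ i ∈ B₁, res B₁ k i + 1 ≤ d) : ∃ x y F, Good (d + 1) k B x y F := by
  obtain ⟨x, y, F, hF, hle⟩ := h.exists_finrank_le hs
  obtain ⟨E, hE, hcard, hsurj⟩ := exists_subset_functionals
    (R := sys d x y (fats (res B₁ k))) (K := sys d x y (tang (res B₁ k) (B₁ \ B)))
    (f := fun i => lcoeff ℂ (Finsupp.single 0 (res B₁ k i)) ∘ₗ (loc (x i) 0).toLinearMap)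
    (A := B₁ \ B) (n := n) (fun v hv hv0 => mem_sys_tang.2 ⟨hv, fun i hi => by
      rw [(hF.on_iff i).2 (Finset.mem_sdiff.1 hi).1]
      exact hv0 i hi⟩) (by
      have := hF.dim
      zify
      linarith)
  have hE1 : E.Nonempty := Finset.card_pos.1 (by omega)
  obtain ⟨y', F', hF'⟩ := hF.overshoot hBB hE hE1 (fun i hi => hk i (hE hi))
    (by rw [hcard]; exact hsum) (by
      rw [eq_top_iff]
      intro w _
      obtain ⟨v, hv, hvw⟩ := hsurj fun i => if hi : i ∈ E then w ⟨i, hi⟩ else 0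
      refine Submodule.mem_map.2 ⟨v, hv, funext fun i => ?_⟩
      have := hvw i i.2
      rw [dif_pos i.2] at this
      exact this) hdeg
  exact ⟨x, y', F', hF'⟩

end

/-- Degree from which a configuration with enough room on the line can be treated. -/
def roomDeg (m : ℕ) : ℕ := m * (3 * m ^ 2 + 2 * m + 3)

/-- Expected dimension from which a configuration with enough room on the line can be treated. -/
def roomChi (m : ℕ) : ℕ := (3 * m ^ 3 + 2).choose 2 + m + (m + 1) * (roomDeg m + 1)

theorem two_mul_sum_choose_le {ι : Type*} [Fintype ι] {m : ℕ} {k : ι → ℕ} (hk : ∀ i, k i ≤ m) :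
    2 * ∑ i, (k i + 1).choose 2 ≤ (m + 1) * ∑ i, k i := by
  rw [Finset.mul_sum, Finset.mul_sum]
  refine Finset.sum_le_sum fun i _ => ?_
  rw [Nat.choose_two_right, Nat.add_sub_cancel]
  calc 2 * ((k i + 1) * k i / 2) ≤ (k i + 1) * k i := Nat.mul_div_le _ _
    _ ≤ (m + 1) * k i := Nat.mul_le_mul_right _ (by have := hk i; omega)

theorem two_mul_choose_two (d : ℕ) : 2 * (d + 2).choose 2 = (d + 1) * (d + 2) := by
  rw [Nat.choose_two_right, Nat.mul_div_cancel' (Nat.even_mul_pred_self _).two_dvd, mul_comm]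
  rfl

theorem exists_good_of_room {ι : Type*} [Fintype ι] [DecidableEq ι] {m : ℕ} (hm : 1 ≤ m) {d : ℕ}
    {k : ι → ℕ} {B : Finset ι} (hk : ∀ i, k i ≤ m) (hd : roomDeg m ≤ d)
    (hchi : (roomChi m : ℤ) ≤ chi d k) (hB : ∑ i ∈ B, k i + 3 * m ^ 2 ≤ d + 1) :
    ∃ x y F, Good d k B x y F := by
  have hm2 : 1 ≤ m ^ 2 := Nat.one_le_pow _ _ hm
  induction d, hd using Nat.le_induction generalizing k B with
  | base =>
    refine exists_good_of_large_chi hm hk (le_trans ?_ hchi) (by omega)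
    rw [roomChi]
    push_cast
    nlinarith [((3 * m ^ 3 + 2).choose 2).cast_nonneg (α := ℤ), m.cast_nonneg (α := ℤ)]
  | succ d hd ih =>
    by_cases hlarge : ((m : ℤ) + 1) * ((d + 1 : ℕ) + 1) ≤ chi (d + 1) k
    · exact exists_good_of_large_chi hm hk hlarge (by omega)
    have hd' : 3 * m ^ 3 + 2 * m ^ 2 + 3 * m ≤ d := by
      refine le_trans (le_of_eq ?_) hd
      rw [roomDeg]; ring
    have hall : d + 2 ≤ ∑ i, k i := by
      by_contra hcon
      apply hlarge
      have h1 := two_mul_sum_choose_le hk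
      have h2 := two_mul_choose_two (d + 1)
      have h3 : (m + 1) * ∑ i, k i ≤ (m + 1) * (d + 2) := Nat.mul_le_mul_left _ (by omega)
      have h4 : (m + 1) * 3 ≤ d + 3 := by nlinarith
      have h5 : (d + 2) * ((m + 1) * 3) ≤ (d + 2) * (d + 3) := Nat.mul_le_mul_left _ h4
      rw [chi]
      zify at h1 h2 h3 h5
      push_cast
      linarith
    have hsplit := Finset.sum_add_sum_compl B k
    obtain ⟨A, hA, hA1, hA2, hA3⟩ := exists_subset_sum_lt hm hk Bᶜ
      (n := d + 2 - ∑ i ∈ B, k i) (by omega)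
    have hdisj : Disjoint B A := Finset.disjoint_right.2 fun i hi => by simpa using hA hi
    have hsum : ∑ i ∈ B ∪ A, k i = ∑ i ∈ B, k i + ∑ i ∈ A, k i := Finset.sum_union hdisj
    have hdiff : (B ∪ A) \ B = A := by rw [Finset.union_sdiff_left, hdisj.symm.sdiff_eq_left]
    have hAm : ∑ i ∈ A, k i ≤ A.card * m := Finset.sum_le_card_nsmul _ _ _ fun i _ => hk i
    have hAcard : 3 * m ≤ A.card := by
      by_contra h
      have h1 : A.card * m + m ≤ 3 * m * m := by
        rw [← Nat.succ_mul]; exact Nat.mul_le_mul_right _ (by omega)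
      have h2 : 3 * m * m = 3 * m ^ 2 := by ring
      omega
    have hact := sum_res_add_card (B ∪ A) k
    have hactm := sum_le_card_mul hk (B ∪ A)
    have hAact : A.card ≤ ((B ∪ A).filter fun i => k i ≠ 0).card :=
      Finset.card_le_card fun i hi => Finset.mem_filter.2
        ⟨Finset.mem_union_right _ hi, Nat.one_le_iff_ne_zero.1 (hA1 i hi)⟩
    set act := ((B ∪ A).filter fun i => k i ≠ 0).card
    have hactge : 3 * m ^ 2 + m ≤ act := by
      by_contra h
      have h1 : act * m ≤ (3 * m ^ 2 + m) * m := Nat.mul_le_mul_right _ (by omega)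
      have h2 : (3 * m ^ 2 + m) * m = 3 * m ^ 3 + m ^ 2 := by ring
      omega
    obtain ⟨n, hn⟩ := Nat.exists_eq_add_of_le (show d + 1 ≤ ∑ i ∈ B ∪ A, k i by omega)
    have hchi' := chi_succ d (B ∪ A) k
    have hn' : ∑ i ∈ B ∪ A, (k i : ℤ) = d + 1 + n := by exact_mod_cast hn
    rw [hn'] at hchi'
    have hn1 : 1 ≤ n := by omega
    have hnm : n ≤ m := by omega
    have hres : ∑ i ∈ B ∪ A, res (B ∪ A) k i + 3 * m ^ 2 ≤ d + 1 := by omega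
    obtain ⟨x, y, G, hG⟩ := ih (k := res (B ∪ A) k) (B := B ∪ A) (fun i => (res_le i).trans (hk i))
      (by linarith [(show (1 : ℤ) ≤ n by exact_mod_cast hn1)]) hres
    have hs := smallSys_of_overfill (K := m) (d := d) (k := res (B ∪ A) k) (B := B ∪ A) (T := A) hm
      (fun i => (res_le i).trans (hk i)) Finset.subset_union_right (by omega) (by
        have h2 : m * (m ^ 2 + m + m + 2) = m ^ 3 + 2 * m ^ 2 + 2 * m := by ring
        omega)
    refine hG.exists_overshoot Finset.subset_union_left (by rw [hdiff]; exact hs) ?_ hn1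
      (fun i hi => hA1 i (hdiff ▸ hi)) hn (by omega)
    rw [max_add, max_le_iff]
    constructor
    · have : (3 * m + m + n : ℤ) ≤ A.card + m + m := by
        have : 3 * m + m + n ≤ A.card + m + m := by omega
        exact_mod_cast this
      linarith
    · have h1 : (3 * m ^ 3 + 2).choose 2 + n ≤ roomChi m := by
        rw [roomChi]
        exact (Nat.add_le_add_left hnm _).trans (Nat.le_add_right _ _)
      zify at h1
      have : (1 : ℤ) ≤ n := by exact_mod_cast hn1
      linarith

theorem exists_affine_eval_ne_zero {d : ℕ} {F : MvPolynomial (Fin 3) ℂ} (hF : F.IsHomogeneous d)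
    (h0 : F ≠ 0) (s : Finset ℂ) :
    ∃ ξ η : ℂ, ξ ∉ s ∧ η ≠ 0 ∧ eval ![ξ, η, 1] F ≠ 0 := by
  have hP : F * X 2 * X 1 * ∏ a ∈ s, (X 0 - C a * X 2) ≠ 0 := by
    refine mul_ne_zero (mul_ne_zero (mul_ne_zero h0 (X_ne_zero _)) (X_ne_zero _))
      (Finset.prod_ne_zero_iff.2 fun a _ h => ?_)
    have := congrArg (eval ![1, 0, 0]) h
    simp at this
  obtain ⟨Q, hQ⟩ : ∃ Q, eval Q (F * X 2 * X 1 * ∏ a ∈ s, (X 0 - C a * X 2)) ≠ 0 := by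
    by_contra! h
    exact hP (MvPolynomial.funext fun Q => by rw [h Q, map_zero])
  simp only [map_mul, eval_X, map_prod, map_sub, eval_C, mul_ne_zero_iff, Finset.prod_ne_zero_iff]
    at hQ
  obtain ⟨⟨⟨h1, h2⟩, h3⟩, h4⟩ := hQ
  have h5 : Q = Q 2 • ![Q 0 / Q 2, Q 1 / Q 2, 1] := by
    funext j
    fin_cases j <;> simp [mul_div_cancel₀, h2]
  refine ⟨Q 0 / Q 2, Q 1 / Q 2, fun h => h4 _ h ?_, div_ne_zero h3 h2, fun h => h1 ?_⟩
  · rw [div_mul_cancel₀ _ h2, sub_self]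
  · rw [h5, hF.eval_smul, h, mul_zero]

section
variable {ι : Type*} [Fintype ι] [DecidableEq ι] {d : ℕ} {k k' : ι → ℕ} {B T : Finset ι}

theorem SmallSys.add_point {D : ℕ} (h : SmallSys d k B T (D + 1 : ℕ)) (hT : T ⊆ B) {j : ι}
    (hj : j ∉ B)
    (hkj : k j = 0) (hkj' : k' j ≠ 0) (hkk : ∀ i ≠ j, k' i = k i) : SmallSys d k' B T D := by
  obtain ⟨x, y, hx, hB, hle⟩ := h
  obtain ⟨F, hF, hF0⟩ : ∃ F : MvPolynomial (Fin 3) ℂ, F.IsHomogeneous d ∧ F ≠ 0 ∧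
      (sys d x y (tang k T) ≠ ⊥ → F ∈ sys d x y (tang k T)) := by
    by_cases hS : sys d x y (tang k T) = ⊥
    · exact ⟨X 0 ^ d, by simpa using (isHomogeneous_X ℂ (0 : Fin 3)).pow d,
        pow_ne_zero _ (X_ne_zero _), fun h => absurd hS h⟩
    · obtain ⟨F, hF, h0⟩ := Submodule.exists_mem_ne_zero_of_ne_bot hS
      exact ⟨F, sys_le _ _ _ _ hF, h0, fun _ => hF⟩
  obtain ⟨ξ, η, hξ, hη, hev⟩ := exists_affine_eval_ne_zero hF hF0.1 (Finset.univ.image x)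
  have hjT : j ∉ T := fun h => hj (hT h)
  have hle' : sys d (Function.update x j ξ) (Function.update y j η) (tang k' T) ≤
      sys d x y (tang k T) := by
    intro G hG
    rw [mem_sys] at hG ⊢
    refine ⟨hG.1, fun i e he => ?_⟩
    by_cases hi : i = j
    · subst hi
      rw [tang, if_neg hjT, hkj, mem_fatSet] at he
      exact absurd he (Nat.not_lt_zero _)
    · have := hG.2 i e (by rw [tang, hkk i hi]; exact he)
      rwa [Function.update_of_ne hi, Function.update_of_ne hi] at this
  refine ⟨Function.update x j ξ, Function.update y j η, fun a b hab => ?_, fun i => ?_, ?_⟩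
  · have hxξ : ∀ i, x i ≠ ξ := fun i h => hξ (Finset.mem_image.2 ⟨i, Finset.mem_univ _, h⟩)
    by_cases ha : a = j <;> by_cases hb : b = j
    · rw [ha, hb]
    · subst ha
      rw [Function.update_self, Function.update_of_ne hb] at hab
      exact absurd hab.symm (hxξ b)
    · subst hb
      rw [Function.update_self, Function.update_of_ne ha] at hab
      exact absurd hab (hxξ a)
    · rw [Function.update_of_ne ha, Function.update_of_ne hb] at hab
      exact hx hab
  · by_cases hi : i = j
    · subst hi
      rw [Function.update_self]
      exact iff_of_false hη hj
    · rw [Function.update_of_ne hi]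
      exact hB i
  · by_cases hS : sys d x y (tang k T) = ⊥
    · rw [hS, le_bot_iff] at hle'
      rw [hle', finrank_bot]
      positivity
    · have hlt := lt_of_le_of_ne hle' fun heq => hev <| by
        have h1 := hF0.2 hS
        rw [← heq, mem_sys] at h1
        have h2 := h1.2 j 0 (by
          rw [tang, if_neg hjT, mem_fatSet]; simpa using Nat.pos_of_ne_zero hkj')
        rw [Function.update_self, Function.update_self, ← constantCoeff_eq, ← eval_zero,
          eval_loc] at h2
        simpa using h2
      have := Submodule.finrank_lt_finrank_of_lt hlt
      push_cast at hle
      zify at this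
      linarith

theorem SmallSys.add_points {D : ℕ} (hT : T ⊆ B) {Z : Finset ι} (hZ : ∀ j ∈ Z, j ∉ B ∧ k j ≠ 0)
    (h : SmallSys d (fun i => if i ∈ Z then 0 else k i) B T (D + Z.card : ℕ)) :
    SmallSys d k B T D := by
  induction Z using Finset.induction_on with
  | empty => simpa using h
  | insert j Z hjZ ih =>
    refine ih (fun i hi => hZ i (Finset.mem_insert_of_mem hi)) ?_
    rw [Finset.card_insert_of_notMem hjZ, ← add_assoc] at h
    obtain ⟨hj, hkj⟩ := hZ j (Finset.mem_insert_self _ _)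
    refine h.add_point hT hj (if_pos (Finset.mem_insert_self _ _)) (by rwa [if_neg hjZ])
      fun i hi => ?_
    simp [hi]

theorem chi_zero_on (d : ℕ) (k : ι → ℕ) (Z : Finset ι) :
    chi d (fun i => if i ∈ Z then 0 else k i) = chi d k + ∑ i ∈ Z, ((k i + 1).choose 2 : ℤ) := by
  have h : ∀ i, ((k i + 1).choose 2 : ℤ) = (((if i ∈ Z then 0 else k i) + 1).choose 2 : ℤ) +
      if i ∈ Z then ((k i + 1).choose 2 : ℤ) else 0 := by
    intro i
    split_ifs <;> simp
  rw [chi, chi, Finset.sum_congr rfl fun i _ => h i, Finset.sum_add_distrib, Finset.sum_ite_mem,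
    Finset.univ_inter]
  ring

end

/-- Degree from which every configuration can be treated. -/
def mainDeg (m : ℕ) : ℕ :=
  roomDeg m + 1 + m * (3 * roomChi m + 3 * m + (3 * m ^ 3 + 2).choose 2 * m ^ 2 + 3 * m ^ 2 + 2) +
    2 * (m ^ 2 + 1) * (roomChi m + m + (3 * m ^ 3 + 2).choose 2 + 1)

theorem choose_two_le_sq {m n : ℕ} (h : n ≤ m) : (n + 1).choose 2 ≤ m ^ 2 := by
  refine (Nat.choose_le_choose 2 (Nat.succ_le_succ h)).trans ?_
  rw [Nat.choose_two_right, Nat.succ_eq_add_one, Nat.add_sub_cancel]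
  exact Nat.div_le_of_le_mul (by nlinarith)

theorem exists_good {ι : Type*} [Fintype ι] [DecidableEq ι] {m : ℕ} (hm : 1 ≤ m) {d : ℕ}
    {k : ι → ℕ} (hk1 : ∀ i, 1 ≤ k i) (hk : ∀ i, k i ≤ m) (hd : mainDeg m ≤ d) (hchi : 1 ≤ chi d k) :
    ∃ x y F, Good d k ∅ x y F := by
  have hm2 : m ≤ m ^ 2 := Nat.le_self_pow two_ne_zero m
  have hroom : 3 * m ^ 2 ≤ roomDeg m := by
    rw [roomDeg]
    nlinarith
  rw [mainDeg] at hd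
  generalize hW : (3 * m ^ 3 + 2).choose 2 = W at hd
  generalize hW1 : roomChi m = W1 at hd
  by_cases hlarge : (W1 : ℤ) ≤ chi d k
  · exact exists_good_of_room hm hk (by omega) (hW1 ▸ hlarge) (by rw [Finset.sum_empty]; omega)
  push Not at hlarge
  obtain ⟨d, rfl⟩ : ∃ d', d = d' + 1 := Nat.exists_eq_add_one.2 (by omega)
  have hd1 : m * (3 * W1 + 3 * m + W * m ^ 2 + 3 * m ^ 2 + 2) ≤ d := by omega
  have hd2 : 2 * (m ^ 2 + 1) * (W1 + m + W + 1) ≤ d + 1 := by omega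
  have hcard : d + 1 + W1 + m + W ≤ Fintype.card ι := by
    by_contra hcon
    have h1 : ∑ i, (k i + 1).choose 2 ≤ Fintype.card ι * m ^ 2 := by
      refine (Finset.sum_le_card_nsmul _ _ _ fun i _ => choose_two_le_sq (hk i)).trans ?_
      simp
    have h2 : Fintype.card ι * m ^ 2 ≤ (d + 1 + W1 + m + W) * m ^ 2 :=
      Nat.mul_le_mul_right _ (by omega)
    have h3 := two_mul_choose_two (d + 1)
    rw [chi] at hlarge
    have h4 : (d + 1 + 2).choose 2 < W1 + ∑ i, (k i + 1).choose 2 := by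
      zify
      linarith
    have h5 : (d + 1) * (2 * (m ^ 2 + 1) * (W1 + m + W + 1)) ≤ (d + 1) * (d + 1) :=
      Nat.mul_le_mul_left _ hd2
    nlinarith
  have hsumall : Fintype.card ι ≤ ∑ i, k i := by
    simpa using Finset.card_nsmul_le_sum Finset.univ k 1 fun i _ => hk1 i
  obtain ⟨A, -, -, hA2, hA3⟩ := exists_subset_sum_lt hm hk Finset.univ (n := d + 1 + 1 + W1)
      (by omega)
  have hAm : ∑ i ∈ A, k i ≤ A.card * m := Finset.sum_le_card_nsmul _ _ _ fun i _ => hk i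
  have hA1 : A.card ≤ ∑ i ∈ A, k i := by
    simpa using Finset.card_nsmul_le_sum A k 1 fun i _ => hk1 i
  have hact := sum_res_add_card A k
  rw [Finset.filter_true_of_mem fun i _ => Nat.one_le_iff_ne_zero.1 (hk1 i)] at hact
  have hAcard : 3 * W1 + 3 * m + W * m ^ 2 + 3 * m ^ 2 + 2 ≤ A.card := by
    by_contra hcon
    have := Nat.mul_le_mul_right m (not_le.1 hcon).le
    rw [mul_comm m] at hd1
    omega
  obtain ⟨Z, hZ, hZcard⟩ := Finset.exists_subset_card_eq (s := Aᶜ) (n := W) (by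
    rw [Finset.card_compl]; omega)
  have hZA : ∀ i ∈ Z, i ∉ A := fun i hi => by simpa using hZ hi
  obtain ⟨n, hn⟩ := Nat.exists_eq_add_of_le (show d + 1 ≤ ∑ i ∈ A, k i by omega)
  have hchi' := chi_succ d A k
  have hn' : ∑ i ∈ A, (k i : ℤ) = d + 1 + n := by exact_mod_cast hn
  rw [hn'] at hchi'
  have hn1 : (W1 : ℤ) + 1 ≤ n := by
    have : W1 + 1 ≤ n := by omega
    exact_mod_cast this
  have hnm : (n : ℤ) ≤ W1 + m := by
    have : n ≤ W1 + m := by omega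
    exact_mod_cast this
  obtain ⟨x, y, G, hG⟩ := exists_good_of_room (d := d) (k := res A k) (B := A) hm
    (fun i => (res_le i).trans (hk i)) (by omega) (by rw [hW1]; linarith) (by omega)
  have hle : ∀ i, (if i ∈ Z then 0 else res A k i) ≤ res A k i := fun i => by split_ifs <;> omega
  have hs := smallSys_of_overfill (d := d) (K := W1 + m) (T := A) (B := A)
    (k := fun i => if i ∈ Z then 0 else res A k i) hm
    (fun i => ((hle i).trans (res_le i)).trans (hk i)) subset_rfl (by
      have := Finset.sum_le_sum fun i (_ : i ∈ A) => hle i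
      omega) (le_trans (Nat.mul_le_mul_left _ (by omega)) hd1)
  have hs0 : SmallSys d (res A k) A A (0 : ℕ) := by
    refine SmallSys.add_points subset_rfl (Z := Z) (fun j hj => ⟨hZA j hj, ?_⟩) (hs.mono ?_)
    · rw [res_off (hZA j hj)]; exact Nat.one_le_iff_ne_zero.1 (hk1 j)
    · rw [hW, zero_add, hZcard, max_le_iff]
      refine ⟨?_, le_rfl⟩
      rw [chi_zero_on]
      have h1 : ∑ i ∈ Z, (res A k i + 1).choose 2 ≤ W * m ^ 2 := by
        rw [← hZcard]
        exact Finset.sum_le_card_nsmul _ _ _ fun i _ => choose_two_le_sq ((res_le i).trans (hk i))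
      zify at h1 hAcard
      push_cast
      have : (0 : ℤ) ≤ (m : ℤ) ^ 2 := by positivity
      linarith [W.cast_nonneg (α := ℤ)]
  exact hG.exists_overshoot (Finset.empty_subset _) (by rw [Finset.sdiff_empty]; exact hs0)
    (by push_cast; linarith) (by omega) (fun i _ => hk1 i) hn (by omega)

theorem pderiv_comm {σ R : Type*} [CommRing R] (i j : σ) (f : MvPolynomial σ R) :
    pderiv i (pderiv j f) = pderiv j (pderiv i f) := by
  classical
  have h : ⁅(pderiv i : Derivation R (MvPolynomial σ R) (MvPolynomial σ R)), pderiv j⁆ = 0 :=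
    MvPolynomial.derivation_ext fun k => by
      rw [Derivation.commutator_apply]
      by_cases hi : k = i <;> by_cases hj : k = j <;> simp [pderiv_X, Pi.single_apply, hi, hj]
      <;> split_ifs <;> simp
  have := congrArg (fun D => D f) h
  rw [Derivation.commutator_apply] at this
  exact sub_eq_zero.1 this

theorem iterate_pderiv_comm {σ R : Type*} [CommRing R] (i j : σ) (n : ℕ) (f : MvPolynomial σ R) :
    pderiv i ((pderiv j)^[n] f) = (pderiv j)^[n] (pderiv i f) :=
  (Function.Commute.iterate_right (f := pderiv i) (g := pderiv j) (pderiv_comm i j) n) f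

theorem MvPolynomial.IsHomogeneous.iterate_pderiv {σ R : Type*} [CommRing R] {f : MvPolynomial σ R}
    {d : ℕ} (hf : f.IsHomogeneous d) (i : σ) (n : ℕ) :
    ((pderiv i)^[n] f).IsHomogeneous (d - n) := by
  induction n with
  | zero => exact hf
  | succ n ih =>
    rw [Function.iterate_succ_apply']
    exact ih.pderiv

theorem exists_coeff_iterate_pderiv {σ : Type*} (i : σ) (n : ℕ) :
    ∀ e : σ →₀ ℕ, ∃ c : ℂ, c ≠ 0 ∧ ∀ f : MvPolynomial σ ℂ,
      coeff e ((pderiv i)^[n] f) = c * coeff (e + Finsupp.single i n) f := by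
  induction n with
  | zero => exact fun e => ⟨1, one_ne_zero, fun f => by simp⟩
  | succ n ih =>
    intro e
    obtain ⟨c, hc, h⟩ := ih (e + Finsupp.single i 1)
    refine ⟨c * (e i + 1), mul_ne_zero hc (Nat.cast_add_one_ne_zero _), fun f => ?_⟩
    rw [Function.iterate_succ_apply', coeff_pderiv, h, add_assoc, ← Finsupp.single_add,
      add_comm 1 n]
    simp; ring

theorem diffOp_apply (k : Fin 3 → ℕ) (F : MvPolynomial (Fin 3) ℂ) :
    diffOp k F = (pderiv 0)^[k 0] ((pderiv 1)^[k 1] ((pderiv 2)^[k 2] F)) := by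
  simp [diffOp, Module.End.pow_apply]

theorem mem_vanishingSubmodule {m : ℕ} {v : Fin 3 → ℂ} {F : MvPolynomial (Fin 3) ℂ} :
    F ∈ vanishingSubmodule m v ↔ ∀ a b c, a + b + c < m →
      eval v ((pderiv 0)^[a] ((pderiv 1)^[b] ((pderiv 2)^[c] F))) = 0 := by
  simp only [vanishingSubmodule, Submodule.mem_iInf, Set.mem_ofPred_eq, LinearMap.mem_ker,
    LinearMap.comp_apply, diffOp_apply]
  constructor
  · intro h a b c habc
    have := h ![a, b, c] habc
    simpa [aeval_eq_eval] using this
  · intro h k hk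
    have := h _ _ _ hk
    simpa [aeval_eq_eval] using this

theorem iterate_pderiv_loc (x y : ℂ) (F : MvPolynomial (Fin 3) ℂ) (j : Fin 2) (n : ℕ) :
    (pderiv j)^[n] (loc x y F) = loc x y ((pderiv j.castSucc)^[n] F) :=
  ((Function.Semiconj.iterate_right (f := loc x y) (ga := pderiv j.castSucc) (gb := pderiv j)
    (fun F => (pderiv_loc x y F j).symm) n) F).symm

theorem fatAt_iff_derivatives {k : ℕ} {x y : ℂ} {F : MvPolynomial (Fin 3) ℂ} : FatAt k x y F ↔
    ∀ a b, a + b < k → eval ![x, y, 1] ((pderiv 0)^[a] ((pderiv 1)^[b] F)) = 0 := by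
  have key : ∀ a b, ∃ c : ℂ, c ≠ 0 ∧ eval ![x, y, 1] ((pderiv 0)^[a] ((pderiv 1)^[b] F)) =
      c * coeff (Finsupp.single 0 a + Finsupp.single 1 b) (loc x y F) := by
    intro a b
    obtain ⟨c, hc, h⟩ := exists_coeff_iterate_pderiv (0 : Fin 2) a 0
    obtain ⟨c', hc', h'⟩ := exists_coeff_iterate_pderiv (1 : Fin 2) b (0 + Finsupp.single 0 a)
    refine ⟨c * c', mul_ne_zero hc hc', ?_⟩
    have h1 := eval_loc x y ((pderiv 0)^[a] ((pderiv 1)^[b] F)) 0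
    rw [show ![(0 : Fin 2 → ℂ) 0 + x, (0 : Fin 2 → ℂ) 1 + y, 1] = ![x, y, 1] by simp] at h1
    rw [← h1, eval_zero, constantCoeff_eq]
    have h2 := iterate_pderiv_loc x y ((pderiv 1)^[b] F) 0 a
    have h3 := iterate_pderiv_loc x y F 1 b
    rw [show Fin.castSucc (0 : Fin 2) = 0 from rfl] at h2
    rw [show Fin.castSucc (1 : Fin 2) = 1 from rfl] at h3
    rw [← h2, h, ← h3, h', mul_assoc, zero_add]
  constructor
  · intro h a b hab
    obtain ⟨c, -, h1⟩ := key a b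
    rw [h1, h _ (by simpa [map_add, Finsupp.degree_single] using hab), mul_zero]
  · intro h e he
    obtain ⟨c, hc, h1⟩ := key (e 0) (e 1)
    have he' : Finsupp.single 0 (e 0) + Finsupp.single 1 (e 1) = e := by
      ext j
      fin_cases j <;> simp
    rw [he', h _ _ (by simpa [Finsupp.degree_eq_sum, Fin.sum_univ_two] using he)] at h1
    exact (mul_eq_zero.1 h1.symm).resolve_left hc

theorem mem_vanishingSubmodule_iff_fatAt {d m : ℕ} {v : Fin 3 → ℂ} (hv : v 2 ≠ 0)
    {F : MvPolynomial (Fin 3) ℂ} (hF : F.IsHomogeneous d) :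
    F ∈ vanishingSubmodule m v ↔ FatAt m (v 0 / v 2) (v 1 / v 2) F := by
  have hv' : v = v 2 • ![v 0 / v 2, v 1 / v 2, 1] := by
    funext j
    fin_cases j <;> simp [mul_div_cancel₀, hv]
  have hev : ∀ {G : MvPolynomial (Fin 3) ℂ} {e : ℕ}, G.IsHomogeneous e →
      (eval v G = 0 ↔ eval ![v 0 / v 2, v 1 / v 2, 1] G = 0) := by
    intro G e hG
    conv_lhs => rw [hv', hG.eval_smul]
    simp [hv]
  rw [mem_vanishingSubmodule, fatAt_iff_derivatives]
  constructor
  · intro h a b hab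
    exact (hev ((hF.iterate_pderiv 1 b).iterate_pderiv 0 a)).1 (h a b 0 hab)
  · intro h a b c
    induction c generalizing a b with
    | zero => exact fun hab => (hev ((hF.iterate_pderiv 1 b).iterate_pderiv 0 a)).2 (h a b hab)
    | succ c ih =>
      intro hab
      have h0 := ih (a + 1) b (by omega)
      have h1 := ih a (b + 1) (by omega)
      have h2 := ih a b (by omega)
      have hE := (((hF.iterate_pderiv 2 c).iterate_pderiv 1 b).iterate_pderiv
        0 a).sum_mul_eval_pderiv v
      rw [Function.iterate_succ_apply'] at h0
      rw [Function.iterate_succ_apply' _ b] at h1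
      rw [h2, mul_zero, Fin.sum_univ_three, h0, iterate_pderiv_comm 1, h1, iterate_pderiv_comm 2,
        iterate_pderiv_comm 2] at hE
      rw [Function.iterate_succ_apply' _ c]
      simpa [hv] using hE

theorem Lspace_eq_sys {d r : ℕ} (P : Fin r → Proj2) (mi : Fin r → ℕ) (hP : ∀ i, (P i).rep 2 ≠ 0) :
    Lspace d P mi = sys d (fun i => (P i).rep 0 / (P i).rep 2)
      (fun i => (P i).rep 1 / (P i).rep 2) (fats mi) := by
  ext F
  rw [mem_sys_fats, Lspace, Submodule.mem_inf, mem_homogeneousSubmodule, Submodule.mem_iInf]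
  exact and_congr_right fun hF =>
    forall_congr' fun i => mem_vanishingSubmodule_iff_fatAt (hP i) hF

theorem exists_eval_line {τ : Type*} (b : MvPolynomial τ ℂ) (w₀ w₁ : τ → ℂ) :
    ∃ g : Polynomial ℂ, ∀ t, g.eval t = eval (fun i => w₀ i + t * (w₁ i - w₀ i)) b := by
  refine ⟨aeval (fun i => Polynomial.C (w₀ i) + Polynomial.X * Polynomial.C (w₁ i - w₀ i)) b,
    fun t => ?_⟩
  have h1 : (Polynomial.evalRingHom t).comp (aeval (fun i => Polynomial.C (w₀ i) + Polynomial.X *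
      Polynomial.C (w₁ i - w₀ i)) : MvPolynomial τ ℂ →ₐ[ℂ] Polynomial ℂ).toRingHom =
      eval (fun i => w₀ i + t * (w₁ i - w₀ i)) := by
    refine MvPolynomial.ringHom_ext (fun c => ?_) fun i => ?_
    · simp [algHom_C]
    · simp
  exact congrArg (fun φ => φ b) h1

theorem frequently_eval_ne_zero {τ : Type*} [Finite τ] {b : MvPolynomial τ ℂ} (hb : b ≠ 0)
    (w₀ : τ → ℂ) : ∃ᶠ w in 𝓝 w₀, eval w b ≠ 0 := by
  obtain ⟨w₁, hw₁⟩ : ∃ w, eval w b ≠ 0 := by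
    by_contra! h
    exact hb (MvPolynomial.funext fun Q => by rw [h Q, map_zero])
  obtain ⟨g, hg⟩ := exists_eval_line b w₀ w₁
  have hg0 : g ≠ 0 := fun h => hw₁ <| by
    have := hg 1
    rw [h, Polynomial.eval_zero] at this
    rw [this]
    simp
  have hlim : Tendsto (fun t : ℂ => fun i => w₀ i + t * (w₁ i - w₀ i)) (𝓝[≠] 0) (𝓝 w₀) := by
    refine Tendsto.mono_left ?_ nhdsWithin_le_nhds
    have : Continuous fun t : ℂ => fun i => w₀ i + t * (w₁ i - w₀ i) := by fun_prop
    simpa using this.tendsto 0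
  exact hlim.frequently (((eventually_eval_ne_zero hg0 0).mono fun t ht => by
    rwa [← hg]).frequently)

/-- A condition on `w` expressing that a system of polynomial equations with coefficients depending
polynomially on `w` has no solution is generically true if it holds on an open set. -/
theorem exists_generic {τ σ : Type*} [Finite τ] [Finite σ] {w₀ : τ → ℂ}
    (S : Set (MvPolynomial σ (MvPolynomial τ ℂ)))
    (hS : ∀ᶠ w in 𝓝 w₀, ∀ z, ∃ f ∈ S, eval₂ (eval w) z f ≠ 0) :
    ∃ a : MvPolynomial τ ℂ, a ≠ 0 ∧ ∀ w, eval w a ≠ 0 → ∀ z, ∃ f ∈ S, eval₂ (eval w) z f ≠ 0 := by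
  rcases exists_elim (FractionRing (MvPolynomial τ ℂ))
    (AlgebraicClosure (FractionRing (MvPolynomial τ ℂ))) S with ⟨y, hy⟩ | ⟨a, ha, haS⟩
  · exfalso
    obtain ⟨b, hb, h⟩ := exists_specialization (A := MvPolynomial τ ℂ)
        (FractionRing (MvPolynomial τ ℂ))
      (AlgebraicClosure (FractionRing (MvPolynomial τ ℂ))) y
    obtain ⟨w, hw, hw'⟩ := ((frequently_eval_ne_zero hb w₀).and_eventually hS).exists
    obtain ⟨z, hz⟩ := h (eval w) (fun c => ⟨C c, eval_C c⟩) hw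
    obtain ⟨f, hf, hne⟩ := hw' z
    exact hne (hz f (hy f hf))
  · refine ⟨a, ha, fun w hw z => ?_⟩
    by_contra! h
    have : Ideal.span S ≤ RingHom.ker (eval₂Hom (eval w) z) :=
      Ideal.span_le.2 fun f hf => h f hf
    have := this haS
    rw [RingHom.mem_ker, coe_eval₂Hom, eval₂_C] at this
    exact hw this

theorem eval₂_rename_eq {τ σ κ : Type*} (g : κ → σ) (w : τ → ℂ) (z : σ → ℂ)
    (P : MvPolynomial κ (MvPolynomial τ ℂ)) :
    eval₂ (eval w) z (rename g P) = eval (fun i => z (g i)) (map (eval w) P) := by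
  rw [eval₂_rename, eval_map]
  rfl

theorem map_homogeneousComponent {σ R S : Type*} [CommRing R] [CommRing S] (φ : R →+* S) (n : ℕ)
    (f : MvPolynomial σ R) :
    map φ (homogeneousComponent n f) = homogeneousComponent n (map φ f) := by
  ext e
  rw [coeff_map, coeff_homogeneousComponent, coeff_homogeneousComponent, coeff_map]
  split_ifs <;> simp

section
variable {τ ι : Type*} [Finite τ] {w₀ : τ → ℂ} {F : MvPolynomial (Fin 3) (MvPolynomial τ ℂ)}
  {x y : ι → MvPolynomial τ ℂ} {k : ι → ℕ}

theorem exists_generic_smooth [Finite ι] [Nonempty ι] (hk : ∀ i, 1 ≤ k i)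
    (h : ∀ᶠ w in 𝓝 w₀, Nice k (fun i => eval w (x i)) (fun i => eval w (y i)) (map (eval w) F)) :
    ∃ a : MvPolynomial τ ℂ, a ≠ 0 ∧ ∀ w, eval w a ≠ 0 → ∀ Q : Fin 3 → ℂ,
      (∀ j, eval Q (pderiv j (map (eval w) F)) = 0) →
        ∃ i, 1 ≤ k i ∧ ∃ c : ℂ, Q = c • ![eval w (x i), eval w (y i), 1] := by
  let S : Set (MvPolynomial (Fin 3 ⊕ ι ⊕ ι) (MvPolynomial τ ℂ)) :=
    (Set.range fun j => rename Sum.inl (pderiv j F)) ∪ Set.range fun i =>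
      X (Sum.inr (Sum.inl i)) * (X (Sum.inl 0) - C (x i) * X (Sum.inl 2)) +
      X (Sum.inr (Sum.inr i)) * (X (Sum.inl 1) - C (y i) * X (Sum.inl 2)) - 1
  have hgrad : ∀ w j z, eval₂ (eval w) z (rename Sum.inl (pderiv j F) :
      MvPolynomial (Fin 3 ⊕ ι ⊕ ι) (MvPolynomial τ ℂ)) =
      eval (fun i => z (Sum.inl i)) (pderiv j (map (eval w) F)) := by
    intro w j z
    rw [eval₂_rename_eq, pderiv_map]
  have hoff : ∀ w i z, eval₂ (eval w) z (X (Sum.inr (Sum.inl i)) * (X (Sum.inl 0) - C (x i) *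
      X (Sum.inl 2)) + X (Sum.inr (Sum.inr i)) * (X (Sum.inl 1) - C (y i) * X (Sum.inl 2)) - 1 :
      MvPolynomial (Fin 3 ⊕ ι ⊕ ι) (MvPolynomial τ ℂ)) =
      z (Sum.inr (Sum.inl i)) * (z (Sum.inl 0) - eval w (x i) * z (Sum.inl 2)) +
      z (Sum.inr (Sum.inr i)) * (z (Sum.inl 1) - eval w (y i) * z (Sum.inl 2)) - 1 := by
    intro w i z
    simp [eval₂_mul, eval₂_add, eval₂_sub]
  obtain ⟨a, ha, hS⟩ := exists_generic (w₀ := w₀) S <| h.mono fun w hw z => by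
    by_contra! hcon
    have h1 : ∀ j, eval (fun i => z (Sum.inl i)) (pderiv j (map (eval w) F)) = 0 := fun j => by
      rw [← hgrad]; exact hcon _ (Or.inl ⟨j, rfl⟩)
    have h2 := fun i => (hoff w i z).symm.trans (hcon _ (Or.inr ⟨i, rfl⟩))
    have hQ : (fun i : Fin 3 => z (Sum.inl i)) ≠ 0 := fun h0 => by
      have h3 : ∀ j, z (Sum.inl j) = 0 := congrFun h0
      obtain ⟨i⟩ := ‹Nonempty ι›
      simpa [h3] using h2 i
    obtain ⟨i, -, c, hc⟩ := hw.smooth _ hQ h1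
    have h3 : ∀ j, z (Sum.inl j) = c * ![eval w (x i), eval w (y i), 1] j := congrFun hc
    have := h2 i
    simp only [h3] at this
    simp [mul_comm] at this
  refine ⟨a, ha, fun w hw Q hQ => ?_⟩
  by_contra! hcon
  have : ∀ i, ∃ s t : ℂ, s * (Q 0 - eval w (x i) * Q 2) + t * (Q 1 - eval w (y i) * Q 2) - 1 = 0 :=
      by
    intro i
    by_cases h0 : Q 0 - eval w (x i) * Q 2 = 0
    · by_cases h1 : Q 1 - eval w (y i) * Q 2 = 0
      · refine absurd ?_ (hcon i (hk i) (Q 2))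
        funext j
        fin_cases j
        · simpa [mul_comm] using sub_eq_zero.1 h0
        · simpa [mul_comm] using sub_eq_zero.1 h1
        · simp
      · exact ⟨0, (Q 1 - eval w (y i) * Q 2)⁻¹, by rw [inv_mul_cancel₀ h1]; ring⟩
    · exact ⟨(Q 0 - eval w (x i) * Q 2)⁻¹, 0, by rw [inv_mul_cancel₀ h0]; ring⟩
  choose s t hst using this
  obtain ⟨f, ⟨j, rfl⟩ | ⟨i, rfl⟩, hf⟩ := hS w hw (Sum.elim Q (Sum.elim s t))
  · rw [hgrad] at hf
    exact hf (hQ j)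
  · rw [hoff] at hf
    exact hf (hst i)

theorem exists_generic_cone (hk : ∀ i, 1 ≤ k i)
    (h : ∀ᶠ w in 𝓝 w₀, Nice k (fun i => eval w (x i)) (fun i => eval w (y i)) (map (eval w) F))
    (i : ι) : ∃ a : MvPolynomial τ ℂ, a ≠ 0 ∧ ∀ w, eval w a ≠ 0 →
      ReducedCone (k i) (eval w (x i)) (eval w (y i)) (map (eval w) F) := by
  let S : Set (MvPolynomial (Fin 2 ⊕ Fin 2) (MvPolynomial τ ℂ)) :=
    (Set.range fun j => rename Sum.inl (pderiv j (homogeneousComponent (k i) (loc (x i) (y i) F))))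
        ∪
      {X (Sum.inr 0) * X (Sum.inl 0) + X (Sum.inr 1) * X (Sum.inl 1) - 1}
  have hgrad : ∀ w j z, eval₂ (eval w) z (rename Sum.inl
      (pderiv j (homogeneousComponent (k i) (loc (x i) (y i) F))) :
      MvPolynomial (Fin 2 ⊕ Fin 2) (MvPolynomial τ ℂ)) = eval (fun i => z (Sum.inl i)) (pderiv j
        (homogeneousComponent (k i) (loc (eval w (x i)) (eval w (y i)) (map (eval w) F)))) := by
    intro w j z
    rw [eval₂_rename_eq, ← pderiv_map, map_homogeneousComponent, map_loc]
  have hone : ∀ w z, eval₂ (eval w) z (X (Sum.inr 0) * X (Sum.inl 0) + X (Sum.inr 1) * X (Sum.inl 1)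
      - 1 : MvPolynomial (Fin 2 ⊕ Fin 2) (MvPolynomial τ ℂ)) =
      z (Sum.inr 0) * z (Sum.inl 0) + z (Sum.inr 1) * z (Sum.inl 1) - 1 := by
    intro w z
    simp [eval₂_mul, eval₂_add, eval₂_sub]
  obtain ⟨a, ha, hS⟩ := exists_generic (w₀ := w₀) S <| h.mono fun w hw z => by
    by_contra! hcon
    have h2 := (hone w z).symm.trans (hcon _ (Or.inr rfl))
    have hv : (fun i : Fin 2 => z (Sum.inl i)) ≠ 0 := fun h0 => by
      have h3 : ∀ j, z (Sum.inl j) = 0 := congrFun h0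
      simp [h3] at h2
    obtain ⟨j, hj⟩ := hw.cone i (hk i) _ hv
    rw [← hgrad] at hj
    exact hj (hcon _ (Or.inl ⟨j, rfl⟩))
  refine ⟨a, ha, fun w hw _ v hv => ?_⟩
  by_contra! hcon
  obtain ⟨s, hs⟩ : ∃ s : Fin 2 → ℂ, s 0 * v 0 + s 1 * v 1 - 1 = 0 := by
    by_cases h0 : v 0 = 0
    · have h1 : v 1 ≠ 0 := fun h1 => hv (by funext j; fin_cases j <;> simp [h0, h1])
      exact ⟨![0, (v 1)⁻¹], by simp [inv_mul_cancel₀ h1]⟩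
    · exact ⟨![(v 0)⁻¹, 0], by simp [inv_mul_cancel₀ h0]⟩
  obtain ⟨f, ⟨j, rfl⟩ | rfl, hf⟩ := hS w hw (Sum.elim v s)
  · rw [hgrad] at hf
    exact hf (hcon j)
  · rw [hone] at hf
    exact hf hs

theorem exists_generic_irreducible {d : ℕ} (hd : d ≠ 0) (hF : F.IsHomogeneous d)
    (h : ∀ᶠ w in 𝓝 w₀, Irreducible (map (eval w) F)) :
    ∃ a : MvPolynomial τ ℂ, a ≠ 0 ∧ ∀ w, eval w a ≠ 0 → Irreducible (map (eval w) F) := by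
  have key : ∀ n : Fin d, ∃ a : MvPolynomial τ ℂ, a ≠ 0 ∧ (1 ≤ n.1 → ∀ w, eval w a ≠ 0 →
      ∀ A B : MvPolynomial (Fin 3) ℂ, A.IsHomogeneous n → B.IsHomogeneous (d - n) →
        map (eval w) F ≠ A * B) := by
    intro n
    by_cases hn : 1 ≤ n.1
    swap
    · exact ⟨1, one_ne_zero, fun h => absurd h hn⟩
    let A₀ : MvPolynomial (Fin 3) (MvPolynomial (Idx n ⊕ Idx (d - n)) (MvPolynomial τ ℂ)) :=
      toPoly _ n (fun e => X (Sum.inl e))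
    let B₀ : MvPolynomial (Fin 3) (MvPolynomial (Idx n ⊕ Idx (d - n)) (MvPolynomial τ ℂ)) :=
      toPoly _ (d - n) (fun e => X (Sum.inr e))
    let S : Set (MvPolynomial (Idx n ⊕ Idx (d - n)) (MvPolynomial τ ℂ)) :=
      Set.range fun e => C (coeff e F) - coeff e (A₀ * B₀)
    have hev : ∀ w z e, eval₂ (eval w) z (C (coeff e F) - coeff e (A₀ * B₀)) =
        coeff e (map (eval w) F) - coeff e (toPoly ℂ n (fun e => z (Sum.inl e)) *
          toPoly ℂ (d - n) (fun e => z (Sum.inr e))) := by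
      intro w z e
      have h1 := map_toPoly (eval₂Hom (eval w) z) (d := n)
        (fun e : Idx n => (X (Sum.inl e) : MvPolynomial (Idx n ⊕ Idx (d - n)) (MvPolynomial τ ℂ)))
      have h2 := map_toPoly (eval₂Hom (eval w) z) (d := d - n)
        (fun e : Idx (d - n) =>
          (X (Sum.inr e) : MvPolynomial (Idx n ⊕ Idx (d - n)) (MvPolynomial τ ℂ)))
      simp only [coe_eval₂Hom, eval₂_X] at h1 h2
      rw [eval₂_sub, eval₂_C, coeff_map, ← h1, ← h2, ← map_mul, coeff_map, coe_eval₂Hom]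
    obtain ⟨a, ha, hS⟩ := exists_generic (w₀ := w₀) S <| h.mono fun w hw z => by
      by_contra! hcon
      have h1 : map (eval w) F = toPoly ℂ n (fun e => z (Sum.inl e)) *
          toPoly ℂ (d - n) (fun e => z (Sum.inr e)) := by
        ext e
        rw [← sub_eq_zero, ← hev]
        exact hcon _ ⟨e, rfl⟩
      have h0 := hw.ne_zero
      rw [h1] at h0
      rcases hw.isUnit_or_isUnit h1 with hu | hu
      · have := ((toPoly_isHomogeneous _).isUnit_iff (left_ne_zero_of_mul h0)).1 hu
        omega
      · have := ((toPoly_isHomogeneous _).isUnit_iff (right_ne_zero_of_mul h0)).1 hu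
        have := n.2
        omega
    refine ⟨a, ha, fun _ w hw A B hA hB hAB => ?_⟩
    obtain ⟨f, ⟨e, rfl⟩, hf⟩ := hS w hw (Sum.elim (fun e => coeff e.1 A) fun e => coeff e.1 B)
    rw [hev] at hf
    simp only [Sum.elim_inl, Sum.elim_inr] at hf
    rw [toPoly_coeff hA, toPoly_coeff hB, hAB, sub_self] at hf
    exact hf rfl
  choose a ha hS using key
  have hF0 : F ≠ 0 := by
    rintro rfl
    obtain ⟨w, hw⟩ := h.exists
    rw [map_zero] at hw
    exact hw.ne_zero rfl
  obtain ⟨e, he⟩ := ne_zero_iff.1 hF0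
  refine ⟨coeff e F * ∏ n, a n, mul_ne_zero he (Finset.prod_ne_zero_iff.2 fun n _ => ha n),
    fun w hw => ?_⟩
  rw [map_mul, map_prod, mul_ne_zero_iff, Finset.prod_ne_zero_iff] at hw
  by_contra hirr
  obtain ⟨n, hn, A, B, hAB, -, -, hA, hB⟩ := exists_factors_of_not_irreducible (hF.map (eval w)) hd
    (fun h0 => hw.1 (by rw [← coeff_map, h0, coeff_zero])) hirr
  exact hS n hn w (hw.2 n (Finset.mem_univ _)) A B hA hB hAB

theorem exists_generic_nice [Finite ι] [Nonempty ι] (hk : ∀ i, 1 ≤ k i) {d : ℕ}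
    (hF : F.IsHomogeneous d)
    (hfat : ∀ i, FatAt (k i) (x i) (y i) F)
    (h : Nice k (fun i => eval w₀ (x i)) (fun i => eval w₀ (y i)) (map (eval w₀) F)) :
    ∃ a : MvPolynomial τ ℂ, a ≠ 0 ∧ ∀ w, eval w a ≠ 0 →
      Nice k (fun i => eval w (x i)) (fun i => eval w (y i)) (map (eval w) F) := by
  have := Fintype.ofFinite ι
  have hd : d ≠ 0 := fun hd => h.irred.not_isUnit
    (((hF.map (eval w₀)).isUnit_iff h.irred.ne_zero).2 hd)
  have hcont : ∀ p : MvPolynomial τ ℂ, Tendsto (fun w => eval w p) (𝓝 w₀) (𝓝 (eval w₀ p)) :=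
    fun p => (MvPolynomial.continuous_eval p).tendsto w₀
  have hnear : ∀ᶠ w in 𝓝 w₀, Nice k (fun i => eval w (x i)) (fun i => eval w (y i))
      (map (eval w) F) := by
    refine eventually_nice (d := d) (MvPolynomial.IsHomogeneous.coeffTendsto (d := d)
      (fun w => hF.map (eval w)) (hF.map (eval w₀)) fun e => ?_) (fun w => hF.map (eval w))
      (tendsto_pi_nhds.2 fun i => hcont (x i)) (tendsto_pi_nhds.2 fun i => hcont (y i))
      (fun w i e he => ?_) h
    · simp only [coeff_map]
      exact hcont _
    · rw [← map_loc, coeff_map, hfat i e he, map_zero]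
  obtain ⟨a, ha, hsm⟩ := exists_generic_smooth hk hnear
  choose b hb hcone using exists_generic_cone hk hnear
  obtain ⟨c, hc, hirr⟩ := exists_generic_irreducible hd hF (hnear.mono fun w hw => hw.irred)
  refine ⟨a * c * ∏ i, b i,
    mul_ne_zero (mul_ne_zero ha hc) (Finset.prod_ne_zero_iff.2 fun i _ => hb i), fun w hw => ?_⟩
  rw [map_mul, map_mul, map_prod, mul_ne_zero_iff, mul_ne_zero_iff, Finset.prod_ne_zero_iff] at hw
  exact ⟨fun i => hcone i w (hw.2 i (Finset.mem_univ _)), fun Q _ hQ => hsm w hw.1.1 Q hQ,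
    hirr w hw.1.2⟩

end

theorem finrank_ker_mul_eq_trace {n m k : Type*} [Fintype n] [DecidableEq n] [Field k]
    {M : Matrix m n k} {N : Matrix n n k} {q : k} (hq : q ≠ 0) (hMN : M * N = 0)
    (hN : ∀ c, M.mulVec c = 0 → N.mulVec c = q • c) :
    (Module.finrank k (LinearMap.ker M.mulVecLin) : k) * q = N.trace := by
  have hp : LinearMap.IsProj (LinearMap.ker M.mulVecLin) (Matrix.toLin' (q⁻¹ • N)) := by
    constructor
    · intro c
      rw [LinearMap.mem_ker, Matrix.mulVecLin_apply, Matrix.toLin'_apply, Matrix.mulVec_mulVec,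
        Matrix.mul_smul, hMN, smul_zero, Matrix.zero_mulVec]
    · intro c hc
      rw [Matrix.toLin'_apply, Matrix.smul_mulVec, hN c hc, inv_smul_smul₀ hq]
  have := hp.trace
  rw [Matrix.trace_toLin'_eq, Matrix.trace_smul, smul_eq_mul] at this
  rw [← this, mul_assoc, mul_comm _ q, inv_mul_cancel_left₀ hq]

theorem finrank_ker_eq_of_kerMatrix {A n m : Type} [CommRing A] [IsDomain A] [Fintype n]
    [DecidableEq n] {M : Matrix m n A} {N : Matrix n n A} {q : A} (hq : q ≠ 0) (hMN : M * N = 0)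
    (hN : ∀ {k : Type} [Field k] (ε : A →+* k) (c : n → k), (M.map ε).mulVec c = 0 →
        (N.map ε).mulVec c = ε q • c) (ε ε' : A →+* ℂ) (hε : ε q ≠ 0) (hε₁ : ε' q ≠ 0) :
    Module.finrank ℂ (LinearMap.ker (M.map ε).mulVecLin) =
      Module.finrank ℂ (LinearMap.ker (M.map ε').mulVecLin) := by
  have key : ∀ {k : Type} [Field k] (ε : A →+* k), ε q ≠ 0 →
      (Module.finrank k (LinearMap.ker (M.map ε).mulVecLin) : k) * ε q = ε N.trace := by
    intro k _ ε hε
    rw [finrank_ker_mul_eq_trace hε (N := N.map ε) (by rw [← Matrix.map_mul, hMN]; simp) (hN ε)]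
    simp [Matrix.trace]
  set ρ := Module.finrank (FractionRing A)
    (LinearMap.ker (M.map (algebraMap A (FractionRing A))).mulVecLin)
  have hρ : N.trace = ρ * q := by
    apply IsFractionRing.injective A (FractionRing A)
    rw [← key (algebraMap A (FractionRing A)), map_mul, map_natCast]
    exact fun h => hq ((IsFractionRing.injective A (FractionRing A)) (by rw [h, map_zero]))
  have key' : ∀ ε : A →+* ℂ, ε q ≠ 0 →
      Module.finrank ℂ (LinearMap.ker (M.map ε).mulVecLin) = ρ := by
    intro ε hε
    have := key ε hε
    rw [hρ, map_mul, map_natCast] at this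
    exact_mod_cast mul_right_cancel₀ hε this
  exact (key' ε hε).trans (key' ε' hε₁).symm

/-- The systems `sys d x y (fats k)` are parametrized in such a way that the members with the wanted
properties correspond to the nonvanishing locus of a nonzero polynomial. -/
theorem exists_parametrization {ι : Type} [Fintype ι] [Nonempty ι] {d : ℕ} {k : ι → ℕ}
    (hk : ∀ i, 1 ≤ k i) (h : ∃ x y F, Good d k ∅ x y F) :
    ∃ (a : MvPolynomial ((ι ⊕ ι) ⊕ Idx d) ℂ) (q : (ι ⊕ ι → ℂ) → ℂ)
      (T : (ι ⊕ ι → ℂ) → (Idx d → ℂ) →ₗ[ℂ] (Idx d → ℂ)), a ≠ 0 ∧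
      ∀ p c₀, eval (Sum.elim p c₀) a ≠ 0 → q p ≠ 0 ∧ Function.Injective (fun i => p (Sum.inl i)) ∧
        (Module.finrank ℂ (sys d (fun i => p (Sum.inl i)) (fun i => p (Sum.inr i)) (fats k)) : ℤ) =
          chi d k ∧
        (∀ c, toPoly ℂ d (T p c) ∈
          sys d (fun i => p (Sum.inl i)) (fun i => p (Sum.inr i)) (fats k)) ∧
        (∀ c, toPoly ℂ d c ∈ sys d (fun i => p (Sum.inl i)) (fun i => p (Sum.inr i)) (fats k) →
          T p c = q p • c) ∧
        ∀ c, eval (Sum.elim p c) a ≠ 0 →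
          Nice k (fun i => p (Sum.inl i)) (fun i => p (Sum.inr i)) (toPoly ℂ d (T p c)) := by
  classical
  set M := condMatrix d (fun i => (X (Sum.inl i) : MvPolynomial (ι ⊕ ι) ℂ))
    (fun i => X (Sum.inr i)) (fats k) with hM
  obtain ⟨q, N, hq, hMN, hN⟩ := exists_kerMatrix M
  have hMp : ∀ p : ι ⊕ ι → ℂ, M.map (eval p) =
      condMatrix d (fun i => p (Sum.inl i)) (fun i => p (Sum.inr i)) (fats k) := by
    intro p
    rw [hM, condMatrix_map]
    simp only [eval_X]
  obtain ⟨p₀, G, hqp, hG⟩ : ∃ (p₀ : ι ⊕ ι → ℂ) (G : MvPolynomial (Fin 3) ℂ), eval p₀ q ≠ 0 ∧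
      Good d k ∅ (fun i => p₀ (Sum.inl i)) (fun i => p₀ (Sum.inr i)) G := by
    obtain ⟨x, y, F, hF⟩ := h
    obtain ⟨p₁, hp₁⟩ : ∃ p, eval p q ≠ 0 := by
      by_contra! h
      exact hq (MvPolynomial.funext fun Q => by rw [h Q, map_zero])
    obtain ⟨g, hg⟩ := exists_eval_line q (Sum.elim x y) p₁
    have hg0 : g ≠ 0 := fun h => hp₁ <| by
      have := hg 1
      rw [h, Polynomial.eval_zero] at this
      rw [this]
      simp
    have hev := hF.eventually_exists (B := ∅)
      (x := fun i => Polynomial.C (x i) + Polynomial.X * Polynomial.C (p₁ (Sum.inl i) - x i))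
      (y := fun i => Polynomial.C (y i) + Polynomial.X * Polynomial.C (p₁ (Sum.inr i) - y i))
      (Finset.Subset.refl _) (fun i => by simp) (fun i => by simp) (by simp) fun i _ h0 => by
        have := congrArg (Polynomial.eval 0) h0
        simp only [Polynomial.eval_add, Polynomial.eval_C, Polynomial.eval_mul, Polynomial.eval_X,
          zero_mul, add_zero, Polynomial.eval_zero] at this
        simpa using (hF.on_iff i).1 this
    obtain ⟨t, ⟨G, hG⟩, ht⟩ := (hev.and (eventually_eval_ne_zero hg0 0)).exists
    refine ⟨_, G, by rwa [hg] at ht, ?_⟩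
    simpa using hG
  have hdim : ∀ p, eval p q ≠ 0 → (Module.finrank ℂ (sys d (fun i => p (Sum.inl i))
      (fun i => p (Sum.inr i)) (fats k)) : ℤ) = chi d k := by
    intro p hp
    rw [← hG.dim, sys_eq_map, sys_eq_map, finrank_map_toPoly, finrank_map_toPoly, ← hMp, ← hMp,
      finrank_ker_eq_of_kerMatrix hq hMN hN (eval p) (eval p₀) hp hqp]
  have hNp : ∀ p c, toPoly ℂ d ((N.map (eval p)).mulVec c) ∈
      sys d (fun i => p (Sum.inl i)) (fun i => p (Sum.inr i)) (fats k) := by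
    intro p c
    rw [toPoly_mem_sys_iff, ← hMp, Matrix.mulVec_mulVec, ← Matrix.map_mul, hMN]
    simp
  have hNq : ∀ p c, toPoly ℂ d c ∈ sys d (fun i => p (Sum.inl i)) (fun i => p (Sum.inr i)) (fats k)
      →
      (N.map (eval p)).mulVec c = eval p q • c := by
    intro p c hc
    rw [toPoly_mem_sys_iff, ← hMp] at hc
    exact hN (eval p) c hc
  let j : MvPolynomial (ι ⊕ ι) ℂ →+* MvPolynomial ((ι ⊕ ι) ⊕ Idx d) ℂ := (rename Sum.inl).toRingHom
  let F : MvPolynomial (Fin 3) (MvPolynomial ((ι ⊕ ι) ⊕ Idx d) ℂ) :=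
    toPoly _ d ((N.map j).mulVec fun e => X (Sum.inr e))
  have hfat : F ∈ sys d (fun i => X (Sum.inl (Sum.inl i))) (fun i => X (Sum.inl (Sum.inr i)))
      (fats k) := by
    have h1 : M.map j = condMatrix d (fun i => X (Sum.inl (Sum.inl i)))
        (fun i => X (Sum.inl (Sum.inr i))) (fats k) := by
      rw [hM, condMatrix_map]
      simp [j]
    rw [toPoly_mem_sys_iff, ← h1, Matrix.mulVec_mulVec, ← Matrix.map_mul, hMN]
    simp
  have hFw : ∀ p c, map (eval (Sum.elim p c)) F = toPoly ℂ d ((N.map (eval p)).mulVec c) := by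
    intro p c
    rw [map_toPoly]
    congr 1
    funext e
    rw [RingHom.map_mulVec]
    congr 1
    · ext a b
      simp [j, eval_rename, Function.comp_def]
    · funext e
      simp
  rw [mem_sys_fats] at hfat
  obtain ⟨a, ha, hnice⟩ := exists_generic_nice
    (w₀ := Sum.elim p₀ fun e => (eval p₀ q)⁻¹ • coeff e.1 G) hk hfat.1 hfat.2 (by
      rw [hFw]
      have h1 := hNq p₀ (fun e => coeff e.1 G) (by
        rw [toPoly_coeff hG.hom, mem_sys_fats]; exact ⟨hG.hom, hG.fat⟩)
      have h2 : (N.map (eval p₀)).mulVec (fun e => (eval p₀ q)⁻¹ • coeff e.1 G) =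
          fun e : Idx d => coeff e.1 G := by
        rw [show (fun e : Idx d => (eval p₀ q)⁻¹ • coeff e.1 G) =
          (eval p₀ q)⁻¹ • fun e : Idx d => coeff e.1 G from rfl, Matrix.mulVec_smul, h1,
          inv_smul_smul₀ hqp]
      rw [h2, toPoly_coeff hG.hom]
      simpa using hG.nice)
  let δ : MvPolynomial (ι ⊕ ι) ℂ :=
    ∏ e ∈ Finset.univ.filter (fun e : ι × ι => e.1 ≠ e.2), (X (Sum.inl e.1) - X (Sum.inl e.2))
  have hδ : δ ≠ 0 := Finset.prod_ne_zero_iff.2 fun e he h0 => (Finset.mem_filter.1 he).2 <| by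
    simpa using X_injective (sub_eq_zero.1 h0)
  have hj : ∀ b : MvPolynomial (ι ⊕ ι) ℂ, b ≠ 0 → j b ≠ 0 := fun b hb h0 =>
    hb (rename_injective _ Sum.inl_injective (h0.trans (map_zero _).symm))
  have hje : ∀ b p c, eval (Sum.elim p c) (j b) = eval p b := fun b p c => by
    simp [j, eval_rename, Function.comp_def]
  refine ⟨a * j q * j δ, fun p => eval p q, fun p => (N.map (eval p)).mulVecLin,
    mul_ne_zero (mul_ne_zero ha (hj q hq)) (hj δ hδ), fun p c₀ hc₀ => ?_⟩
  simp only [map_mul, mul_ne_zero_iff, hje] at hc₀ ⊢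
  refine ⟨hc₀.1.2, fun i i' hii => ?_, hdim p hc₀.1.2, hNp p, hNq p, fun c hc => ?_⟩
  · by_contra hne
    refine hc₀.2 ?_
    rw [map_prod]
    exact Finset.prod_eq_zero (i := (i, i')) (by simpa using hne) (by simpa [sub_eq_zero] using hii)
  · have := hnice _ hc.1.1
    rw [hFw] at this
    simpa using this

theorem exists_zero_of_binary {n : ℕ} (hn : n ≠ 0) {q : MvPolynomial (Fin 2) ℂ}
    (hq : q.IsHomogeneous n) : ∃ v : Fin 2 → ℂ, v ≠ 0 ∧ eval v q = 0 := by
  obtain ⟨R, hR⟩ := exists_eval_line q ![1, 0] ![1, 1]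
  obtain ⟨P, hP⟩ := exists_eval_line q ![0, 1] ![1, 1]
  have hR' : ∀ t, R.eval t = eval ![1, t] q := fun t => by
    rw [hR]
    congr 2
    funext j
    fin_cases j <;> simp
  have hP' : ∀ t, P.eval t = eval ![t, 1] q := fun t => by
    rw [hP]
    congr 2
    funext j
    fin_cases j <;> simp
  by_cases hdeg : 0 < R.degree
  · obtain ⟨t, ht⟩ := Complex.exists_root hdeg
    exact ⟨![1, t], fun h => one_ne_zero (congrFun h 0), by rw [← hR']; exact ht⟩
  · have hc := Polynomial.eq_C_of_degree_le_zero (not_lt.1 hdeg)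
    set c := R.coeff 0
    have hX : (P - Polynomial.C c * Polynomial.X ^ n) * Polynomial.X = 0 := by
      refine Polynomial.funext fun t => ?_
      by_cases ht : t = 0
      · simp [ht]
      · have h1 : (![t, 1] : Fin 2 → ℂ) = t • ![1, t⁻¹] := by
          funext j
          fin_cases j <;> simp [ht]
        have h2 : eval ![t, 1] q = c * t ^ n := by
          rw [h1, hq.eval_smul, ← hR', hc]
          simp [mul_comm]
        simp [hP', h2]
    have hPc := sub_eq_zero.1 ((mul_eq_zero.1 hX).resolve_right Polynomial.X_ne_zero)
    refine ⟨![0, 1], fun h => one_ne_zero (congrFun h 1), ?_⟩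
    rw [← hP', hPc]
    simp [hn]

theorem squarefree_of_binary {n : ℕ} {g : MvPolynomial (Fin 2) ℂ} (hg : g.IsHomogeneous n)
    (h0 : g ≠ 0) (h : ∀ v : Fin 2 → ℂ, v ≠ 0 → ∃ j, eval v (pderiv j g) ≠ 0) : Squarefree g := by
  rintro q ⟨s, hs⟩
  rw [mul_assoc] at hs
  have h1 : q * (q * s) ≠ 0 := hs ▸ h0
  obtain ⟨e, he⟩ := MvPolynomial.IsHomogeneous.of_mul_left (hs ▸ hg) h1
  rw [he.isUnit_iff (left_ne_zero_of_mul h1)]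
  by_contra hne
  obtain ⟨v, hv, hqv⟩ := exists_zero_of_binary hne he
  obtain ⟨j, hj⟩ := h v hv
  refine hj ?_
  rw [hs]
  simp [hqv]

theorem hasOrdinarySingularity_of_reducedCone {k : ℕ} (hk : 1 ≤ k) {P : Proj2} (hP : P.rep 2 ≠ 0)
    {F : MvPolynomial (Fin 3) ℂ} (hfat : FatAt k (P.rep 0 / P.rep 2) (P.rep 1 / P.rep 2) F)
    (hc : ReducedCone k (P.rep 0 / P.rep 2) (P.rep 1 / P.rep 2) F) :
    HasOrdinarySingularity k P F := by
  set x := P.rep 0 / P.rep 2 with hx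
  set y := P.rep 1 / P.rep 2 with hy
  have hA : (!![1, 0, x; 0, 1, y; 0, 0, 1] : Matrix (Fin 3) (Fin 3) ℂ).mulVec ![0, 0, 1] =
      ![x, y, 1] := by
    funext j
    fin_cases j <;> simp [Matrix.mulVec, dotProduct, Fin.sum_univ_three]
  have hchart : chartPoly !![1, 0, x; 0, 1, y; 0, 0, 1] F = loc x y F := by
    rw [chartPoly, loc]
    congr 2
    funext j
    fin_cases j <;> simp [Fin.sum_univ_three]
  have hne : (![x, y, 1] : Fin 3 → ℂ) ≠ 0 := fun h => one_ne_zero (congrFun h 2)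
  have h0 : homogeneousComponent k (loc x y F) ≠ 0 := fun h => by
    obtain ⟨j, hj⟩ := hc hk ![1, 0] fun h => one_ne_zero (congrFun h 0)
    rw [h, map_zero, map_zero] at hj
    exact hj rfl
  refine ⟨_, ?_, hA ▸ hne, ?_, ?_⟩
  · simp [Matrix.det_fin_three]
  · conv_rhs => rw [← P.mk_rep]
    rw [Projectivization.mk_eq_mk_iff']
    refine ⟨(P.rep 2)⁻¹, ?_⟩
    rw [hA]
    funext j
    fin_cases j <;> simp [hx, hy, hP, div_eq_inv_mul]
  · rw [hchart]
    refine ⟨fun j hj => ?_, h0, ?_⟩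
    · ext e
      rw [coeff_homogeneousComponent, coeff_zero]
      split_ifs with he
      · exact hfat e (he ▸ hj)
      · rfl
    · exact squarefree_of_binary (homogeneousComponent_isHomogeneous _ _) h0 (hc hk)

section
variable {V : Type*} [AddCommGroup V] [Module ℂ V]

theorem isOpen_vectorZariski {κ : Type*} [Fintype κ] (f : MvPolynomial κ ℂ) (φ : κ → V →ₗ[ℂ] ℂ) :
    IsOpen[vectorZariski V] {v | eval (fun i => φ i v) f ≠ 0} := by
  refine TopologicalSpace.GenerateOpen.basic _ ⟨Fintype.card κ, rename (Fintype.equivFin κ) f,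
    fun i => φ ((Fintype.equivFin κ).symm i), ?_⟩
  simp [eval_rename, Function.comp_def]

theorem exists_line_of_isOpen {O : Set V} (hO : IsOpen[vectorZariski V] O) (u : V) :
    ∀ v ∈ O, ∃ g : Polynomial ℂ, g ≠ 0 ∧ ∀ t, g.eval t ≠ 0 → v + t • (u - v) ∈ O := by
  change TopologicalSpace.GenerateOpen _ O at hO
  induction hO with
  | basic s hs =>
    obtain ⟨n, f, φ, rfl⟩ := hs
    intro v hv
    obtain ⟨g, hg⟩ := exists_eval_line f (fun i => φ i v) (fun i => φ i u)
    refine ⟨g, fun h => hv ?_, fun t ht => ?_⟩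
    · have := hg 0
      rw [h] at this
      simpa using this.symm
    · rw [hg] at ht
      simpa using ht
  | univ => exact fun v _ => ⟨1, one_ne_zero, fun t _ => Set.mem_univ _⟩
  | inter s t _ _ hs ht =>
    intro v hv
    obtain ⟨g, hg, h⟩ := hs v hv.1
    obtain ⟨g', hg', h'⟩ := ht v hv.2
    refine ⟨g * g', mul_ne_zero hg hg', fun t ht => ?_⟩
    rw [Polynomial.eval_mul, mul_ne_zero_iff] at ht
    exact ⟨h t ht.1, h' t ht.2⟩
  | sUnion S _ ih =>
    rintro v ⟨s, hs, hv⟩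
    obtain ⟨g, hg, h⟩ := ih s hs v hv
    exact ⟨g, hg, fun t ht => ⟨s, hs, h t ht⟩⟩

theorem vectorZariski_inter_nonempty {O₁ O₂ : Set V} (h₁ : IsOpen[vectorZariski V] O₁)
    (h₂ : IsOpen[vectorZariski V] O₂) (hne₁ : O₁.Nonempty) (hne₂ : O₂.Nonempty) :
    (O₁ ∩ O₂).Nonempty := by
  obtain ⟨v, hv⟩ := hne₁
  obtain ⟨u, hu⟩ := hne₂
  obtain ⟨g, hg, h⟩ := exists_line_of_isOpen h₁ u v hv
  obtain ⟨g', hg', h'⟩ := exists_line_of_isOpen h₂ v u hu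
  have hcomp : g'.comp (1 - Polynomial.X) ≠ 0 := fun h0 => hg' <| Polynomial.funext fun t => by
    have := congrArg (Polynomial.eval (1 - t)) h0
    simpa [Polynomial.eval_comp] using this
  obtain ⟨t, ht⟩ := (eventually_eval_ne_zero (mul_ne_zero hg hcomp) 0).exists
  simp only [Polynomial.eval_mul, Polynomial.eval_comp, Polynomial.eval_sub, Polynomial.eval_one,
    Polynomial.eval_X, mul_ne_zero_iff] at ht
  refine ⟨_, h t ht.1, ?_⟩
  convert h' _ ht.2 using 1
  module

theorem isOpen_and_dense_coinduced {Y : Type*} {p : V → Prop} {f : {v // p v} → Y}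
    (hf : Function.Surjective f) {O : Set V} (hO : IsOpen[vectorZariski V] O) (hne : O.Nonempty)
    (hOp : ∀ v ∈ O, p v) {U : Set Y} (hU : ∀ v, f v ∈ U ↔ v.1 ∈ O) :
    let _ := TopologicalSpace.coinduced f (TopologicalSpace.induced Subtype.val (vectorZariski V))
    IsOpen U ∧ Dense U := by
  let _ : TopologicalSpace V := vectorZariski V
  intro _
  constructor
  · refine isOpen_coinduced.2 (isOpen_induced_iff.2 ⟨O, hO, ?_⟩)
    ext v
    exact (hU v).symm
  · rw [dense_iff_inter_open]
    rintro S hS ⟨y, hy⟩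
    obtain ⟨O', hO', hOS⟩ := isOpen_induced_iff.1 (isOpen_coinduced.1 hS)
    have hmem : ∀ v, f v ∈ S ↔ v.1 ∈ O' := fun v => (Set.ext_iff.1 hOS v).symm
    obtain ⟨w, rfl⟩ := hf y
    obtain ⟨v, hv', hv⟩ := vectorZariski_inter_nonempty hO' hO ⟨w.1, (hmem w).1 hy⟩ hne
    exact ⟨f ⟨v, hOp v hv⟩, (hmem _).2 hv', (hU _).2 hv⟩

end

theorem exists_clear_denominators {ι : Type*} [Fintype ι] (f : MvPolynomial (ι ⊕ ι) ℂ) :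
    ∃ N : ℕ, ∀ n ≥ N, ∃ h : MvPolynomial (ι × Fin 3) ℂ, ∀ v : ι → Fin 3 → ℂ, (∀ i, v i 2 ≠ 0) →
      eval (fun e => v e.1 e.2) h = (∏ i, v i 2) ^ n *
        eval (Sum.elim (fun i => v i 0 / v i 2) fun i => v i 1 / v i 2) f := by
  classical
  induction f using MvPolynomial.induction_on with
  | C c => exact ⟨0, fun n _ => ⟨(∏ i, X (i, 2)) ^ n * C c, fun v _ => by simp⟩⟩
  | add p q hp hq =>
    obtain ⟨N, h⟩ := hp
    obtain ⟨N', h'⟩ := hq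
    refine ⟨max N N', fun n hn => ?_⟩
    obtain ⟨P, hP⟩ := h n (le_of_max_le_left hn)
    obtain ⟨Q, hQ⟩ := h' n (le_of_max_le_right hn)
    exact ⟨P + Q, fun v hv => by rw [map_add, hP v hv, hQ v hv, map_add, mul_add]⟩
  | mul_X p i hp =>
    obtain ⟨N, h⟩ := hp
    refine ⟨N + 1, fun n hn => ?_⟩
    obtain ⟨n, rfl⟩ : ∃ n', n = n' + 1 := ⟨n - 1, by omega⟩
    obtain ⟨P, hP⟩ := h n (by omega)
    rcases i with i | i
    · refine ⟨P * X (i, 0) * ∏ j ∈ Finset.univ.erase i, X (j, 2), fun v hv => ?_⟩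
      simp only [map_mul, hP v hv, eval_X, map_prod, Sum.elim_inl]
      rw [pow_succ, ← Finset.mul_prod_erase Finset.univ (fun i => v i 2) (Finset.mem_univ i)]
      field_simp [hv i]
    · refine ⟨P * X (i, 1) * ∏ j ∈ Finset.univ.erase i, X (j, 2), fun v hv => ?_⟩
      simp only [map_mul, hP v hv, eval_X, map_prod, Sum.elim_inr]
      rw [pow_succ, ← Finset.mul_prod_erase Finset.univ (fun i => v i 2) (Finset.mem_univ i)]
      field_simp [hv i]

theorem isOpen_affine {ι : Type*} [Fintype ι] (f : MvPolynomial (ι ⊕ ι) ℂ) :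
    IsOpen[vectorZariski (ι → Fin 3 → ℂ)] {v | (∀ i, v i 2 ≠ 0) ∧
      eval (Sum.elim (fun i => v i 0 / v i 2) fun i => v i 1 / v i 2) f ≠ 0} := by
  obtain ⟨N, h⟩ := exists_clear_denominators f
  obtain ⟨P, hP⟩ := h N le_rfl
  convert isOpen_vectorZariski (V := ι → Fin 3 → ℂ) (P * ∏ i, X (i, 2))
    (fun e => LinearMap.proj e.2 ∘ₗ LinearMap.proj e.1) using 1
  ext v
  simp only [Set.mem_ofPred_eq, LinearMap.comp_apply, LinearMap.proj_apply, map_mul, map_prod,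
      eval_X,
    mul_ne_zero_iff, Finset.prod_ne_zero_iff, Finset.mem_univ, true_implies]
  rw [and_comm]
  refine and_congr_left fun hv => ?_
  rw [hP v hv, mul_ne_zero_iff]
  exact (and_iff_right (pow_ne_zero _ (Finset.prod_ne_zero_iff.2 fun i _ => hv i))).symm

theorem Projectivization.exists_rep_mk_eq_smul {V : Type*} [AddCommGroup V] [Module ℂ V]
    {v : V} (hv : v ≠ 0) :
    ∃ c : ℂ, c ≠ 0 ∧ (Projectivization.mk ℂ v hv).rep = c • v := by
  obtain ⟨u, hu⟩ := Projectivization.exists_smul_eq_mk_rep ℂ v hv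
  exact ⟨u, u.ne_zero, hu.symm⟩

theorem Projectivization.eq_of_rep_eq_smul {V : Type*} [AddCommGroup V] [Module ℂ V]
    {P Q : Projectivization ℂ V} {c : ℂ} (h : Q.rep = c • P.rep) : Q = P := by
  rw [← P.mk_rep, ← Q.mk_rep, Projectivization.mk_eq_mk_iff']
  exact ⟨c, h.symm⟩

theorem smoothAwayFrom_of_nice {r : ℕ} {P : Fin r → Proj2} {k : Fin r → ℕ}
    (hP : ∀ i, (P i).rep 2 ≠ 0) {F : MvPolynomial (Fin 3) ℂ}
    (hF : Nice k (fun i => (P i).rep 0 / (P i).rep 2) (fun i => (P i).rep 1 / (P i).rep 2) F) :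
    SmoothAwayFrom F P := by
  intro Q _ hQ
  by_contra! h
  obtain ⟨i, -, c, hc⟩ := hF.smooth Q.rep Q.rep_nonzero h
  refine hQ i (Projectivization.eq_of_rep_eq_smul (c := c / (P i).rep 2) ?_)
  rw [hc]
  have := hP i
  ext j
  fin_cases j <;> simp <;> field_simp

theorem eval_aeval {σ τ : Type*} (x : τ → ℂ) (g : σ → MvPolynomial τ ℂ) (f : MvPolynomial σ ℂ) :
    eval x (aeval g f) = eval (fun i => eval x (g i)) f := by
  induction f using MvPolynomial.induction_on <;> simp_all

theorem isOpen_exists_smul_add {V κ : Type*} [AddCommGroup V] [Module ℂ V] [Fintype κ]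
    (φ : V →ₗ[ℂ] (κ → ℂ)) (S : Set (κ → ℂ)) (f : MvPolynomial κ ℂ) :
    IsOpen[vectorZariski V] {v | ∃ l : ℂ, l ≠ 0 ∧ ∃ c, c ∈ S ∧ eval (l • φ v + c) f ≠ 0} := by
  have : {v | ∃ l : ℂ, l ≠ 0 ∧ ∃ c, c ∈ S ∧ eval (l • φ v + c) f ≠ 0} =
      ⋃ (l : ℂ) (_ : l ≠ 0) (c : κ → ℂ) (_ : c ∈ S),
        {v | eval (φ v) (aeval (fun e => C l * X e + C (c e)) f) ≠ 0} := by
    ext v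
    simp only [Set.mem_ofPred_eq, Set.mem_iUnion, exists_prop]
    refine exists_congr fun l => and_congr_right fun _ => exists_congr fun c =>
      and_congr_right fun _ => not_congr ?_
    rw [eval_aeval]
    simp [Pi.add_def, Pi.smul_def]
  rw [this]
  have hbasic : ∀ g : MvPolynomial κ ℂ, IsOpen[vectorZariski V] {v | eval (φ v) g ≠ 0} := by
    intro g
    have := isOpen_vectorZariski g fun e => LinearMap.proj (R := ℂ) e ∘ₗ φ
    exact this
  let _ : TopologicalSpace V := vectorZariski V
  exact isOpen_iUnion fun l => isOpen_iUnion fun _ => isOpen_iUnion fun c => isOpen_iUnion fun _ =>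
    hbasic _

theorem exists_dense_open_nice {d r : ℕ} {P : Fin r → Proj2} {k : Fin r → ℕ}
    (hk : ∀ i, 1 ≤ k i) (hP : ∀ i, (P i).rep 2 ≠ 0) {q : ℂ} (hq : q ≠ 0)
    (T : (Idx d → ℂ) →ₗ[ℂ] (Idx d → ℂ)) {f : MvPolynomial (Idx d) ℂ} (hf : ∃ c, eval c f ≠ 0)
    (hT : ∀ c, toPoly ℂ d (T c) ∈ Lspace d P k)
    (hTq : ∀ c, toPoly ℂ d c ∈ Lspace d P k → T c = q • c)
    (hnice : ∀ c, eval c f ≠ 0 → Nice k (fun i => (P i).rep 0 / (P i).rep 2)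
      (fun i => (P i).rep 1 / (P i).rep 2) (toPoly ℂ d (T c))) :
    ∃ W : Set (Projectivization ℂ (Lspace d P k)),
      @IsOpen _ (projZariski (Lspace d P k)) W ∧ @Dense _ (projZariski (Lspace d P k)) W ∧
      ∀ w ∈ W, ∃ (F : MvPolynomial (Fin 3) ℂ) (hF : F ∈ Lspace d P k)
          (hne : (⟨F, hF⟩ : Lspace d P k) ≠ 0),
        Projectivization.mk ℂ (⟨F, hF⟩ : Lspace d P k) hne = w ∧ Irreducible F ∧
        (∀ i, HasOrdinarySingularity (k i) (P i) F) ∧ SmoothAwayFrom F P := by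
  obtain ⟨co, hco⟩ : ∃ co : Lspace d P k →ₗ[ℂ] (Idx d → ℂ), ∀ F, toPoly ℂ d (co F) = F.1 :=
    ⟨LinearMap.pi fun e => lcoeff ℂ e.1 ∘ₗ (Lspace d P k).subtype, fun F =>
      toPoly_coeff ((mem_homogeneousSubmodule _ _).1 F.2.1)⟩
  have hTco : ∀ F : Lspace d P k, T (co F) = q • co F := fun F => hTq _ (by rw [hco]; exact F.2)
  let O : Set (Lspace d P k) :=
    {F | ∃ l : ℂ, l ≠ 0 ∧ ∃ κ, T κ = 0 ∧ eval (l • co F + κ) f ≠ 0}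
  have hmk : ∀ F ∈ O, ∃ l : ℂ, l ≠ 0 ∧ Nice k (fun i => (P i).rep 0 / (P i).rep 2)
      (fun i => (P i).rep 1 / (P i).rep 2) (l • F.1) := by
    rintro F ⟨l, hl, κ, hκ, h⟩
    refine ⟨l * q, mul_ne_zero hl hq, ?_⟩
    have := hnice _ h
    rwa [map_add, hκ, add_zero, map_smul, hTco, map_smul, map_smul, hco, smul_smul] at this
  have hO : IsOpen[vectorZariski (Lspace d P k)] O :=
    isOpen_exists_smul_add co {κ | T κ = 0} f
  have hO0 : ∀ F ∈ O, F ≠ 0 := by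
    rintro F hF rfl
    obtain ⟨l, -, h⟩ := hmk _ hF
    simpa using h.irred.ne_zero
  have hOsmul : ∀ (c : ℂ) (F : Lspace d P k), c ≠ 0 → c • F ∈ O → F ∈ O := by
    rintro c F hc ⟨l, hl, κ, hκ, h⟩
    refine ⟨l * c, mul_ne_zero hl hc, κ, hκ, ?_⟩
    rwa [map_smul, smul_smul] at h
  have hne : O.Nonempty := by
    obtain ⟨c, hc⟩ := hf
    have h1 : co ⟨_, hT c⟩ = T c := toPoly_injective ℂ d (hco _)
    refine ⟨⟨_, hT c⟩, q⁻¹, inv_ne_zero hq, c - q⁻¹ • T c, ?_, ?_⟩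
    · rw [map_sub, map_smul, hTq _ (hT c), inv_smul_smul₀ hq, sub_self]
    · rwa [h1, add_sub_cancel]
  refine ⟨{w | w.rep ∈ O}, and_assoc.1 ⟨isOpen_and_dense_coinduced
    (f := fun v : {v : Lspace d P k // v ≠ 0} => Projectivization.mk ℂ v.1 v.2)
    (fun w => ⟨⟨w.rep, w.rep_nonzero⟩, w.mk_rep⟩) hO hne hO0 fun v => ?_, fun w hw => ?_⟩⟩
  · obtain ⟨c, hc, h⟩ := Projectivization.exists_rep_mk_eq_smul v.2
    rw [Set.mem_ofPred_eq, h]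
    refine ⟨hOsmul c _ hc, fun hv => hOsmul c⁻¹ _ (inv_ne_zero hc) ?_⟩
    rwa [inv_smul_smul₀ hc]
  · obtain ⟨l, hl, h⟩ := hmk _ hw
    refine ⟨_, (l • w.rep).2, smul_ne_zero hl w.rep_nonzero, ?_, h.irred, fun i => ?_,
      smoothAwayFrom_of_nice hP h⟩
    · conv_rhs => rw [← w.mk_rep]
      rw [Projectivization.mk_eq_mk_iff']
      exact ⟨l, rfl⟩
    · refine hasOrdinarySingularity_of_reducedCone (hk i) (hP i) ?_ (h.cone i)
      exact (mem_sys_fats.1 ((Lspace_eq_sys P k hP).le (l • w.rep).2)).2 i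

theorem chi_eq {r : ℕ} (d : ℕ) (k : Fin r → ℕ) :
    ((d : ℤ) + 1) * ((d : ℤ) + 2) / 2 - ∑ i, (k i : ℤ) * ((k i : ℤ) + 1) / 2 = chi d k := by
  have key : ∀ n : ℕ, (n : ℤ) * ((n : ℤ) + 1) / 2 = ((n + 1).choose 2 : ℕ) := by
    intro n
    rw [Nat.choose_two_right, Nat.add_sub_cancel, mul_comm (n + 1)]
    push_cast
    rfl
  rw [chi]
  simp only [key]
  rw [← key]
  push_cast
  ring_nf

theorem exists_dense_open_tuples {r : ℕ} {κ : Type} [Finite κ]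
    {a : MvPolynomial ((Fin r ⊕ Fin r) ⊕ κ) ℂ} (ha : a ≠ 0) :
    ∃ U : Set (Fin r → Proj2), @IsOpen _ (projTupleZariski r) U ∧ @Dense _ (projTupleZariski r) U ∧
      ∀ P ∈ U, (∀ i, (P i).rep 2 ≠ 0) ∧ ∃ c, eval (Sum.elim (Sum.elim
        (fun i => (P i).rep 0 / (P i).rep 2) fun i => (P i).rep 1 / (P i).rep 2) c) a ≠ 0 := by
  let O : Set (Fin r → Fin 3 → ℂ) := {v | (∀ i, v i 2 ≠ 0) ∧ ∃ c, eval (Sum.elim (Sum.elim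
    (fun i => v i 0 / v i 2) fun i => v i 1 / v i 2) c) a ≠ 0}
  have hO : IsOpen[vectorZariski (Fin r → Fin 3 → ℂ)] O := by
    have : O = ⋃ c : κ → ℂ, {v | (∀ i, v i 2 ≠ 0) ∧ eval (Sum.elim (fun i => v i 0 / v i 2)
        fun i => v i 1 / v i 2) (aeval (Sum.elim X fun e => C (c e)) a) ≠ 0} := by
      ext v
      simp only [O, Set.mem_ofPred_eq, Set.mem_iUnion, exists_and_left]
      refine and_congr_right fun _ => exists_congr fun c => not_congr ?_
      rw [eval_aeval]
      refine Eq.congr_left (congrArg (eval · a) ?_)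
      ext (i | i) <;> simp
    rw [this]
    let _ := vectorZariski (Fin r → Fin 3 → ℂ)
    exact isOpen_iUnion fun c => isOpen_affine _
  have hne : O.Nonempty := by
    obtain ⟨w, hw⟩ : ∃ w, eval w a ≠ 0 := by
      by_contra! h
      exact ha (MvPolynomial.funext fun w => by rw [h w, map_zero])
    refine ⟨fun i => ![w (Sum.inl (Sum.inl i)), w (Sum.inl (Sum.inr i)), 1], by simp,
      fun e => w (Sum.inr e), ?_⟩
    convert hw using 2
    refine congrArg eval ?_
    ext ((i | i) | i) <;> simp
  have hsmul : ∀ (c : Fin r → ℂ) (v : Fin r → Fin 3 → ℂ), (∀ i, c i ≠ 0) →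
      ((fun i => c i • v i) ∈ O ↔ v ∈ O) := by
    intro c v hc
    simp [O, mul_div_mul_left _ _ (hc _), hc]
  refine ⟨{P | (fun i => (P i).rep) ∈ O}, and_assoc.1 ⟨isOpen_and_dense_coinduced
    (f := fun v : {v : Fin r → Fin 3 → ℂ // ∀ i, v i ≠ 0} =>
      fun i => Projectivization.mk ℂ (v.1 i) (v.2 i))
    (fun P => ⟨⟨fun i => (P i).rep, fun i => (P i).rep_nonzero⟩, funext fun i => (P i).mk_rep⟩)
    hO hne (fun v hv i h0 => hv.1 i (by rw [h0]; rfl)) fun v => ?_, fun P hP => hP⟩⟩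
  choose c hc h using fun i => Projectivization.exists_rep_mk_eq_smul (v.2 i)
  rw [Set.mem_ofPred_eq]
  simp only [h]
  exact hsmul c _ hc

end

/-- For every positive integer `m` there is a degree bound `D` such that for
all `d ≥ D`, `r ≥ 1` and multiplicities `1 ≤ mᵢ ≤ m` with
`χ = (d+1)(d+2)/2 − Σ mᵢ(mᵢ+1)/2 ≥ 1`, there is a dense Zariski-open set `U` of `r`-tuples of
pairwise distinct points such that for `(P₁, …, P_r) ∈ U` the space `L_d(P, m)` has dimension
exactly `χ`, and a dense Zariski-open subset of its projectivization consists of classes of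
irreducible polynomials with an ordinary singularity of multiplicity exactly `mᵢ` at each
`Pᵢ` and whose zero curve is smooth away from the `Pᵢ`. -/
theorem generic_curve_irreducible_with_ordinary_singularities :
    ∀ m : ℕ, 1 ≤ m → ∃ D : ℕ, ∀ d : ℕ, D ≤ d → ∀ r : ℕ, 1 ≤ r →
      ∀ mi : Fin r → ℕ, (∀ i, 1 ≤ mi i ∧ mi i ≤ m) →
        1 ≤ ((d : ℤ) + 1) * ((d : ℤ) + 2) / 2 - ∑ i, (mi i : ℤ) * ((mi i : ℤ) + 1) / 2 →
        ∃ U : Set (Fin r → Proj2),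
          @IsOpen _ (projTupleZariski r) U ∧ @Dense _ (projTupleZariski r) U ∧
          ∀ P ∈ U, Function.Injective P ∧
            (Module.finrank ℂ (Lspace d P mi) : ℤ) =
              ((d : ℤ) + 1) * ((d : ℤ) + 2) / 2 - ∑ i, (mi i : ℤ) * ((mi i : ℤ) + 1) / 2 ∧
            ∃ W : Set (Projectivization ℂ (Lspace d P mi)),
              @IsOpen _ (projZariski (Lspace d P mi)) W ∧
              @Dense _ (projZariski (Lspace d P mi)) W ∧
              ∀ w ∈ W, ∃ (F : MvPolynomial (Fin 3) ℂ) (hF : F ∈ Lspace d P mi)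
                  (hne : (⟨F, hF⟩ : Lspace d P mi) ≠ 0),
                Projectivization.mk ℂ (⟨F, hF⟩ : Lspace d P mi) hne = w ∧
                Irreducible F ∧
                (∀ i, HasOrdinarySingularity (mi i) (P i) F) ∧
                SmoothAwayFrom F P := by
  intro m hm
  refine ⟨mainDeg m, fun d hd r hr mi hmi hchi => ?_⟩
  rw [chi_eq] at hchi ⊢
  have : Nonempty (Fin r) := ⟨⟨0, hr⟩⟩
  obtain ⟨a, q, T, ha, h⟩ := exists_parametrization (fun i => (hmi i).1)
    (exists_good hm (fun i => (hmi i).1) (fun i => (hmi i).2) hd hchi)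
  obtain ⟨U, hUo, hUd, hU⟩ := exists_dense_open_tuples ha
  refine ⟨U, hUo, hUd, fun P hPU => ?_⟩
  obtain ⟨hP, c₀, hc₀⟩ := hU P hPU
  obtain ⟨hq, hinj, hdim, hT, hTq, hnice⟩ := h _ _ hc₀
  simp only [Sum.elim_inl, Sum.elim_inr] at hinj hdim hT hTq hnice
  have hL := Lspace_eq_sys (d := d) P mi hP
  replace hdim : (Module.finrank ℂ (Lspace d P mi) : ℤ) = chi d mi := by rw [hL]; exact hdim
  rw [← hL] at hT hTq
  set p : Fin r ⊕ Fin r → ℂ :=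
    Sum.elim (fun i => (P i).rep 0 / (P i).rep 2) fun i => (P i).rep 1 / (P i).rep 2
  have hev : ∀ c, eval c (aeval (Sum.elim (fun i => C (p i)) X) a) = eval (Sum.elim p c) a := by
    intro c
    rw [eval_aeval]
    refine congrArg (eval · a) ?_
    ext (i | i) <;> simp
  refine ⟨fun i j hij => hinj (by simp only [hij]), hdim,
    exists_dense_open_nice (fun i => (hmi i).1) hP hq (T p)
      (f := aeval (Sum.elim (fun i => C (p i)) X) a) ⟨c₀, by rwa [hev]⟩ hT hTq fun c hc => ?_⟩
  exact hnice c (by rwa [hev] at hc)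

end
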